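/- Let x > 0 be real and let N1, N2 ≥ 0 be even integers with N = N1 + N2 and n = N/2. Assume normalized ground-state vectors ψ_{N1}, ψ_{N2}, ψ_N of the XXZ Hamiltonians H_{N1}(x), H_{N2}(x), H_N(x) exist. Then the overlap satisfies O_{N1,N2} = γ_{N1} · γ_{N2} · det_{i,j=1}^{n} ( (x−1)² C(i+j−2, 2j−i−1) + x · C(i+j, 2j−i) ). -/

import Mathlib

open scoped Classical

noncomputable section

/-- Spin configurations of an `N`-site chain: `0` encodes `↑`, `1` encodes `↓`. -/
abbrev Conf (N : ℕ) := Fin N → Fin 2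

def pauliX : Matrix (Fin 2) (Fin 2) ℂ := !![0, 1; 1, 0]
def pauliY : Matrix (Fin 2) (Fin 2) ℂ := !![0, -Complex.I; Complex.I, 0]
def pauliZ : Matrix (Fin 2) (Fin 2) ℂ := !![1, 0; 0, -1]

/-- The operator acting as `A` on site `i` and as the identity elsewhere. -/
def siteOp (N : ℕ) (i : Fin N) (A : Matrix (Fin 2) (Fin 2) ℂ) :
    Matrix (Conf N) (Conf N) ℂ :=
  Matrix.of fun α β =>
    A (α i) (β i) * ∏ j ∈ Finset.univ.erase i, (if α j = β j then (1 : ℂ) else 0)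

/-- Left boundary field `p = (1/2)(1/2 − x)`. -/
def pL (x : ℝ) : ℝ := (1/2) * (1/2 - x)

/-- Right boundary field `p̄ = (1/2)(1/2 − 1/x)`. -/
def pR (x : ℝ) : ℝ := (1/2) * (1/2 - 1/x)

/-- The open XXZ Hamiltonian at `Δ = −1/2` with diagonal boundary fields. -/
def XXZ (N : ℕ) (hN : 0 < N) (x : ℝ) : Matrix (Conf N) (Conf N) ℂ :=
  (-(1/2) : ℂ) • (∑ i : Fin (N-1),
      (siteOp N ⟨i.1, by have := i.2; omega⟩ pauliX *
          siteOp N ⟨i.1+1, by have := i.2; omega⟩ pauliX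
        + siteOp N ⟨i.1, by have := i.2; omega⟩ pauliY *
          siteOp N ⟨i.1+1, by have := i.2; omega⟩ pauliY
        - (1/2 : ℂ) • (siteOp N ⟨i.1, by have := i.2; omega⟩ pauliZ *
          siteOp N ⟨i.1+1, by have := i.2; omega⟩ pauliZ)))
  + ((pL x : ℝ) : ℂ) • siteOp N ⟨0, hN⟩ pauliZ
  + ((pR x : ℝ) : ℂ) • siteOp N ⟨N-1, by omega⟩ pauliZ

/-- The special eigenvalue `E₀`. -/
def E0 (N : ℕ) (x : ℝ) : ℝ := -(3*(N:ℝ) - 1)/4 - (1-x)^2/(2*x)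

/-- The basis state with `⌊N/2⌋` down spins followed by `⌈N/2⌉` up spins. -/
def baseState (N : ℕ) : Conf N := fun i => if i.1 < N/2 then 1 else 0

/-- `ψ` is a normalized ground-state vector of `H_N(x)`; for `N = 0` it is the
scalar `1` by convention. -/
def IsGroundState (N : ℕ) (x : ℝ) (ψ : Conf N → ℂ) : Prop :=
  if h : 0 < N then
    (XXZ N h x).mulVec ψ = ((E0 N x : ℝ) : ℂ) • ψ
    ∧ (∀ φ : Conf N → ℂ, (XXZ N h x).mulVec φ = ((E0 N x : ℝ) : ℂ) • φ → ∃ c : ℂ, φ = c • ψ)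
    ∧ ψ (baseState N) = 1
  else ∀ α, ψ α = 1

/-- The overlap `O_{N1,N2} = ⟨ψ, ψ1 ⊗ ψ2⟩` (bilinear, unconjugated pairing). -/
def overlap (N1 N2 : ℕ) (ψ : Conf (N1+N2) → ℂ) (ψ1 : Conf N1 → ℂ) (ψ2 : Conf N2 → ℂ) : ℂ :=
  ∑ α : Conf N1, ∑ β : Conf N2, ψ (Fin.append α β) * ψ1 α * ψ2 β

/-- The square norm `O_{M,0} = ⟨ψ, ψ⟩` (bilinear pairing). -/
def selfOverlap (M : ℕ) (ψ : Conf M → ℂ) : ℂ := ∑ α : Conf M, ψ α * ψ α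

/-- `γ_N`: `A_V(N+1)` for `N` even, `N_8(N+1)` for `N` odd. -/
def gammaN (N : ℕ) : ℝ :=
  if N % 2 = 0 then
    ((2:ℝ)⁻¹) ^ (N/2) * ∏ i ∈ Finset.Icc 1 (N/2),
      ((Nat.factorial (6*i-2) : ℝ) * (Nat.factorial (2*i-1) : ℝ)) /
        ((Nat.factorial (4*i-2) : ℝ) * (Nat.factorial (4*i-1) : ℝ))
  else
    ∏ i ∈ Finset.range ((N+1)/2),
      (((3*i+1 : ℕ) : ℝ) * (Nat.factorial (6*i) : ℝ) * (Nat.factorial (2*i) : ℝ)) /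
        ((Nat.factorial (4*i) : ℝ) * (Nat.factorial (4*i+1) : ℝ))

/-- Binomial coefficient `C(a,b)` for integers, vanishing unless `0 ≤ b ≤ a`. -/
def zchoose (a b : ℤ) : ℤ := if 0 ≤ b ∧ b ≤ a then (a.toNat).choose b.toNat else 0

/-- The logarithmic bipartite fidelity. -/
def LBF (N1 N2 : ℕ) (ψ : Conf (N1+N2) → ℂ) (ψ1 : Conf N1 → ℂ) (ψ2 : Conf N2 → ℂ) : ℂ :=
  -Complex.log ((overlap N1 N2 ψ ψ1 ψ2)^2 /
    (selfOverlap N1 ψ1 * selfOverlap N2 ψ2 * selfOverlap (N1+N2) ψ))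

namespace XXZOverlap

open MvPolynomial

/-- The elementary factor `1 + 3vw + v - w` of the `R`-matrix. -/
def D {A : Type*} [CommRing A] (v w : A) : A := 1 + 3 * v * w + v - w

/-- Polynomials in the spectral parameters. -/
abbrev Poly := MvPolynomial ℕ ℝ

/-- Exchange of the coordinates `i` and `i + 1` of a point. -/
def sw (i : ℕ) (v : ℕ → ℝ) : ℕ → ℝ := v ∘ Equiv.swap i (i + 1)

@[simp] lemma sw_left (i : ℕ) (v : ℕ → ℝ) : sw i v i = v (i + 1) := by simp [sw]
@[simp] lemma sw_right (i : ℕ) (v : ℕ → ℝ) : sw i v (i + 1) = v i := by simp [sw]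
lemma sw_of_ne {i j : ℕ} (v : ℕ → ℝ) (h : j ≠ i) (h' : j ≠ i + 1) : sw i v j = v j := by
  simp [sw, Equiv.swap_apply_of_ne_of_ne h h']
@[simp] lemma sw_sw (i : ℕ) (v : ℕ → ℝ) : sw i (sw i v) = v := by
  ext j; simp [sw]

lemma sw_comm {i j : ℕ} (h : i + 2 ≤ j) (v : ℕ → ℝ) : sw i (sw j v) = sw j (sw i v) := by
  ext k
  simp only [sw, Function.comp]
  congr 1
  have : Disjoint ({i, i + 1} : Finset ℕ) {j, j + 1} := by
    simp; omega
  have h2 : Commute (Equiv.swap i (i + 1)) (Equiv.swap j (j + 1)) := by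
    apply Equiv.Perm.Disjoint.commute
    intro x
    by_cases hx : x = i ∨ x = i + 1
    · right; apply Equiv.swap_apply_of_ne_of_ne <;> omega
    · left; apply Equiv.swap_apply_of_ne_of_ne <;> omega
  have := congrArg (fun e : Equiv.Perm ℕ => e k) h2.eq
  simpa using this.symm

lemma sw_braid (i : ℕ) (v : ℕ → ℝ) :
    sw i (sw (i + 1) (sw i v)) = sw (i + 1) (sw i (sw (i + 1) v)) := by
  ext k
  rcases eq_or_ne k i with rfl | h1
  · rw [sw_left, sw_left, sw_of_ne v (by omega) (by omega), sw_of_ne _ (by omega) (by omega),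
      sw_left, sw_left]
  rcases eq_or_ne k (i + 1) with rfl | h2
  · rw [sw_right, sw_of_ne (sw i v) (by omega) (by omega), sw_left, sw_left,
      sw_of_ne (sw (i + 1) v) (by omega) (by omega), sw_right]
  rcases eq_or_ne k (i + 2) with rfl | h3
  · rw [sw_of_ne _ (by omega) (by omega), sw_right, sw_right, sw_right, sw_right,
      sw_of_ne _ (by omega) (by omega)]
  · rw [sw_of_ne _ (by omega) (by omega), sw_of_ne _ (by omega) (by omega),
      sw_of_ne _ (by omega) (by omega), sw_of_ne _ (by omega) (by omega),
      sw_of_ne _ (by omega) (by omega), sw_of_ne _ (by omega) (by omega)]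

/-- Points with distinct coordinates in `(0, δ)`. -/
def Gen (δ : ℝ) (v : ℕ → ℝ) : Prop := Function.Injective v ∧ ∀ i, 0 < v i ∧ v i < δ

lemma Gen.sw {δ : ℝ} {v : ℕ → ℝ} (h : Gen δ v) (i : ℕ) : Gen δ (sw i v) :=
  ⟨h.1.comp (Equiv.injective _), fun _ => h.2 _⟩

lemma Gen.ne {δ : ℝ} {v : ℕ → ℝ} (h : Gen δ v) {i j : ℕ} (hij : i ≠ j) : v i - v j ≠ 0 :=
  sub_ne_zero.2 fun e => hij (h.1 e)

lemma poly_ext {δ : ℝ} (hδ : 0 < δ) {p q : Poly}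
    (h : ∀ v, Gen δ v → eval v p = eval v q) : p = q := by
  apply MvPolynomial.funext_set (fun i : ℕ => Set.Ioo (δ / (i + 2)) (δ / (i + 1)))
  · intro i
    apply Set.Ioo_infinite
    apply div_lt_div_of_pos_left hδ <;> linarith [(Nat.cast_nonneg i : (0 : ℝ) ≤ i)]
  · intro v hv
    have hv' : ∀ i : ℕ, v i ∈ Set.Ioo (δ / (i + 2)) (δ / (i + 1)) := fun i => hv i (Set.mem_univ _)
    apply h
    constructor
    · have : StrictAnti v := by
        apply strictAnti_nat_of_succ_lt
        intro n
        have h1 := (hv' n).1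
        have h2 := (hv' (n + 1)).2
        push_cast at h2
        have e : (n : ℝ) + 1 + 1 = n + 2 := by ring
        rw [e] at h2
        exact h2.trans h1
      exact this.injective
    · intro i
      have hi : (0 : ℝ) ≤ i := Nat.cast_nonneg i
      refine ⟨lt_trans (by positivity) (hv' i).1, lt_of_lt_of_le (hv' i).2 ?_⟩
      apply div_le_self hδ.le; linarith

lemma exists_divided_difference (i : ℕ) (f : Poly) :
    ∃ g : Poly, (X i - X (i + 1)) * g = rename (Equiv.swap i (i + 1)) f - f := by
  induction f using MvPolynomial.induction_on with
  | C a => exact ⟨0, by simp⟩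
  | add p q hp hq =>
    obtain ⟨g, hg⟩ := hp
    obtain ⟨g', hg'⟩ := hq
    exact ⟨g + g', by rw [mul_add, hg, hg']; simp; ring⟩
  | mul_X p k hp =>
    obtain ⟨g, hg⟩ := hp
    have : ∃ e : Poly, (X i - X (i + 1)) * e = X (Equiv.swap i (i + 1) k) - X k := by
      rcases eq_or_ne k i with rfl | h1
      · exact ⟨-1, by simp⟩
      rcases eq_or_ne k (i + 1) with rfl | h2
      · exact ⟨1, by simp⟩
      · exact ⟨0, by simp [Equiv.swap_apply_of_ne_of_ne h1 h2]⟩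
    obtain ⟨e, he⟩ := this
    refine ⟨g * X k + rename (Equiv.swap i (i + 1)) p * e, ?_⟩
    simp only [map_mul, rename_X]
    linear_combination (X k) * hg + (rename (Equiv.swap i (i + 1)) p) * he

lemma exists_T (i : ℕ) (f : Poly) :
    ∃ g : Poly, 2 * (X i - X (i + 1)) * g =
      D (X i) (X (i + 1)) * rename (Equiv.swap i (i + 1)) f - (1 + 3 * X (i + 1) ^ 2) * f := by
  obtain ⟨g, hg⟩ := exists_divided_difference i f
  refine ⟨C (1 / 2) * ((3 * X (i + 1) + 1) * f + D (X i) (X (i + 1)) * g), ?_⟩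
  have h2 : (2 : Poly) * C (1 / 2) = 1 := by
    rw [show (2 : Poly) = C 2 from rfl, ← C_mul]; norm_num
  simp only [D]
  linear_combination (norm := ring_nf)
    (X i - X (i + 1)) * ((3 * X (i + 1) + 1) * f + D (X i) (X (i + 1)) * g) * h2
      + D (X i) (X (i + 1)) * hg
  simp only [D]
  ring

/-- The exchange operator (a Demazure–Lusztig type operator). -/
def T (i : ℕ) (f : Poly) : Poly := (exists_T i f).choose

lemma eval_rename_swap (i : ℕ) (v : ℕ → ℝ) (f : Poly) :
    eval v (rename (Equiv.swap i (i + 1)) f) = eval (sw i v) f := by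
  rw [eval_rename]; rfl

lemma T_spec (i : ℕ) (f : Poly) (v : ℕ → ℝ) :
    2 * (v i - v (i + 1)) * eval v (T i f) =
      D (v i) (v (i + 1)) * eval (sw i v) f - (1 + 3 * v (i + 1) ^ 2) * eval v f := by
  have := congrArg (eval v) (exists_T i f).choose_spec
  simpa [D, eval_rename_swap, T] using this

lemma eval_T {i : ℕ} (f : Poly) {v : ℕ → ℝ} (h : v i - v (i + 1) ≠ 0) :
    eval v (T i f) = (D (v i) (v (i + 1)) * eval (sw i v) f -
      (1 + 3 * v (i + 1) ^ 2) * eval v f) / (2 * (v i - v (i + 1))) := by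
  rw [eq_div_iff (by simpa using h)]
  linear_combination T_spec i f v

lemma T_comm {i j : ℕ} (h : i + 2 ≤ j) (f : Poly) : T i (T j f) = T j (T i f) := by
  apply poly_ext one_pos
  intro v hv
  rw [eval_T _ (hv.ne (by omega)), eval_T _ (hv.ne (by omega)), eval_T _ ((hv.sw i).ne (by omega)),
    eval_T _ (hv.ne (by omega)), eval_T _ (hv.ne (by omega)), eval_T _ ((hv.sw j).ne (by omega)),
    sw_comm h]
  rw [sw_of_ne v (by omega : j ≠ i) (by omega), sw_of_ne v (by omega : j + 1 ≠ i) (by omega),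
    sw_of_ne v (by omega : i ≠ j) (by omega), sw_of_ne v (by omega : i + 1 ≠ j) (by omega)]
  have h1 : v i - v (i + 1) ≠ 0 := hv.ne (by omega)
  have h2 : v j - v (j + 1) ≠ 0 := hv.ne (by omega)
  field_simp
  ring

/-- Symmetry under the exchange of the variables `i`, `i + 1` up to the factor `D`. -/
def Dsym (i : ℕ) (f : Poly) : Prop :=
  ∀ v : ℕ → ℝ, D (v (i + 1)) (v i) * eval v f = D (v i) (v (i + 1)) * eval (sw i v) f

lemma Dsym_of_gen {i : ℕ} {f : Poly} {δ : ℝ} (hδ : 0 < δ)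
    (h : ∀ v, Gen δ v → D (v (i + 1)) (v i) * eval v f = D (v i) (v (i + 1)) * eval (sw i v) f) :
    Dsym i f := by
  have : D (X (i + 1)) (X i) * f = D (X i) (X (i + 1)) * rename (Equiv.swap i (i + 1)) f := by
    apply poly_ext hδ
    intro v hv
    simpa [D, eval_rename_swap] using h v hv
  intro v
  simpa [D, eval_rename_swap] using congrArg (eval v) this

lemma Dsym.T_of_far {i j : ℕ} {f : Poly} (hf : Dsym i f) (h : i + 2 ≤ j ∨ j + 2 ≤ i) :
    Dsym i (T j f) := by
  apply Dsym_of_gen one_pos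
  intro v hv
  rw [eval_T _ (hv.ne (by omega)), eval_T _ ((hv.sw i).ne (by omega))]
  have hc : sw j (sw i v) = sw i (sw j v) := by
    rcases h with h | h
    · exact (sw_comm h v).symm
    · exact sw_comm h v
  have h1 := hf v
  have h2 := hf (sw j v)
  rw [hc]
  rw [sw_of_ne v (by omega : i ≠ j) (by omega), sw_of_ne v (by omega : i + 1 ≠ j) (by omega)] at h2
  rw [sw_of_ne v (by omega : j ≠ i) (by omega), sw_of_ne v (by omega : j + 1 ≠ i) (by omega)]
  have h3 : v j - v (j + 1) ≠ 0 := hv.ne (by omega)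
  field_simp
  linear_combination D (v j) (v (j + 1)) * h2 - (1 + 3 * v (j + 1) ^ 2) * h1

lemma Dsym.braid_up {i : ℕ} {f : Poly} (hf : Dsym i f) : Dsym (i + 1) (T i (T (i + 1) f)) := by
  apply Dsym_of_gen one_pos
  intro v hv
  have g1 : v i - v (i + 1) ≠ 0 := hv.ne (by omega)
  have g2 : v (i + 1) - v (i + 2) ≠ 0 := hv.ne (by omega)
  have g3 : v i - v (i + 2) ≠ 0 := hv.ne (by omega)
  have e1 : sw i v (i + 2) = v (i + 2) := sw_of_ne v (by omega) (by omega)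
  have e2 : sw (i + 1) v i = v i := sw_of_ne v (by omega) (by omega)
  have e3 : sw i (sw (i + 1) v) (i + 2) = v (i + 1) := by
    rw [sw_of_ne _ (by omega) (by omega), sw_right]
  have e4 : sw (i + 1) (sw i v) i = v (i + 1) := by
    rw [sw_of_ne _ (by omega) (by omega), sw_left]
  have h1 := hf v
  have h2 := hf (sw (i + 1) v)
  have h3 := hf (sw (i + 1) (sw i v))
  have t1 := T_spec i (T (i + 1) f) v
  have t2 := T_spec (i + 1) f (sw i v)
  have t3 := T_spec (i + 1) f v
  have s1 := T_spec i (T (i + 1) f) (sw (i + 1) v)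
  have s2 := T_spec (i + 1) f (sw i (sw (i + 1) v))
  have s3 := T_spec (i + 1) f (sw (i + 1) v)
  simp only [sw_left, sw_right, sw_sw, sw_braid, D, show i + 1 + 1 = i + 2 from rfl,
    e1, e2, e3, e4] at *
  apply mul_left_cancel₀ (mul_ne_zero (mul_ne_zero g1 g2) g3)
  generalize v i = a at *
  generalize v (i + 1) = b at *
  generalize v (i + 2) = c at *
  linear_combination (1 / 8) * ((1 + 3 * c * b + c - b) * (4 * (a - c) * (b - c) * t1
      + 2 * (b - c) * (1 + 3 * a * b + a - b) * t2 - 2 * (a - c) * (1 + 3 * b ^ 2) * t3)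
    - (1 + 3 * b * c + b - c) * (4 * (a - b) * (b - c) * s1
      + 2 * (b - c) * (1 + 3 * a * c + a - c) * s2 + 2 * (a - b) * (1 + 3 * c ^ 2) * s3)
    + 2 * (b - c) * ((1 + 3 * c * b + c - b) * (1 + 3 * c ^ 2) * h1
      + (1 + 3 * a * b + a - b) * (1 + 3 * a * c + a - c) * h3
      - (1 + 3 * b * c + b - c) * (1 + 3 * b ^ 2) * h2))

lemma Dsym.braid_down {i : ℕ} {f : Poly} (hf : Dsym (i + 1) f) :
    Dsym i (T (i + 1) (T i f)) := by
  apply Dsym_of_gen one_pos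
  intro v hv
  have g1 : v i - v (i + 1) ≠ 0 := hv.ne (by omega)
  have g2 : v (i + 1) - v (i + 2) ≠ 0 := hv.ne (by omega)
  have g3 : v i - v (i + 2) ≠ 0 := hv.ne (by omega)
  have e1 : sw i v (i + 2) = v (i + 2) := sw_of_ne v (by omega) (by omega)
  have e2 : sw (i + 1) v i = v i := sw_of_ne v (by omega) (by omega)
  have e3 : sw i (sw (i + 1) v) (i + 2) = v (i + 1) := by
    rw [sw_of_ne _ (by omega) (by omega), sw_right]
  have e4 : sw (i + 1) (sw i v) i = v (i + 1) := by
    rw [sw_of_ne _ (by omega) (by omega), sw_left]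
  have h1 := hf v
  have h2 := hf (sw i v)
  have h3 := hf (sw i (sw (i + 1) v))
  have t1 := T_spec (i + 1) (T i f) v
  have t2 := T_spec i f (sw (i + 1) v)
  have t3 := T_spec i f v
  have s1 := T_spec (i + 1) (T i f) (sw i v)
  have s2 := T_spec i f (sw (i + 1) (sw i v))
  have s3 := T_spec i f (sw i v)
  simp only [sw_left, sw_right, sw_sw, sw_braid, D, show i + 1 + 1 = i + 2 from rfl,
    e1, e2, e3, e4] at *
  apply mul_left_cancel₀ (mul_ne_zero (mul_ne_zero g1 g2) g3)
  generalize v i = a at *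
  generalize v (i + 1) = b at *
  generalize v (i + 2) = c at *
  linear_combination (1 / 8) * ((1 + 3 * b * a + b - a) * (4 * (a - b) * (a - c) * t1
      + 2 * (a - b) * (1 + 3 * b * c + b - c) * t2 - 2 * (a - c) * (1 + 3 * c ^ 2) * t3)
    - (1 + 3 * a * b + a - b) * (4 * (a - b) * (b - c) * s1
      + 2 * (a - b) * (1 + 3 * a * c + a - c) * s2 + 2 * (b - c) * (1 + 3 * c ^ 2) * s3)
    + 2 * (a - b) * ((1 + 3 * b * a + b - a) * (1 + 3 * c ^ 2) * h1
      + (1 + 3 * b * c + b - c) * (1 + 3 * a * c + a - c) * h3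
      - (1 + 3 * a * b + a - b) * (1 + 3 * c ^ 2) * h2))

end XXZOverlap

namespace XXZOverlap

open MvPolynomial

/-- The composition `T o ∘ T (o + 1) ∘ ⋯ ∘ T (o + k - 1)`. -/
def chain : ℕ → ℕ → Poly → Poly
  | _, 0, f => f
  | o, k + 1, f => T o (chain (o + 1) k f)

/-- The polynomial attached to a word (`true` is a down spin) from that of the word with all
down spins on the left; `o` is the position of the first letter. -/
def W : ℕ → List Bool → Poly → Poly
  | _, [], f => f
  | o, true :: α, f => W (o + 1) α f
  | o, false :: α, f => W (o + 1) α (chain o (α.count true) f)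

/-- The part of `W` read off from an initial segment which is followed by `k` down spins. -/
def preW : ℕ → List Bool → ℕ → Poly → Poly
  | _, [], _, f => f
  | o, true :: α, k, f => preW (o + 1) α k f
  | o, false :: α, k, f => preW (o + 1) α k (chain o (α.count true + k) f)

lemma W_append (o : ℕ) (l r : List Bool) (f : Poly) :
    W o (l ++ r) f = W (o + l.length) r (preW o l (r.count true) f) := by
  induction l generalizing o f with
  | nil => simp [preW]
  | cons a l ih =>
    cases a <;> simp [W, preW, ih, Nat.add_assoc, Nat.add_comm 1]

lemma T_chain_comm {i o : ℕ} (h : i + 2 ≤ o) (k : ℕ) (f : Poly) :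
    T i (chain o k f) = chain o k (T i f) := by
  induction k generalizing o f with
  | zero => rfl
  | succ k ih => rw [chain, chain, T_comm h, ih (by omega)]

lemma T_W_comm {i o : ℕ} (h : i + 2 ≤ o) (α : List Bool) (f : Poly) :
    T i (W o α f) = W o α (T i f) := by
  induction α generalizing o f with
  | nil => rfl
  | cons a α ih =>
    cases a
    · rw [W, W, ih (by omega), T_chain_comm h]
    · rw [W, W, ih (by omega)]

lemma W_ud (l r : List Bool) (f : Poly) :
    W 0 (l ++ false :: true :: r) f = T l.length (W 0 (l ++ true :: false :: r) f) := by
  rw [W_append, W_append]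
  simp only [List.count_cons_self, W, zero_add, chain, List.count_cons_of_ne, ne_eq,
    Bool.false_eq_true, not_false_eq_true]
  rw [T_W_comm (by omega)]

lemma Dsym.chain_of_far {i o : ℕ} {f : Poly} (hf : Dsym i f) (k : ℕ)
    (h : i + 2 ≤ o ∨ o + k + 1 ≤ i) : Dsym i (chain o k f) := by
  induction k generalizing o f with
  | zero => exact hf
  | succ k ih => exact (ih hf (by omega)).T_of_far (by omega)

lemma Dsym.W_of_far {i o : ℕ} {f : Poly} (hf : Dsym i f) (h : i + 2 ≤ o) (α : List Bool) :
    Dsym i (W o α f) := by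
  induction α generalizing o f with
  | nil => exact hf
  | cons a α ih =>
    cases a
    · exact ih (hf.chain_of_far _ (by omega)) (by omega)
    · exact ih hf (by omega)

lemma Dsym.chain_shift {j o k : ℕ} {f : Poly} (hf : Dsym j f) (h : o ≤ j) (h' : j + 1 < o + k) :
    Dsym (j + 1) (chain o k f) := by
  induction k generalizing o f with
  | zero => omega
  | succ k ih =>
    rcases h.eq_or_lt with rfl | h
    · obtain ⟨k, rfl⟩ : ∃ m, k = m + 1 := ⟨k - 1, by omega⟩
      exact (hf.chain_of_far (o := o + 1 + 1) k (by omega)).braid_up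
    · exact (ih hf h (by omega)).T_of_far (by omega)

lemma Dsym.chain_chain {o k : ℕ} {f : Poly} (hf : Dsym (o + k) f) :
    Dsym o (chain (o + 1) k (chain o k f)) := by
  induction k generalizing o f with
  | zero => exact hf
  | succ k ih =>
    have := ih (o := o + 1) (f := f) (by convert hf using 1; omega)
    rw [chain, chain, ← T_chain_comm (by omega)]
    exact this.braid_down

/-- `f` has the exchange symmetry inside two adjacent blocks of sizes `k` and `m`. -/
def Good (o k m : ℕ) (f : Poly) : Prop :=
  (∀ i, o ≤ i → i + 1 < o + k → Dsym i f) ∧ ∀ i, o + k ≤ i → i + 1 < o + k + m → Dsym i f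

lemma Good.down {o k m : ℕ} {f : Poly} (h : Good o (k + 1) m f) : Good (o + 1) k m f :=
  ⟨fun i hi hi' => h.1 i (by omega) (by omega), fun i hi hi' => h.2 i (by omega) (by omega)⟩

lemma Good.up {o k m : ℕ} {f : Poly} (h : Good o k (m + 1) f) :
    Good (o + 1) k m (chain o k f) := by
  refine ⟨fun i hi hi' => ?_, fun i hi hi' => ?_⟩
  · obtain ⟨j, rfl⟩ : ∃ j, i = j + 1 := ⟨i - 1, by omega⟩
    exact (h.1 j (by omega) (by omega)).chain_shift (by omega) (by omega)
  · exact (h.2 i (by omega) (by omega)).chain_of_far _ (by omega)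

lemma Dsym_W_of_equal {o : ℕ} {f : Poly} (l r : List Bool) (a : Bool)
    (h : Good o ((l ++ a :: a :: r).count true) ((l ++ a :: a :: r).count false) f) :
    Dsym (o + l.length) (W o (l ++ a :: a :: r) f) := by
  induction l generalizing o f with
  | nil =>
    cases a
    · simp only [List.nil_append, W, List.length_nil, add_zero]
      refine Dsym.W_of_far ?_ (by omega) _
      have : List.count true (false :: r) = List.count true r := by simp
      rw [this]
      apply Dsym.chain_chain
      apply h.2 <;> simp
    · simp only [List.nil_append, W, List.length_nil, add_zero]
      refine Dsym.W_of_far ?_ (by omega) _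
      apply h.1 <;> simp
  | cons b l ih =>
    rw [List.cons_append, List.length_cons, ← Nat.add_assoc, Nat.add_right_comm]
    cases b
    · refine ih (Good.up ?_)
      simpa using h
    · refine ih (Good.down ?_)
      simpa using h

/-- Words with given letters are reached from the one with all down spins on the left. -/
lemma word_induction {Q : List Bool → Prop} {k m : ℕ}
    (base : Q (List.replicate k true ++ List.replicate m false))
    (step : ∀ l r, Q (l ++ true :: false :: r) → Q (l ++ false :: true :: r))
    (β : List Bool) (h1 : β.count true = k) (h2 : β.count false = m) : Q β := by
  have move : ∀ j l r, Q (l ++ List.replicate j true ++ false :: r) →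
      Q (l ++ false :: (List.replicate j true ++ r)) := by
    intro j
    induction j with
    | zero => intro l r h; simpa using h
    | succ j ih =>
      intro l r h
      have h' : Q (l ++ [true] ++ List.replicate j true ++ false :: r) := by
        simpa [List.replicate_succ] using h
      have := ih _ _ h'
      have := step l (List.replicate j true ++ r) (by simpa using this)
      simpa [List.replicate_succ] using this
  have gen : ∀ β l : List Bool, ∀ k m, β.count true = k → β.count false = m →
      Q (l ++ (List.replicate k true ++ List.replicate m false)) → Q (l ++ β) := by
    intro β
    induction β with
    | nil => intro l k m hk hm h; simp at hk hm; subst hk hm; simpa using h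
    | cons b β ih =>
      intro l k m hk hm h
      cases b
      · simp at hk hm
        subst hk hm
        have := ih (l ++ [false]) _ _ rfl rfl (by
          have := move (β.count true) l (List.replicate (β.count false) false)
            (by simpa [List.replicate_succ] using h)
          simpa using this)
        simpa using this
      · simp at hk hm
        subst hk hm
        have := ih (l ++ [true]) _ _ rfl rfl (by simpa [List.replicate_succ] using h)
        simpa using this
  simpa using gen β [] k m h1 h2 (by simpa using base)

end XXZOverlap

namespace XXZOverlap

open MvPolynomial

section Base
variable {A B : Type*} [CommRing A] [CommRing B]

/-- The product of the left kernel and its reflection. -/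
def mL (a b : A) : A := D a b * D (-a) b

/-- The product of the right kernel and its reflection. -/
def mR (a b : A) : A := D a b * D a (-b)

/-- The factor of the extremal component carried by the down spins. -/
def PL (c : A) : List A → A
  | [] => 1
  | a :: l => (1 - c * a) * (l.map (mL a)).prod * PL c l

/-- The factor of the extremal component carried by the up spins. -/
def PR : List A → A
  | [] => 1
  | a :: l => (l.map (mR a)).prod * PR l

/-- The values of `v` on `k` consecutive integers from `o` on. -/
def seg {A : Type*} (v : ℕ → A) : ℕ → ℕ → List A
  | _, 0 => []
  | o, k + 1 => v o :: seg v (o + 1) k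

lemma map_D (φ : A →+* B) (a b : A) : φ (D a b) = D (φ a) (φ b) := by simp [D, map_ofNat]

lemma map_mL (φ : A →+* B) (a b : A) : φ (mL a b) = mL (φ a) (φ b) := by simp [mL, map_D]

lemma map_mR (φ : A →+* B) (a b : A) : φ (mR a b) = mR (φ a) (φ b) := by simp [mR, map_D]

lemma map_PL (φ : A →+* B) (c : A) (l : List A) : φ (PL c l) = PL (φ c) (l.map φ) := by
  induction l with
  | nil => simp [PL]
  | cons a l ih =>
    simp [PL, ih, map_list_prod, Function.comp_def, map_mL]

lemma map_PR (φ : A →+* B) (l : List A) : φ (PR l) = PR (l.map φ) := by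
  induction l with
  | nil => simp [PR]
  | cons a l ih =>
    simp [PR, ih, map_list_prod, Function.comp_def, map_mR]

lemma map_seg {A B : Type*} (φ : A → B) (v : ℕ → A) (o k : ℕ) :
    (seg v o k).map φ = seg (φ ∘ v) o k := by
  induction k generalizing o with
  | zero => rfl
  | succ k ih => simp [seg, ih]

lemma PL_swap (c : A) (l r : List A) (a b : A) :
    D b a * PL c (l ++ a :: b :: r) = D a b * PL c (l ++ b :: a :: r) := by
  induction l with
  | nil =>
    simp only [List.nil_append, PL, List.map_cons, List.prod_cons, mL, D]
    ring
  | cons e l ih =>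
    simp only [List.cons_append, PL, List.map_append, List.map_cons, List.prod_append,
      List.prod_cons]
    linear_combination (1 - c * e) * ((l.map (mL e)).prod * (mL e a * (mL e b *
      (r.map (mL e)).prod))) * ih

lemma PR_swap (l r : List A) (a b : A) :
    D b a * PR (l ++ a :: b :: r) = D a b * PR (l ++ b :: a :: r) := by
  induction l with
  | nil =>
    simp only [List.nil_append, PR, List.map_cons, List.prod_cons, mR, D]
    ring
  | cons e l ih =>
    simp only [List.cons_append, PR, List.map_append, List.map_cons, List.prod_append,
      List.prod_cons]
    linear_combination ((l.map (mR e)).prod * (mR e a * (mR e b *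
      (r.map (mR e)).prod))) * ih

end Base

lemma seg_sw_of_far {o k i : ℕ} (v : ℕ → ℝ) (h : i + 1 < o ∨ o + k ≤ i) :
    seg (sw i v) o k = seg v o k := by
  induction k generalizing o with
  | zero => rfl
  | succ k ih => rw [seg, seg, ih (by omega), sw_of_ne _ (by omega) (by omega)]

lemma seg_sw {o k i : ℕ} (v : ℕ → ℝ) (h : o ≤ i) (h' : i + 1 < o + k) :
    ∃ l r, seg v o k = l ++ v i :: v (i + 1) :: r ∧
      seg (sw i v) o k = l ++ v (i + 1) :: v i :: r := by
  induction k generalizing o with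
  | zero => omega
  | succ k ih =>
    rcases h.eq_or_lt with rfl | h
    · obtain ⟨k, rfl⟩ : ∃ m, k = m + 1 := ⟨k - 1, by omega⟩
      exact ⟨[], seg v (o + 2) k, rfl, by
        simp [seg, seg_sw_of_far (o := o + 1 + 1) (i := o) v (by omega)]⟩
    · obtain ⟨l, r, h1, h2⟩ := ih (o := o + 1) h (by omega)
      exact ⟨v o :: l, r, by simp [seg, h1], by
        simp [seg, h2, sw_of_ne v (by omega : o ≠ i) (by omega)]⟩

/-- The component of the word with all down spins on the left. -/
def base (x : ℝ) (n : ℕ) : Poly := PL (C (2 * x - 1)) (seg X 0 n) * PR (seg X n n)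

lemma eval_base (x : ℝ) (n : ℕ) (v : ℕ → ℝ) :
    eval v (base x n) = PL (2 * x - 1) (seg v 0 n) * PR (seg v n n) := by
  have : (eval v : Poly → ℝ) ∘ X = v := by ext; simp
  simp [base, map_PL, map_PR, map_seg, this]

lemma good_base (x : ℝ) (n : ℕ) : Good 0 n n (base x n) := by
  constructor
  · intro i h1 h2 v
    obtain ⟨l, r, e1, e2⟩ := seg_sw v h1 h2
    rw [eval_base, eval_base, seg_sw_of_far (o := n) v (by omega), e1, e2]
    linear_combination PR (seg v n n) * PL_swap (2 * x - 1) l r (v i) (v (i + 1))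
  · intro i h1 h2 v
    obtain ⟨l, r, e1, e2⟩ := seg_sw (o := n) (k := n) (i := i) v (by omega) (by omega)
    rw [eval_base, eval_base, seg_sw_of_far (o := 0) (k := n) v (by omega), e1, e2]
    linear_combination PL (2 * x - 1) (seg v 0 n) * PR_swap l r (v i) (v (i + 1))

/-- The polynomial component on the word `α` (zero outside the sector of zero magnetization). -/
def P (x : ℝ) (n : ℕ) (α : List Bool) : Poly :=
  if α.count true = n ∧ α.count false = n then W 0 α (base x n) else 0

@[simp] lemma T_zero (i : ℕ) : T i 0 = 0 := by
  apply poly_ext one_pos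
  intro v hv
  rw [eval_T _ (hv.ne (by omega))]
  simp

lemma P_ud (x : ℝ) (n : ℕ) (l r : List Bool) :
    P x n (l ++ false :: true :: r) = T l.length (P x n (l ++ true :: false :: r)) := by
  have h1 : (l ++ false :: true :: r).count true = (l ++ true :: false :: r).count true := by simp
  have h2 : (l ++ false :: true :: r).count false = (l ++ true :: false :: r).count false := by
    simp
  unfold P
  rw [h1, h2]
  split_ifs
  · exact W_ud _ _ _
  · simp

lemma Dsym_P (x : ℝ) (n : ℕ) (l r : List Bool) (a : Bool) :
    Dsym l.length (P x n (l ++ a :: a :: r)) := by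
  unfold P
  split_ifs with h
  · have := Dsym_W_of_equal (o := 0) (f := base x n) l r a (by
      rw [h.1, h.2]; exact good_base x n)
    simpa using this
  · intro v; simp

/-- A list as a point with zeros appended. -/
def toV (L : List ℝ) : ℕ → ℝ := fun i => L.getD i 0

@[simp] lemma toV_append_left (l r : List ℝ) (a : ℝ) : toV (l ++ a :: r) l.length = a := by
  simp [toV]

@[simp] lemma toV_append_succ (l r : List ℝ) (a b : ℝ) :
    toV (l ++ a :: b :: r) (l.length + 1) = b := by
  simp [toV]

lemma sw_toV (l r : List ℝ) (a b : ℝ) :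
    sw l.length (toV (l ++ a :: b :: r)) = toV (l ++ b :: a :: r) := by
  ext i
  rcases eq_or_ne i l.length with rfl | h1
  · simp
  rcases eq_or_ne i (l.length + 1) with rfl | h2
  · simp
  rw [sw_of_ne _ h1 h2]
  simp only [toV, List.getD_eq_getElem?_getD]
  congr 1
  rcases lt_or_gt_of_ne h1 with h | h
  · rw [List.getElem?_append_left h, List.getElem?_append_left h]
  · rw [List.getElem?_append_right h.le, List.getElem?_append_right h.le]
    obtain ⟨k, hk⟩ : ∃ k, i - l.length = k + 2 := ⟨i - l.length - 2, by omega⟩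
    rw [hk]; simp

/-- The inhomogeneous components, as functions of the list of spectral parameters. -/
def psi (x : ℝ) (n : ℕ) (α : List Bool) (L : List ℝ) : ℝ := eval (toV L) (P x n α)

variable {x : ℝ} {n : ℕ}

lemma psi_du {l r : List Bool} {lv rv : List ℝ} (h : l.length = lv.length) (v w : ℝ) :
    (1 + 3 * w ^ 2) * psi x n (l ++ true :: false :: r) (lv ++ v :: w :: rv) +
      2 * (v - w) * psi x n (l ++ false :: true :: r) (lv ++ v :: w :: rv) =
      D v w * psi x n (l ++ true :: false :: r) (lv ++ w :: v :: rv) := by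
  have := T_spec lv.length (P x n (l ++ true :: false :: r)) (toV (lv ++ v :: w :: rv))
  rw [← h, ← P_ud, h, sw_toV] at this
  simp only [toV_append_left, toV_append_succ] at this
  simp only [psi]
  linear_combination this

lemma psi_ud {l r : List Bool} {lv rv : List ℝ} (h : l.length = lv.length) (v w : ℝ) :
    (1 + 3 * v ^ 2) * psi x n (l ++ false :: true :: r) (lv ++ v :: w :: rv) +
      2 * (v - w) * psi x n (l ++ true :: false :: r) (lv ++ v :: w :: rv) =
      D v w * psi x n (l ++ false :: true :: r) (lv ++ w :: v :: rv) := by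
  rcases eq_or_ne v w with rfl | hvw
  · simp only [D]; ring
  · have h1 := psi_du (x := x) (n := n) (r := r) (rv := rv) h v w
    have h2 := psi_du (x := x) (n := n) (r := r) (rv := rv) h w v
    apply mul_left_cancel₀ (mul_ne_zero two_ne_zero (sub_ne_zero.2 hvw))
    simp only [D] at *
    linear_combination (1 + 3 * v ^ 2) * h1 + (1 + 3 * v * w + v - w) * h2

lemma psi_eq {l r : List Bool} {lv rv : List ℝ} (h : l.length = lv.length) (a : Bool) (v w : ℝ) :
    D w v * psi x n (l ++ a :: a :: r) (lv ++ v :: w :: rv) =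
      D v w * psi x n (l ++ a :: a :: r) (lv ++ w :: v :: rv) := by
  have := Dsym_P x n l r a (toV (lv ++ v :: w :: rv))
  rw [h, sw_toV] at this
  simpa [psi] using this

lemma psi_eq_zero {α : List Bool} {L : List ℝ} (h : ¬ (α.count true = n ∧ α.count false = n)) :
    psi x n α L = 0 := by
  simp [psi, P, h]

end XXZOverlap

namespace XXZOverlap

open MvPolynomial

/-- The sum over the elements `c` of a list of `h c * ∏ k c b`, the product being over the
other elements of the list. -/
def selSum (k : ℝ → ℝ → ℝ) : List ℝ → (ℝ → ℝ) → ℝ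
  | [], _ => 0
  | b :: B, h => h b * (B.map (k b)).prod + selSum k B (fun c => h c * k c b)

lemma selSum_congr {k : ℝ → ℝ → ℝ} {B : List ℝ} {h h' : ℝ → ℝ} (e : ∀ c ∈ B, h c = h' c) :
    selSum k B h = selSum k B h' := by
  induction B generalizing h h' with
  | nil => rfl
  | cons b B ih =>
    rw [selSum, selSum, e b (by simp), ih fun c hc => by rw [e c (by simp [hc])]]

lemma selSum_add_mul (k : ℝ → ℝ → ℝ) (B : List ℝ) (s t : ℝ) (h h' : ℝ → ℝ) :
    selSum k B (fun c => s * h c + t * h' c) = s * selSum k B h + t * selSum k B h' := by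
  induction B generalizing h h' with
  | nil => simp [selSum]
  | cons b B ih =>
    simp only [selSum]
    have := ih (fun c => h c * k c b) (fun c => h' c * k c b)
    rw [show (fun c => (s * h c + t * h' c) * k c b) =
      fun c => s * (h c * k c b) + t * (h' c * k c b) by ext; ring, this]
    ring

lemma selSum_mul (k : ℝ → ℝ → ℝ) (B : List ℝ) (s : ℝ) (h : ℝ → ℝ) :
    selSum k B (fun c => s * h c) = s * selSum k B h := by
  have := selSum_add_mul k B s 0 h h
  simpa using this

lemma selSum_append_singleton (k : ℝ → ℝ → ℝ) (B : List ℝ) (y : ℝ) (h : ℝ → ℝ) :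
    selSum k (B ++ [y]) h = h y * (B.map (k y)).prod + selSum k B (fun c => h c * k c y) := by
  induction B generalizing h with
  | nil => simp [selSum]
  | cons b B ih =>
    simp only [List.cons_append, selSum, ih, List.map_append, List.prod_append, List.map_cons,
      List.prod_cons, List.map_nil, List.prod_nil]
    rw [show (fun c => h c * k c b * k c y) = fun c => h c * k c y * k c b by ext; ring]
    ring

lemma selSum_eq_sum (k : ℝ → ℝ → ℝ) {L : List ℝ} (hL : L.Nodup) (h : ℝ → ℝ) :
    selSum k L h = ∑ c ∈ L.toFinset, h c * ∏ b ∈ L.toFinset.erase c, k c b := by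
  induction L generalizing h with
  | nil => simp [selSum]
  | cons a L ih =>
    have ha : a ∉ L.toFinset := by simpa using (List.nodup_cons.1 hL).1
    have hL' := (List.nodup_cons.1 hL).2
    rw [selSum, ih hL', List.toFinset_cons, Finset.sum_insert ha, Finset.erase_insert ha,
      List.prod_toFinset _ hL']
    congr 1
    apply Finset.sum_congr rfl
    intro c hc
    have hca : a ≠ c := fun e => ha (e ▸ hc)
    rw [Finset.erase_insert_of_ne hca, Finset.prod_insert (by simp [ha])]
    ring

lemma selSum_lagrange {k : ℝ → ℝ → ℝ} {L : List ℝ} {h u s : ℝ → ℝ} {m : ℕ} (hL : L.Nodup)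
    (hlen : L.length = m + 2) (Q : Polynomial ℝ) (hQ : Q.natDegree ≤ m)
    (hs : ∀ c ∈ L, s c ≠ 0) (hu : ∀ b ∈ L, ∀ c ∈ L, b ≠ c → u b ≠ u c)
    (hk : ∀ b ∈ L, ∀ c ∈ L, b ≠ c → k c b = (s b * s c * (u c - u b))⁻¹)
    (hh : ∀ c ∈ L, h c = s c ^ m * Q.eval (u c)) : selSum k L h = 0 := by
  rw [selSum_eq_sum k hL]
  have hcard : L.toFinset.card = m + 2 := by rw [List.toFinset_card_of_nodup hL, hlen]
  have hinj : Set.InjOn u (L.toFinset : Set ℝ) := by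
    intro b hb c hc e
    by_contra hne
    exact hu b (by simpa using hb) c (by simpa using hc) hne e
  have key := Lagrange.coeff_eq_sum hinj (P := Q) (by
    rw [hcard]
    apply lt_of_le_of_lt Polynomial.degree_le_natDegree
    exact_mod_cast (by omega : Q.natDegree < m + 2))
  rw [Polynomial.coeff_eq_zero_of_natDegree_lt (by omega)] at key
  rw [← mul_zero (∏ b ∈ L.toFinset, s b)⁻¹, key, Finset.mul_sum]
  apply Finset.sum_congr rfl
  intro c hc
  have hcL : c ∈ L := by simpa using hc
  rw [hh c hcL]
  have h1 : ∏ b ∈ L.toFinset.erase c, k c b =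
      ∏ b ∈ L.toFinset.erase c, ((s b)⁻¹ * (s c)⁻¹ * (u c - u b)⁻¹) := by
    apply Finset.prod_congr rfl
    intro b hb
    rw [Finset.mem_erase] at hb
    rw [hk b (by simpa using hb.2) c hcL hb.1]
    rw [mul_inv, mul_inv]
  rw [h1, Finset.prod_mul_distrib, Finset.prod_mul_distrib, Finset.prod_const,
    Finset.card_erase_of_mem hc, hcard, ← Finset.mul_prod_erase _ s hc, Finset.prod_inv_distrib,
    Finset.prod_inv_distrib]
  have := hs c hcL
  rw [mul_inv, show m + 2 - 1 = m + 1 by omega]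
  rw [div_eq_mul_inv, inv_pow]
  field_simp
  ring

lemma seg_toV (l m r : List ℝ) : seg (toV (l ++ m ++ r)) l.length m.length = m := by
  induction m generalizing l with
  | nil => rfl
  | cons a m ih =>
    have := ih (l ++ [a])
    simp only [List.length_append, List.length_cons, List.length_nil, List.append_assoc,
      List.cons_append, List.nil_append] at this
    simp [seg, this]

lemma eval_base_list {x : ℝ} {n : ℕ} {l r : List ℝ} (hl : l.length = n) (hr : r.length = n) :
    eval (toV (l ++ r)) (base x n) = PL (2 * x - 1) l * PR r := by
  rw [eval_base]
  have h1 := seg_toV [] l r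
  have h2 := seg_toV l r []
  simp only [hl, hr, List.length_nil, List.nil_append, List.append_nil] at h1 h2
  rw [h1, h2]

lemma T_list (l r : List ℝ) (v w : ℝ) (f : Poly) :
    2 * (v - w) * eval (toV (l ++ v :: w :: r)) (T l.length f) =
      D v w * eval (toV (l ++ w :: v :: r)) f -
        (1 + 3 * w ^ 2) * eval (toV (l ++ v :: w :: r)) f := by
  have := T_spec l.length f (toV (l ++ v :: w :: r))
  rwa [sw_toV, toV_append_left, toV_append_succ] at this

/-- Lists of distinct numbers in `(0, δ)`. -/
def GenL (δ : ℝ) (L : List ℝ) : Prop := L.Nodup ∧ ∀ a ∈ L, 0 < a ∧ a < δ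

lemma GenL.perm {δ : ℝ} {L L' : List ℝ} (h : GenL δ L) (p : L.Perm L') : GenL δ L' :=
  ⟨p.nodup_iff.1 h.1, fun a ha => h.2 a (p.mem_iff.2 ha)⟩

/-- Lists of distinct numbers in `(-δ, δ)`. -/
def GenS (δ : ℝ) (L : List ℝ) : Prop := L.Nodup ∧ ∀ a ∈ L, |a| < δ

lemma GenS.perm {δ : ℝ} {L L' : List ℝ} (h : GenS δ L) (p : L.Perm L') : GenS δ L' :=
  ⟨p.nodup_iff.1 h.1, fun a ha => h.2 a (p.mem_iff.2 ha)⟩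

lemma D_pos {v w : ℝ} (hv : |v| < 1 / 5) (hw : |w| < 1 / 5) : 0 < D v w := by
  rw [abs_lt] at hv hw
  unfold D; nlinarith

lemma D_neg_left_pos {v w : ℝ} (hv : |v| < 1 / 5) (hw : |w| < 1 / 5) : 0 < D (-v) w := by
  rw [abs_lt] at hv hw
  unfold D; nlinarith

lemma D_neg_right_pos {v w : ℝ} (hv : |v| < 1 / 5) (hw : |w| < 1 / 5) : 0 < D v (-w) := by
  rw [abs_lt] at hv hw
  unfold D; nlinarith

/-- The kernel of the left partial fraction expansions. -/
def kL (c b : ℝ) : ℝ := (2 * (c - b) * D (-b) c)⁻¹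

/-- The partial fraction sum of the left chain formula; the kernel `ρ` carries the dependence
on the other variables. -/
def sumL (ρ : ℝ → ℝ) (b : ℝ) (B : List ℝ) : ℝ :=
  ρ b * (B.map (kL b)).prod +
    selSum kL B fun c => (1 + 3 * c ^ 2) * ρ c * (2 * (c - b) * mL b c)⁻¹

lemma sumL_step (ρ : ℝ → ℝ) (b₀ b₁ : ℝ) (B : List ℝ) (h : GenS (1 / 5) (b₀ :: b₁ :: B)) :
    D b₁ b₀ * sumL (fun c => ρ c * (mL b₁ c)⁻¹) b₀ B -
      (1 + 3 * b₁ ^ 2) * sumL (fun c => ρ c * (mL b₀ c)⁻¹) b₁ B =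
      2 * (b₀ - b₁) * sumL ρ b₀ (b₁ :: B) := by
  have h01 : b₀ - b₁ ≠ 0 := sub_ne_zero.2 (by have := h.1; simp at this; tauto)
  have p0 := h.2 b₀ (by simp)
  have p1 := h.2 b₁ (by simp)
  have a0 := p0
  have a1 := p1
  have d10 := (D_pos p1 p0).ne'
  have d01 := (D_pos p0 p1).ne'
  have e10 := (D_neg_left_pos a1 a0).ne'
  simp only [sumL, selSum, List.map_cons, List.prod_cons]
  have key : D b₁ b₀ * selSum kL B (fun c => (1 + 3 * c ^ 2) * (ρ c * (mL b₁ c)⁻¹) *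
        (2 * (c - b₀) * mL b₀ c)⁻¹) - (1 + 3 * b₁ ^ 2) *
        selSum kL B (fun c => (1 + 3 * c ^ 2) * (ρ c * (mL b₀ c)⁻¹) *
        (2 * (c - b₁) * mL b₁ c)⁻¹) = 2 * (b₀ - b₁) *
      selSum kL B (fun c => (1 + 3 * c ^ 2) * ρ c * (2 * (c - b₀) * mL b₀ c)⁻¹ * kL c b₁) := by
    rw [sub_eq_add_neg, ← neg_mul, ← selSum_add_mul, ← selSum_mul]
    apply selSum_congr
    intro c hc
    have pc := h.2 c (by simp [hc])
    have ac := pc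
    have hc0 : c - b₀ ≠ 0 := sub_ne_zero.2 (by have := h.1; simp at this; rintro rfl; tauto)
    have hc1 : c - b₁ ≠ 0 := sub_ne_zero.2 (by have := h.1; simp at this; rintro rfl; tauto)
    have d0c := (D_pos p0 pc).ne'
    have d1c := (D_pos p1 pc).ne'
    have e0c := (D_neg_left_pos a0 ac).ne'
    have e1c := (D_neg_left_pos a1 ac).ne'
    have id : D b₁ b₀ * (c - b₁) - (1 + 3 * b₁ ^ 2) * (c - b₀) = (b₀ - b₁) * D b₁ c := by
      simp only [D]; ring
    simp only [kL, mL]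
    field_simp
    linear_combination ρ c * id
  have t0 : D b₁ b₀ * (ρ b₀ * (mL b₁ b₀)⁻¹) = 2 * (b₀ - b₁) * (ρ b₀ * kL b₀ b₁) := by
    simp only [kL, mL]; field_simp
  have t1 : -((1 + 3 * b₁ ^ 2) * (ρ b₁ * (mL b₀ b₁)⁻¹)) =
      2 * (b₀ - b₁) * ((1 + 3 * b₁ ^ 2) * ρ b₁ * (2 * (b₁ - b₀) * mL b₀ b₁)⁻¹) := by
    have h10 : b₁ - b₀ ≠ 0 := by intro e; apply h01; linarith
    have e01 := (D_neg_left_pos a0 a1).ne'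
    simp only [mL]; field_simp; ring
  linear_combination key + (B.map (kL b₀)).prod * t0 + (B.map (kL b₁)).prod * t1

end XXZOverlap

namespace XXZOverlap

open MvPolynomial

lemma PL_append_singleton {A : Type*} [CommRing A] (c b : A) (l : List A) :
    PL c (l ++ [b]) = PL c l * (l.map fun a => mL a b).prod * (1 - c * b) := by
  induction l with
  | nil => simp [PL]
  | cons a l ih =>
    simp only [List.cons_append, PL, ih, List.map_append, List.prod_append, List.map_cons,
      List.prod_cons, List.map_nil, List.prod_nil]
    ring

lemma abs_lt_of_pos {a : ℝ} (h : 0 < a ∧ a < 1 / 5) : |a| < 1 / 5 := by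
  rw [abs_of_pos h.1]; exact h.2

lemma mL_ne {a b : ℝ} (ha : |a| < 1 / 5) (hb : |b| < 1 / 5) : mL a b ≠ 0 :=
  mul_ne_zero (D_pos ha hb).ne' (D_neg_left_pos ha hb).ne'

lemma mR_ne {a b : ℝ} (ha : |a| < 1 / 5) (hb : |b| < 1 / 5) : mR a b ≠ 0 :=
  mul_ne_zero (D_pos ha hb).ne' (D_neg_right_pos ha hb).ne'

lemma prod_map_mul_inv {L : List ℝ} {f : ℝ → ℝ} (h : ∀ a ∈ L, f a ≠ 0) :
    (L.map f).prod * (L.map fun a => (f a)⁻¹).prod = 1 := by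
  rw [← List.prod_map_mul]
  apply List.prod_eq_one
  intro y hy
  obtain ⟨a, ha, rfl⟩ := List.mem_map.1 hy
  exact mul_inv_cancel₀ (h a ha)

/-- The kernel `ρ` in the left chain formula. -/
def rhoL (κ : ℝ) (A R : List ℝ) (c : ℝ) : ℝ :=
  (R.map (mR c)).prod * (1 - κ * c)⁻¹ * (A.map fun a => (mL a c)⁻¹).prod

lemma rhoL_append (κ : ℝ) (A R : List ℝ) (b : ℝ) :
    rhoL κ (A ++ [b]) R = fun c => rhoL κ A R c * (mL b c)⁻¹ := by
  ext c; simp [rhoL, mul_assoc]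

lemma eval_chain {x : ℝ} {n : ℕ} (A B R : List ℝ) (b : ℝ) (hg : GenS (1 / 5) (A ++ b :: B ++ R))
    (hκ : ∀ a ∈ A ++ b :: B ++ R, 1 - (2 * x - 1) * a ≠ 0) (h1 : A.length + B.length = n)
    (h2 : R.length + 1 = n) :
    eval (toV (A ++ b :: B ++ R)) (chain A.length B.length (base x n)) =
      PL (2 * x - 1) (A ++ b :: B) * PR R * sumL (rhoL (2 * x - 1) A R) b B := by
  induction B generalizing A b with
  | nil =>
    have e : A ++ [b] ++ R = A ++ (b :: R) := by simp
    rw [List.length_nil, chain, e, eval_base_list (by simpa using h1) (by simpa using h2), PR,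
      PL_append_singleton, sumL, selSum, List.map_nil, List.prod_nil, rhoL]
    have hb := hg.2 b (by simp)
    have k1 := hκ b (by simp)
    have k2 := prod_map_mul_inv (L := A) (f := fun a => mL a b)
      fun a ha => mL_ne (hg.2 a (by simp [ha])) hb
    linear_combination -PL (2 * x - 1) A * (R.map (mR b)).prod * PR R *
      ((1 - (2 * x - 1) * b) * (1 - (2 * x - 1) * b)⁻¹ * k2 + mul_inv_cancel₀ k1)
  | cons b' B ih =>
    have p1 : (A ++ b :: b' :: B ++ R).Perm ((A ++ [b']) ++ b :: B ++ R) := by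
      simp only [List.append_assoc, List.cons_append, List.nil_append]
      exact List.Perm.append_left _ (List.Perm.swap _ _ _)
    have p2 : (A ++ b :: b' :: B ++ R) = (A ++ [b]) ++ b' :: B ++ R := by simp
    have i1 := ih (A ++ [b']) b (hg.perm p1) (fun a ha => hκ a (p1.mem_iff.2 ha))
      (by simp at h1 ⊢; omega)
    have i2 := ih (A ++ [b]) b' (p2 ▸ hg) (fun a ha => hκ a (p2 ▸ ha)) (by simp at h1 ⊢; omega)
    have hT := T_list A (B ++ R) b b' (chain (A.length + 1) B.length (base x n))
    have hs := sumL_step (rhoL (2 * x - 1) A R) b b' B (by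
      refine ⟨?_, fun a ha => hg.2 a (by simp at ha ⊢; tauto)⟩
      have := hg.1
      rw [List.append_assoc] at this
      exact (List.nodup_append.1 (List.nodup_append.1 this).2.1).1)
    have hP := PL_swap (2 * x - 1) A B b b'
    simp only [List.append_assoc, List.cons_append, List.nil_append, List.length_append,
      List.length_cons, List.length_nil, zero_add, rhoL_append] at *
    rw [chain]
    have hbb : b - b' ≠ 0 := by
      have := hg.1
      rw [List.nodup_append] at this
      have := this.2.1
      rw [List.nodup_cons] at this
      exact sub_ne_zero.2 fun e => this.1 (by simp [e])
    apply mul_left_cancel₀ (mul_ne_zero two_ne_zero hbb)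
    rw [i1, i2] at hT
    linear_combination hT - PR R * sumL (fun c => rhoL (2 * x - 1) A R c * (mL b' c)⁻¹) b B * hP
      + PL (2 * x - 1) (A ++ b :: b' :: B) * PR R * hs

lemma eval_listProd_X_sub (R : List ℝ) (t : ℝ) (f : ℝ → ℝ) :
    ((R.map fun r => Polynomial.X - Polynomial.C (f r)).prod).eval t =
      (R.map fun r => t - f r).prod := by
  rw [Polynomial.eval_list_prod]
  simp [Function.comp_def]

lemma natDegree_listProd_X_sub (R : List ℝ) (f : ℝ → ℝ) :
    ((R.map fun r => Polynomial.X - Polynomial.C (f r)).prod).natDegree ≤ R.length := by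
  induction R with
  | nil => simp
  | cons r R ih =>
    simp only [List.map_cons, List.prod_cons, List.length_cons]
    refine Polynomial.natDegree_mul_le.trans ?_
    have := Polynomial.natDegree_X_sub_C_le (f r)
    omega

lemma prod_map_mul_const (R : List ℝ) (f : ℝ → ℝ) (s : ℝ) :
    (R.map fun r => s * f r).prod = s ^ R.length * (R.map f).prod := by
  rw [List.prod_map_mul]; simp

lemma sumL_even {κ b : ℝ} {B R : List ℝ} (hg : GenL (1 / 5) (b :: B))
    (hκ : ∀ a ∈ B, 1 - κ * a ≠ 0) (h1 : 1 - κ * b ≠ 0) (h2 : 1 + κ * b ≠ 0)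
    (hlen : B.length = R.length + 1) :
    (1 - κ * b) * sumL (rhoL κ [] R) b B = (1 + κ * b) * sumL (rhoL κ [] R) (-b) B := by
  have pb := hg.2 b (by simp)
  have ab := abs_lt_of_pos pb
  have hbB : b ∉ B := (List.nodup_cons.1 hg.1).1
  have hmem : ∀ c ∈ b :: -b :: B, |c| < 1 / 5 := by
    intro c hc
    simp only [List.mem_cons] at hc
    rcases hc with rfl | rfl | hc
    · exact ab
    · rwa [abs_neg]
    · exact abs_lt_of_pos (hg.2 c (by simp [hc]))
  have hnd : (b :: -b :: B).Nodup := by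
    rw [List.nodup_cons, List.nodup_cons, List.mem_cons]
    refine ⟨?_, ?_, (List.nodup_cons.1 hg.1).2⟩
    · rintro (h | h)
      · linarith [pb.1]
      · exact hbB h
    · intro h
      have := hg.2 (-b) (by simp [h])
      linarith [pb.1, this.1]
  have key := selSum_lagrange (k := kL) (h := fun c => (1 + 3 * c ^ 2) * (R.map (mR c)).prod)
    (u := fun c => ((1 + c) / (1 - 3 * c)) ^ 2) (s := fun c => (1 - 3 * c) ^ 2 / 2)
    (m := R.length + 1) hnd (by simp [hlen])
    (Polynomial.C (2 ^ (R.length + 1) / 4) * ((1 + 3 * Polynomial.X) *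
      (R.map fun r => Polynomial.X - Polynomial.C (r ^ 2)).prod)) ?_ ?_ ?_ ?_ ?_
  · have f0 : 1 + 3 * b ^ 2 ≠ 0 := by positivity
    have hb0 : b ≠ 0 := pb.1.ne'
    simp only [selSum, List.map_cons, List.prod_cons] at key
    simp only [sumL, rhoL, List.map_nil, List.prod_nil, mul_one]
    have id : (1 - κ * b) * selSum kL B (fun c => (1 + 3 * c ^ 2) * ((R.map (mR c)).prod *
          (1 - κ * c)⁻¹) * (2 * (c - b) * mL b c)⁻¹) + -(1 + κ * b) *
        selSum kL B (fun c => (1 + 3 * c ^ 2) * ((R.map (mR c)).prod *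
          (1 - κ * c)⁻¹) * (2 * (c - -b) * mL (-b) c)⁻¹) = 4 * b * selSum kL B
        (fun c => (1 + 3 * c ^ 2) * (R.map (mR c)).prod * kL c b * kL c (-b)) := by
      rw [← selSum_add_mul, ← selSum_mul]
      apply selSum_congr
      intro c hc
      have pc := hg.2 c (by simp [hc])
      have hcb : c - b ≠ 0 := sub_ne_zero.2 fun e => hbB (e ▸ hc)
      have hcb' : c + b ≠ 0 := by linarith [pc.1, pb.1]
      have := hκ c hc
      have d1 := (D_pos ab (abs_lt_of_pos pc)).ne'
      have d2 := (D_neg_left_pos ab (abs_lt_of_pos pc)).ne'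
      simp only [kL, mL, neg_neg, sub_neg_eq_add]
      field_simp
      ring
    have t1 : b * 4 * (1 + 3 * b ^ 2) * kL b (-b) = 1 := by
      simp only [kL, neg_neg, D]
      rw [show 2 * (b - -b) * (1 + 3 * b * b + b - b) = b * 4 * (1 + 3 * b ^ 2) by ring]
      exact mul_inv_cancel₀ (by positivity)
    have t2 : b * 4 * (1 + 3 * b ^ 2) * kL (-b) b = -1 := by
      simp only [kL, D]
      rw [show 2 * (-b - b) * (1 + 3 * -b * -b + -b - -b) = -(b * 4 * (1 + 3 * b ^ 2)) by ring,
        inv_neg, mul_neg, mul_inv_cancel₀ (by positivity)]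
    have t3 := mul_inv_cancel₀ h1
    have t4 : (1 + κ * b) * (1 - κ * -b)⁻¹ = 1 := by
      rw [show 1 - κ * -b = 1 + κ * b by ring]; exact mul_inv_cancel₀ h2
    linear_combination id + 4 * b * key
      - (R.map (mR b)).prod * (B.map (kL b)).prod * t1
      - (R.map (mR (-b))).prod * (B.map (kL (-b))).prod * t2
      + (R.map (mR b)).prod * (B.map (kL b)).prod * t3
      - (R.map (mR (-b))).prod * (B.map (kL (-b))).prod * t4
  · refine (Polynomial.natDegree_C_mul_le _ _).trans ?_
    refine Polynomial.natDegree_mul_le.trans ?_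
    have := natDegree_listProd_X_sub R (fun r => r ^ 2)
    have h3 : (1 + 3 * Polynomial.X : Polynomial ℝ).natDegree ≤ 1 := by
      compute_degree
    omega
  · intro c hc
    have := abs_lt.1 (hmem c hc)
    have : 1 - 3 * c ≠ 0 := by linarith
    positivity
  · intro c hc d hd hcd e
    have h3 := abs_lt.1 (hmem c hc)
    have h4 := abs_lt.1 (hmem d hd)
    have h5 : 1 - 3 * c ≠ 0 := by linarith
    have h6 : 1 - 3 * d ≠ 0 := by linarith
    have h7 := (D_neg_left_pos (hmem c hc) (hmem d hd)).ne'
    have h8 : c - d ≠ 0 := sub_ne_zero.2 hcd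
    simp only [div_pow] at e
    rw [div_eq_div_iff (by positivity) (by positivity)] at e
    apply mul_ne_zero h7 h8
    unfold D
    linear_combination (1 / 8) * e
  · intro c hc d hd hcd
    have h3 := abs_lt.1 (hmem c hc)
    have h4 := abs_lt.1 (hmem d hd)
    have h5 : 1 - 3 * c ≠ 0 := by linarith
    have h6 : 1 - 3 * d ≠ 0 := by linarith
    simp only [kL]
    congr 1
    have hp : (1 + d) / (1 - 3 * d) * (1 - 3 * d) = 1 + d := div_mul_cancel₀ _ h6
    have hq : (1 + c) / (1 - 3 * c) * (1 - 3 * c) = 1 + c := div_mul_cancel₀ _ h5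
    generalize (1 + d) / (1 - 3 * d) = p at *
    generalize (1 + c) / (1 - 3 * c) = q at *
    simp only [D]
    linear_combination -(1 / 4) * ((1 - 3 * c) ^ 2 * (p * (1 - 3 * d) + 1 + d) * hp -
      (1 - 3 * d) ^ 2 * (q * (1 - 3 * c) + 1 + c) * hq)
  · intro c hc
    have h3 := abs_lt.1 (hmem c hc)
    have h5 : 1 - 3 * c ≠ 0 := by linarith
    have : (R.map (mR c)).prod = ((1 - 3 * c) ^ 2) ^ R.length *
        (R.map fun r => ((1 + c) / (1 - 3 * c)) ^ 2 - r ^ 2).prod := by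
      rw [← prod_map_mul_const]
      congr 1
      apply List.map_congr_left
      intro r _
      simp only [mR, D]
      field_simp
      ring
    rw [Polynomial.eval_mul, Polynomial.eval_mul, eval_listProd_X_sub R _ (fun r => r ^ 2), this]
    simp only [Polynomial.eval_C, Polynomial.eval_add, Polynomial.eval_one, Polynomial.eval_mul,
      Polynomial.eval_ofNat, Polynomial.eval_X]
    generalize (R.map fun r => ((1 + c) / (1 - 3 * c)) ^ 2 - r ^ 2).prod = Z
    rw [div_pow (_ ^ 2)]
    field_simp
    ring

end XXZOverlap

namespace XXZOverlap

open MvPolynomial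

/-- The composition `T (o + k - 1) ∘ ⋯ ∘ T (o + 1) ∘ T o`. -/
def chainR (o : ℕ) : ℕ → Poly → Poly
  | 0, f => f
  | k + 1, f => T (o + k) (chainR o k f)

/-- The kernel of the right partial fraction expansions. -/
def kR (c b : ℝ) : ℝ := (2 * (b - c) * D c (-b))⁻¹

/-- The partial fraction sum of the right chain formula. -/
def sumR (ρ : ℝ → ℝ) (w : ℝ) (B : List ℝ) : ℝ :=
  ρ w * (B.map (kR w)).prod +
    selSum kR B fun c => (1 + 3 * w ^ 2) * ρ c * (2 * (w - c) * mR c w)⁻¹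

lemma sumR_step (ρ : ℝ → ℝ) (y w : ℝ) (B : List ℝ) (h : GenS (1 / 5) (y :: w :: B)) :
    D w y * sumR (fun c => ρ c * (mR c y)⁻¹) w B -
      (1 + 3 * w ^ 2) * sumR (fun c => ρ c * (mR c w)⁻¹) y B =
      2 * (y - w) * sumR ρ w (B ++ [y]) := by
  have h01 : y - w ≠ 0 := sub_ne_zero.2 (by have := h.1; simp at this; tauto)
  have p0 := h.2 y (by simp)
  have p1 := h.2 w (by simp)
  have d10 := (D_pos p1 p0).ne'
  have d01 := (D_pos p0 p1).ne'
  have e10 := (D_neg_right_pos p1 p0).ne'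
  have e01 := (D_neg_right_pos p0 p1).ne'
  simp only [sumR, selSum_append_singleton, List.map_append, List.prod_append, List.map_cons,
    List.prod_cons, List.map_nil, List.prod_nil, mul_one]
  have key : D w y * selSum kR B (fun c => (1 + 3 * w ^ 2) * (ρ c * (mR c y)⁻¹) *
        (2 * (w - c) * mR c w)⁻¹) + -(1 + 3 * w ^ 2) *
        selSum kR B (fun c => (1 + 3 * y ^ 2) * (ρ c * (mR c w)⁻¹) *
        (2 * (y - c) * mR c y)⁻¹) = 2 * (y - w) *
      selSum kR B (fun c => (1 + 3 * w ^ 2) * ρ c * (2 * (w - c) * mR c w)⁻¹ * kR c y) := by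
    rw [← selSum_add_mul, ← selSum_mul]
    apply selSum_congr
    intro c hc
    have pc := h.2 c (by simp [hc])
    have hc0 : y - c ≠ 0 := sub_ne_zero.2 (by have := h.1; simp at this; rintro rfl; tauto)
    have hc1 : w - c ≠ 0 := sub_ne_zero.2 (by have := h.1; simp at this; rintro rfl; tauto)
    have d0c := (D_pos pc p0).ne'
    have d1c := (D_pos pc p1).ne'
    have e0c := (D_neg_right_pos pc p0).ne'
    have e1c := (D_neg_right_pos pc p1).ne'
    have id : D w y * (y - c) - (1 + 3 * y ^ 2) * (w - c) = (y - w) * D c y := by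
      simp only [D]; ring
    simp only [kR, mR]
    field_simp
    linear_combination ρ c * id
  have t0 : D w y * (ρ w * (mR w y)⁻¹) = 2 * (y - w) * (ρ w * kR w y) := by
    simp only [kR, mR]; field_simp
  have t1 : -((1 + 3 * w ^ 2) * (ρ y * (mR y w)⁻¹)) =
      2 * (y - w) * ((1 + 3 * w ^ 2) * ρ y * (2 * (w - y) * mR y w)⁻¹) := by
    have h10 : w - y ≠ 0 := by intro e; apply h01; linarith
    simp only [mR]; field_simp; ring
  linear_combination key + (B.map (kR w)).prod * t0 + (B.map (kR y)).prod * t1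

/-- The kernel `ρ` in the right chain formula. -/
def rhoR (κ : ℝ) (A R : List ℝ) (c : ℝ) : ℝ :=
  (1 - κ * c) * (A.map fun a => mL a c).prod * (R.map fun r => (mR c r)⁻¹).prod

lemma rhoR_cons (κ : ℝ) (A R : List ℝ) (b : ℝ) :
    rhoR κ A (b :: R) = fun c => rhoR κ A R c * (mR c b)⁻¹ := by
  ext c; simp [rhoR]; ring

lemma eval_chainR {x : ℝ} {n : ℕ} (A B R : List ℝ) (w : ℝ)
    (hg : GenS (1 / 5) (A ++ B ++ w :: R)) (h1 : A.length + 1 = n)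
    (h2 : B.length + R.length = n) :
    eval (toV (A ++ B ++ w :: R)) (chainR A.length B.length (base x n)) =
      PL (2 * x - 1) A * PR (B ++ w :: R) * sumR (rhoR (2 * x - 1) A R) w B := by
  induction B using List.reverseRecOn generalizing w R with
  | nil =>
    have e : A ++ [] ++ w :: R = (A ++ [w]) ++ R := by simp
    rw [List.length_nil, chainR, e, eval_base_list (by simpa using h1) (by simpa using h2),
      PL_append_singleton, sumR, selSum, List.map_nil, List.prod_nil, rhoR, List.nil_append, PR]
    have hw := hg.2 w (by simp)
    have k2 := prod_map_mul_inv (L := R) (f := fun r => mR w r)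
      fun a ha => mR_ne hw (hg.2 a (by simp [ha]))
    linear_combination -PL (2 * x - 1) A * PR R * (A.map fun a => mL a w).prod *
      (1 - (2 * x - 1) * w) * k2
  | append_singleton B y ih =>
    have p2 : A ++ (B ++ [y]) ++ w :: R = A ++ B ++ y :: w :: R := by simp
    have p1 : (A ++ (B ++ [y]) ++ w :: R).Perm (A ++ B ++ w :: y :: R) := by
      rw [p2]
      exact List.Perm.append_left _ (List.Perm.swap _ _ _)
    have i1 := ih (y :: R) w (hg.perm p1) (by simp at h2 ⊢; omega)
    have i2 := ih (w :: R) y (p2 ▸ hg) (by simp at h2 ⊢; omega)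
    have hT := T_list (A ++ B) R y w (chainR A.length B.length (base x n))
    have hs := sumR_step (rhoR (2 * x - 1) A R) y w B (by
      have p3 : (A ++ B ++ y :: w :: R).Perm ((y :: w :: B) ++ (A ++ R)) := by
        rw [List.perm_iff_count]; intro a; simp [List.count_cons]; omega
      have := hg.perm (p2 ▸ p3)
      exact ⟨(List.nodup_append.1 this.1).1, fun a ha => this.2 a (by
        rw [List.mem_append]; exact Or.inl ha)⟩)
    have hP := PR_swap B R w y
    have hyw : y - w ≠ 0 := by
      have := hg.1
      rw [p2, List.nodup_append] at this
      have := this.2.1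
      rw [List.nodup_cons] at this
      exact sub_ne_zero.2 fun e => this.1 (by simp [e])
    rw [p2, List.length_append, List.length_singleton, chainR, ← List.length_append,
      List.append_assoc B, List.cons_append, List.nil_append]
    rw [i1, i2] at hT
    rw [rhoR_cons, rhoR_cons] at hT
    apply mul_left_cancel₀ (mul_ne_zero two_ne_zero hyw)
    linear_combination hT + PL (2 * x - 1) A *
      sumR (fun c => rhoR (2 * x - 1) A R c * (mR c y)⁻¹) w B * hP
      + PL (2 * x - 1) A * PR (B ++ y :: w :: R) * hs

lemma sumR_even {x w : ℝ} (hx : 0 < x) {A B : List ℝ} (hg : GenL (1 / 5) (w :: B))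
    (hlen : B.length = A.length + 1) :
    (1 - (2 / x - 1) * w) * sumR (rhoR (2 * x - 1) A []) w B =
      (1 + (2 / x - 1) * w) * sumR (rhoR (2 * x - 1) A []) (-w) B := by
  have pb := hg.2 w (by simp)
  have ab := abs_lt_of_pos pb
  have hbB : w ∉ B := (List.nodup_cons.1 hg.1).1
  have hmem : ∀ c ∈ w :: -w :: B, |c| < 1 / 5 := by
    intro c hc
    simp only [List.mem_cons] at hc
    rcases hc with rfl | rfl | hc
    · exact ab
    · rwa [abs_neg]
    · exact abs_lt_of_pos (hg.2 c (by simp [hc]))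
  have hnd : (w :: -w :: B).Nodup := by
    rw [List.nodup_cons, List.nodup_cons, List.mem_cons]
    refine ⟨?_, ?_, (List.nodup_cons.1 hg.1).2⟩
    · rintro (h | h)
      · linarith [pb.1]
      · exact hbB h
    · intro h
      have := hg.2 (-w) (by simp [h])
      linarith [pb.1, this.1]
  have key := selSum_lagrange (k := kR)
    (h := fun c => (1 - (2 * x - 1) * c) * (1 - (2 / x - 1) * c) * (A.map fun a => mL a c).prod)
    (u := fun c => ((1 - c) / (1 + 3 * c)) ^ 2) (s := fun c => (1 + 3 * c) ^ 2 / 2)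
    (m := A.length + 1) hnd (by simp [hlen])
    (Polynomial.C (2 ^ (A.length + 1)) * ((Polynomial.C ((x + 1) ^ 2 / (4 * x)) * Polynomial.X -
      Polynomial.C ((x - 1) ^ 2 / (4 * x))) *
      (A.map fun r => Polynomial.X - Polynomial.C (r ^ 2)).prod)) ?_ ?_ ?_ ?_ ?_
  · have f0 : 1 + 3 * w ^ 2 ≠ 0 := by positivity
    have hw0 : w ≠ 0 := pb.1.ne'
    simp only [selSum, List.map_cons, List.prod_cons] at key
    simp only [sumR, rhoR, List.map_nil, List.prod_nil, mul_one]
    generalize 2 / x - 1 = κ at *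
    have id : (1 - κ * w) * selSum kR B (fun c => (1 + 3 * w ^ 2) * ((1 - (2 * x - 1) * c) *
          (A.map fun a => mL a c).prod) * (2 * (w - c) * mR c w)⁻¹) + -(1 + κ * w) *
        selSum kR B (fun c => (1 + 3 * (-w) ^ 2) * ((1 - (2 * x - 1) * c) *
          (A.map fun a => mL a c).prod) * (2 * (-w - c) * mR c (-w))⁻¹) =
        (-(4 * w * (1 + 3 * w ^ 2))) * selSum kR B
        (fun c => (1 - (2 * x - 1) * c) * (1 - κ * c) * (A.map fun a => mL a c).prod *
          kR c w * kR c (-w)) := by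
      rw [← selSum_add_mul, ← selSum_mul]
      apply selSum_congr
      intro c hc
      have pc := hg.2 c (by simp [hc])
      have hcb : w - c ≠ 0 := sub_ne_zero.2 fun e => hbB (e ▸ hc)
      have hcb' : -w - c ≠ 0 := by linarith [pc.1, pb.1]
      have d1 := (D_pos (abs_lt_of_pos pc) ab).ne'
      have d2 := (D_neg_right_pos (abs_lt_of_pos pc) ab).ne'
      simp only [kR, mR, neg_neg]
      field_simp
      ring
    have t1 : w * 4 * (1 + 3 * w ^ 2) * kR w (-w) = -1 := by
      simp only [kR, neg_neg, D]
      rw [show 2 * (-w - w) * (1 + 3 * w * w + w - w) = -(w * 4 * (1 + 3 * w ^ 2)) by ring,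
        inv_neg, mul_neg, mul_inv_cancel₀ (by positivity)]
    have t2 : w * 4 * (1 + 3 * w ^ 2) * kR (-w) w = 1 := by
      simp only [kR, D]
      rw [show 2 * (w - -w) * (1 + 3 * -w * -w + -w - -w) = w * 4 * (1 + 3 * w ^ 2) by ring,
        mul_inv_cancel₀ (by positivity)]
    linear_combination id - 4 * w * (1 + 3 * w ^ 2) * key
      + (1 - (2 * x - 1) * w) * (1 - κ * w) * (A.map fun a => mL a w).prod *
        (B.map (kR w)).prod * t1
      + (1 + (2 * x - 1) * w) * (1 + κ * w) * (A.map fun a => mL a (-w)).prod *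
        (B.map (kR (-w))).prod * t2
  · refine (Polynomial.natDegree_C_mul_le _ _).trans ?_
    refine Polynomial.natDegree_mul_le.trans ?_
    have := natDegree_listProd_X_sub A (fun r => r ^ 2)
    have h3 : (Polynomial.C ((x + 1) ^ 2 / (4 * x)) * Polynomial.X -
      Polynomial.C ((x - 1) ^ 2 / (4 * x))).natDegree ≤ 1 := by
      compute_degree
    omega
  · intro c hc
    have := abs_lt.1 (hmem c hc)
    have : 1 + 3 * c ≠ 0 := by linarith
    positivity
  · intro c hc d hd hcd e
    have h3 := abs_lt.1 (hmem c hc)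
    have h4 := abs_lt.1 (hmem d hd)
    have h5 : 1 + 3 * c ≠ 0 := by linarith
    have h6 : 1 + 3 * d ≠ 0 := by linarith
    have h7 := (D_neg_right_pos (hmem c hc) (hmem d hd)).ne'
    have h8 : c - d ≠ 0 := sub_ne_zero.2 hcd
    simp only [div_pow] at e
    rw [div_eq_div_iff (by positivity) (by positivity)] at e
    apply mul_ne_zero h7 h8
    unfold D
    linear_combination -(1 / 8) * e
  · intro c hc d hd hcd
    have h3 := abs_lt.1 (hmem c hc)
    have h4 := abs_lt.1 (hmem d hd)
    have h5 : 1 + 3 * c ≠ 0 := by linarith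
    have h6 : 1 + 3 * d ≠ 0 := by linarith
    simp only [kR]
    congr 1
    have hp : (1 - d) / (1 + 3 * d) * (1 + 3 * d) = 1 - d := div_mul_cancel₀ _ h6
    have hq : (1 - c) / (1 + 3 * c) * (1 + 3 * c) = 1 - c := div_mul_cancel₀ _ h5
    generalize (1 - d) / (1 + 3 * d) = p at *
    generalize (1 - c) / (1 + 3 * c) = q at *
    simp only [D]
    linear_combination -(1 / 4) * ((1 + 3 * c) ^ 2 * (p * (1 + 3 * d) + 1 - d) * hp -
      (1 + 3 * d) ^ 2 * (q * (1 + 3 * c) + 1 - c) * hq)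
  · intro c hc
    have h3 := abs_lt.1 (hmem c hc)
    have h5 : 1 + 3 * c ≠ 0 := by linarith
    have : (A.map fun a => mL a c).prod = ((1 + 3 * c) ^ 2) ^ A.length *
        (A.map fun r => ((1 - c) / (1 + 3 * c)) ^ 2 - r ^ 2).prod := by
      rw [← prod_map_mul_const]
      congr 1
      apply List.map_congr_left
      intro r _
      simp only [mL, D]
      field_simp
      ring
    rw [Polynomial.eval_mul, Polynomial.eval_mul, eval_listProd_X_sub A _ (fun r => r ^ 2), this]
    simp only [Polynomial.eval_C, Polynomial.eval_sub, Polynomial.eval_mul, Polynomial.eval_X]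
    generalize (A.map fun r => ((1 - c) / (1 + 3 * c)) ^ 2 - r ^ 2).prod = Z
    have hq : (1 - c) / (1 + 3 * c) * (1 + 3 * c) = 1 - c := div_mul_cancel₀ _ h5
    generalize (1 - c) / (1 + 3 * c) = q at *
    have hid : (1 - (2 * x - 1) * c) * (1 - (2 / x - 1) * c) = (1 + 3 * c) ^ 2 *
        ((x + 1) ^ 2 / (4 * x) * q ^ 2 - (x - 1) ^ 2 / (4 * x)) := by
      have h7 : (1 - (2 * x - 1) * c) * (1 - (2 / x - 1) * c) =
          (x + 1) ^ 2 / (4 * x) * (1 - c) ^ 2 - (1 + 3 * c) ^ 2 * ((x - 1) ^ 2 / (4 * x)) := by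
        field_simp
        ring
      rw [h7, ← hq]
      ring
    have h2 : (2 : ℝ) ^ (A.length + 1) * ((1 + 3 * c) ^ 2 / 2) ^ (A.length + 1) =
        ((1 + 3 * c) ^ 2) ^ A.length * (1 + 3 * c) ^ 2 := by
      rw [← mul_pow, mul_div_cancel₀ _ (two_ne_zero), pow_succ]
    rw [hid]
    linear_combination -((x + 1) ^ 2 / (4 * x) * q ^ 2 - (x - 1) ^ 2 / (4 * x)) * Z * h2

end XXZOverlap

namespace XXZOverlap

open MvPolynomial

lemma eval_bind (v : ℕ → ℝ) (f : ℕ → Poly) (p : Poly) :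
    eval v (bind₁ f p) = eval (fun i => eval v (f i)) p := by
  rw [← coe_aeval_eq_eval, ← coe_aeval_eq_eval]
  simp only [RingHom.coe_coe, aeval_bind₁]

lemma toV_seg (v : ℕ → ℝ) (m : ℕ) : toV (seg v 0 m) = fun i => if i < m then v i else 0 := by
  have h : ∀ o m i, (seg v o m).getD i 0 = if i < m then v (o + i) else 0 := by
    intro o m
    induction m generalizing o with
    | zero => simp [seg]
    | succ m ih =>
      intro i
      cases i with
      | zero => simp [seg]
      | succ i =>
        rw [seg, List.getD_cons_succ, ih]
        simp only [add_lt_add_iff_right]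
        congr 2
        omega
  ext i
  simpa [toV] using h 0 m i

lemma length_seg {A : Type*} (v : ℕ → A) (o m : ℕ) : (seg v o m).length = m := by
  induction m generalizing o with
  | zero => rfl
  | succ m ih => simp [seg, ih]

lemma mem_seg {A : Type*} {v : ℕ → A} {o m : ℕ} {a : A} (h : a ∈ seg v o m) :
    ∃ i, o ≤ i ∧ a = v i := by
  induction m generalizing o with
  | zero => simp [seg] at h
  | succ m ih =>
    rcases List.mem_cons.1 h with rfl | h
    · exact ⟨o, le_rfl, rfl⟩
    · obtain ⟨i, h1, h2⟩ := ih h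
      exact ⟨i, by omega, h2⟩

lemma genL_seg {δ : ℝ} {v : ℕ → ℝ} (h : Gen δ v) (o m : ℕ) : GenL δ (seg v o m) := by
  refine ⟨?_, fun a ha => ?_⟩
  · induction m generalizing o with
    | zero => simp [seg]
    | succ m ih =>
      rw [seg, List.nodup_cons]
      refine ⟨fun hm => ?_, ih _⟩
      obtain ⟨i, h1, h2⟩ := mem_seg hm
      have := h.1 h2
      omega
  · obtain ⟨i, -, rfl⟩ := mem_seg ha
    exact h.2 i

lemma list_ext {δ : ℝ} (hδ : 0 < δ) {m : ℕ} {p q : Poly}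
    (h : ∀ L, GenL δ L → L.length = m → eval (toV L) p = eval (toV L) q)
    (L : List ℝ) (hL : L.length = m) : eval (toV L) p = eval (toV L) q := by
  have key : ∀ v (r : Poly), eval v (bind₁ (fun i => if i < m then X i else 0) r) =
      eval (fun i => if i < m then v i else 0) r := by
    intro v r
    rw [eval_bind]
    congr 2
    ext i
    split_ifs <;> simp
  have := poly_ext hδ (p := bind₁ (fun i => if i < m then X i else 0) p)
    (q := bind₁ (fun i => if i < m then X i else 0) q) fun v hv => by
      rw [key, key, ← toV_seg]
      exact h _ (genL_seg hv 0 m) (length_seg _ _ _)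
  have := congrArg (eval (toV L)) this
  rw [key, key] at this
  convert this using 3 <;>
  · ext i
    split_ifs with hi
    · rfl
    · simp [toV, List.getD_eq_getElem?_getD, List.getElem?_eq_none (by omega : L.length ≤ i)]

/-- Change of sign of the `k`-th variable. -/
def negAt (k : ℕ) (p : Poly) : Poly := bind₁ (fun i => if i = k then -X i else X i) p

lemma eval_negAt (lv rv : List ℝ) (v : ℝ) (p : Poly) :
    eval (toV (lv ++ v :: rv)) (negAt lv.length p) = eval (toV (lv ++ -v :: rv)) p := by
  rw [negAt, eval_bind]
  congr 2
  ext i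
  split_ifs with h
  · subst h; simp
  · simp only [eval_X, toV, List.getD_eq_getElem?_getD]
    congr 1
    rcases lt_or_gt_of_ne h with h | h
    · rw [List.getElem?_append_left h, List.getElem?_append_left h]
    · rw [List.getElem?_append_right h.le, List.getElem?_append_right h.le]
      obtain ⟨k, hk⟩ : ∃ k, i - lv.length = k + 1 := ⟨i - lv.length - 1, by omega⟩
      rw [hk]; simp

/-- The coefficient in the left reflection relation. -/
def kapL (x : ℝ) (a : Bool) : ℝ := if a then 2 * x - 1 else 0

/-- The coefficient in the right reflection relation. -/
def kapR (x : ℝ) (a : Bool) : ℝ := if a then 2 / x - 1 else 0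

lemma W_true (o k : ℕ) (r : List Bool) (f : Poly) :
    W o (List.replicate k true ++ r) f = W (o + k) r f := by
  induction k generalizing o with
  | zero => rfl
  | succ k ih =>
    rw [List.replicate_succ, List.cons_append, W, ih]
    congr 1
    omega

lemma W_false (o k : ℕ) (f : Poly) : W o (List.replicate k false) f = f := by
  induction k generalizing o with
  | zero => rfl
  | succ k ih => simp [List.replicate_succ, W, List.count_replicate, chain, ih]

lemma P_base (x : ℝ) (n : ℕ) :
    P x n (List.replicate n true ++ List.replicate n false) = base x n := by
  rw [P, if_pos (by simp [List.count_replicate]), W_true, W_false]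

lemma P_first_up (x : ℝ) (n : ℕ) :
    P x (n + 1) (false :: (List.replicate (n + 1) true ++ List.replicate n false)) =
      chain 0 (n + 1) (base x (n + 1)) := by
  rw [P, if_pos (by simp [List.count_replicate]), W, W_true, W_false]
  simp [List.count_replicate]

lemma P_last_down (x : ℝ) (n : ℕ) :
    P x (n + 1) (List.replicate n true ++ List.replicate (n + 1) false ++ [true]) =
      chainR n (n + 1) (base x (n + 1)) := by
  have h : ∀ j m, j + m = n + 1 → P x (n + 1) (List.replicate n true ++
      (List.replicate j false ++ true :: List.replicate m false)) =
      chainR n j (base x (n + 1)) := by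
    intro j
    induction j with
    | zero =>
      intro m hm
      obtain rfl : m = n + 1 := by omega
      rw [chainR, ← P_base, List.replicate_zero, List.nil_append, List.replicate_succ' (a := true),
        List.append_assoc]
      rfl
    | succ j ih =>
      intro m hm
      have := P_ud x (n + 1) (List.replicate n true ++ List.replicate j false)
        (List.replicate m false)
      rw [chainR, ← ih (m + 1) (by omega), List.replicate_succ', List.replicate_succ]
      simpa using this
  have := h (n + 1) 0 (by omega)
  simpa using this

lemma PL_neg (c b : ℝ) (B : List ℝ) :
    (1 - c * b) * PL c (-b :: B) = (1 + c * b) * PL c (b :: B) := by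
  have : ∀ y : ℝ, mL (-b) y = mL b y := fun y => by simp only [mL, neg_neg]; ring
  have h2 : mL (-b) = mL b := funext this
  simp only [PL, h2]
  ring

lemma PR_neg (b : ℝ) (B : List ℝ) : PR (B ++ [-b]) = PR (B ++ [b]) := by
  have : ∀ y : ℝ, mR y (-b) = mR y b := fun y => by simp only [mR, neg_neg]; ring
  induction B with
  | nil => simp [PR]
  | cons a B ih => simp [PR, ih, this]

/-- A bound ensuring that boundary factors do not vanish. -/
lemma exists_small (c : ℝ) : ∃ δ : ℝ, 0 < δ ∧ δ ≤ 1 / 5 ∧ ∀ a, |a| < δ → 1 - c * a ≠ 0 := by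
  refine ⟨1 / (5 + |c|), by positivity, ?_, ?_⟩
  · apply one_div_le_one_div_of_le (by norm_num); linarith [abs_nonneg c]
  · intro a ha
    rw [lt_div_iff₀ (by positivity)] at ha
    have h1 : |c * a| < 1 := by
      rw [abs_mul]; nlinarith [abs_nonneg a, abs_nonneg c]
    have := (abs_lt.1 h1).2
    linarith

end XXZOverlap

namespace XXZOverlap

open MvPolynomial

variable {x : ℝ} {n : ℕ}

lemma exists_append_of_length {A : Type*} {L : List A} {j k : ℕ} (h : L.length = j + k) :
    ∃ l r, L = l ++ r ∧ l.length = j ∧ r.length = k :=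
  ⟨L.take j, L.drop j, by simp, by simp [h], by simp [h]⟩

lemma exists_pair_of_length {A B : Type*} {L : List A} {l r : List B} {a b : B}
    (h : L.length = (l ++ a :: b :: r).length) :
    ∃ lv v w rv, L = lv ++ v :: w :: rv ∧ l.length = lv.length ∧ rv.length = r.length := by
  obtain ⟨lv, L', rfl, h1, h2⟩ := exists_append_of_length (j := l.length) (k := r.length + 1 + 1)
    (by simpa using h)
  obtain ⟨v, L', rfl⟩ := List.exists_cons_of_length_eq_add_one h2
  obtain ⟨w, L', rfl⟩ := List.exists_cons_of_length_eq_add_one (by simpa using h2)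
  exact ⟨lv, v, w, L', rfl, h1.symm, by simpa using h2⟩

lemma counts_tail {n : ℕ} {a : Bool} {β : List Bool}
    (h : (a :: β).count true = n ∧ (a :: β).count false = n) : ∃ k, n = k + 1 := by
  refine ⟨n - 1, ?_⟩
  cases a <;> simp at h <;> omega

lemma psi_left_base_down (v : ℝ) (L : List ℝ) (hL : L.length = n + (n + 1)) :
    (1 - (2 * x - 1) * v) * psi x (n + 1)
        (true :: (List.replicate n true ++ List.replicate (n + 1) false)) (-v :: L) =
      (1 + (2 * x - 1) * v) * psi x (n + 1)
        (true :: (List.replicate n true ++ List.replicate (n + 1) false)) (v :: L) := by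
  obtain ⟨B, R, rfl, hB, hR⟩ := exists_append_of_length hL
  have h := P_base x (n + 1)
  rw [List.replicate_succ (a := true), List.cons_append] at h
  rw [psi, psi, h, ← List.cons_append, ← List.cons_append,
    eval_base_list (by simpa using hB) (by simpa using hR),
    eval_base_list (by simpa using hB) (by simpa using hR)]
  linear_combination PR R * PL_neg (2 * x - 1) v B

lemma psi_left_base_up {δ : ℝ} (h5 : δ ≤ 1 / 5) (hδ : ∀ a, |a| < δ → 1 - (2 * x - 1) * a ≠ 0)
    (v : ℝ) (L : List ℝ) (hg : GenL δ (v :: L)) (hL : L.length = (n + 1) + n) :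
    psi x (n + 1) (false :: (List.replicate (n + 1) true ++ List.replicate n false)) (-v :: L) =
      psi x (n + 1) (false :: (List.replicate (n + 1) true ++ List.replicate n false))
        (v :: L) := by
  obtain ⟨B, R, rfl, hB, hR⟩ := exists_append_of_length hL
  have pv := hg.2 v (by simp)
  have av : |v| < δ := by rw [abs_of_pos pv.1]; exact pv.2
  have aL : ∀ a ∈ B ++ R, |a| < δ := fun a ha => by
    have := hg.2 a (List.mem_cons_of_mem _ ha)
    rw [abs_of_pos this.1]; exact this.2
  have s1 : GenS (1 / 5) ([] ++ v :: B ++ R) := by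
    refine ⟨hg.1, fun a ha => lt_of_lt_of_le ?_ h5⟩
    rcases List.mem_cons.1 ha with rfl | ha
    · exact av
    · exact aL a ha
  have s2 : GenS (1 / 5) ([] ++ -v :: B ++ R) := by
    refine ⟨?_, fun a ha => lt_of_lt_of_le ?_ h5⟩
    · change (-v :: (B ++ R)).Nodup
      rw [List.nodup_cons]
      refine ⟨fun h => ?_, (List.nodup_cons.1 hg.1).2⟩
      have := hg.2 _ (List.mem_cons_of_mem _ h)
      linarith [this.1, pv.1]
    · rcases List.mem_cons.1 ha with rfl | ha
      · rwa [abs_neg]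
      · exact aL a ha
  have e1 := eval_chain (x := x) (n := n + 1) [] B R v s1 (fun a ha => hδ a (by
      rcases List.mem_cons.1 ha with rfl | ha
      · exact av
      · exact aL a ha)) (by simpa using hB) (by simpa using hR)
  have e2 := eval_chain (x := x) (n := n + 1) [] B R (-v) s2 (fun a ha => hδ a (by
      rcases List.mem_cons.1 ha with rfl | ha
      · rwa [abs_neg]
      · exact aL a ha)) (by simpa using hB) (by simpa using hR)
  have h1 := hδ v av
  have h2 : 1 + (2 * x - 1) * v ≠ 0 := by
    have := hδ (-v) (by rwa [abs_neg])
    rwa [mul_neg, sub_neg_eq_add] at this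
  have ev := sumL_even (κ := 2 * x - 1) (b := v) (B := B) (R := R)
    ⟨(List.nodup_append.1 (show (v :: B ++ R).Nodup from hg.1)).1, fun a ha => by
      have := hg.2 a (by simp at ha ⊢; tauto)
      exact ⟨this.1, by linarith [this.2]⟩⟩
    (fun a ha => hδ a (aL a (by simp [ha]))) h1 h2 (by omega)
  simp only [List.nil_append, List.length_nil, hB, List.cons_append] at e1 e2
  rw [psi, psi, P_first_up, e1, e2]
  apply mul_left_cancel₀ (mul_ne_zero h1 h2)
  linear_combination (1 + (2 * x - 1) * v) * PR R * sumL (rhoL (2 * x - 1) [] R) (-v) B *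
    PL_neg (2 * x - 1) v B - (1 + (2 * x - 1) * v) * PR R * PL (2 * x - 1) (v :: B) * ev

lemma psi_left_of_genL {δ : ℝ} (h5 : δ ≤ 1 / 5) (hδ : ∀ a, |a| < δ → 1 - (2 * x - 1) * a ≠ 0)
    (a : Bool) (β : List Bool) (h1 : (a :: β).count true = n + 1)
    (h2 : (a :: β).count false = n + 1) : ∀ (v : ℝ) (L : List ℝ), L.length = β.length →
      GenL δ (v :: L) → (1 - kapL x a * v) * psi x (n + 1) (a :: β) (-v :: L) =
      (1 + kapL x a * v) * psi x (n + 1) (a :: β) (v :: L) := by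
  have step : ∀ l r, (∀ (v : ℝ) (L : List ℝ), L.length = (l ++ true :: false :: r).length →
      GenL δ (v :: L) →
      (1 - kapL x a * v) * psi x (n + 1) (a :: (l ++ true :: false :: r)) (-v :: L) =
      (1 + kapL x a * v) * psi x (n + 1) (a :: (l ++ true :: false :: r)) (v :: L)) →
      (∀ (v : ℝ) (L : List ℝ), L.length = (l ++ false :: true :: r).length → GenL δ (v :: L) →
      (1 - kapL x a * v) * psi x (n + 1) (a :: (l ++ false :: true :: r)) (-v :: L) =
      (1 + kapL x a * v) * psi x (n + 1) (a :: (l ++ false :: true :: r)) (v :: L)) := by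
    intro l r ih v L hL hg
    obtain ⟨lv, s, w, rv, rfl, hl, hr⟩ := exists_pair_of_length hL
    have p : (v :: (lv ++ s :: w :: rv)).Perm (v :: (lv ++ w :: s :: rv)) :=
      ((List.Perm.swap _ _ _).append_left _).cons _
    have hsw : s - w ≠ 0 := by
      have := hg.1
      simp only [List.nodup_cons, List.nodup_append] at this
      exact sub_ne_zero.2 fun e => this.2.2.1.1 (by simp [e])
    have i1 := ih v (lv ++ s :: w :: rv) (by simp [hl, hr]) hg
    have i2 := ih v (lv ++ w :: s :: rv) (by simp [hl, hr]) (hg.perm p)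
    have j1 := psi_du (x := x) (n := n + 1) (l := a :: l) (r := r) (lv := v :: lv) (rv := rv)
      (by simp [hl]) s w
    have j2 := psi_du (x := x) (n := n + 1) (l := a :: l) (r := r) (lv := -v :: lv) (rv := rv)
      (by simp [hl]) s w
    simp only [List.cons_append] at j1 j2
    apply mul_left_cancel₀ (mul_ne_zero two_ne_zero hsw)
    linear_combination (1 - kapL x a * v) * j2 - (1 + kapL x a * v) * j1 + D s w * i2 -
      (1 + 3 * w ^ 2) * i1
  cases a
  · refine word_induction (Q := fun β => ∀ (v : ℝ) (L : List ℝ), L.length = β.length →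
      GenL δ (v :: L) → (1 - kapL x false * v) * psi x (n + 1) (false :: β) (-v :: L) =
      (1 + kapL x false * v) * psi x (n + 1) (false :: β) (v :: L))
      (k := n + 1) (m := n) ?_ step β (by simpa using h1) (by simpa using h2)
    intro v L hL hg
    simp only [kapL, Bool.false_eq_true, if_false, zero_mul, sub_zero, add_zero, one_mul]
    exact psi_left_base_up h5 hδ v L hg (by simpa using hL)
  · refine word_induction (Q := fun β => ∀ (v : ℝ) (L : List ℝ), L.length = β.length →
      GenL δ (v :: L) → (1 - kapL x true * v) * psi x (n + 1) (true :: β) (-v :: L) =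
      (1 + kapL x true * v) * psi x (n + 1) (true :: β) (v :: L))
      (k := n) (m := n + 1) ?_ step β (by simpa using h1) (by simpa using h2)
    intro v L hL hg
    simp only [kapL, if_true]
    exact psi_left_base_down v L (by simpa using hL)

lemma psi_left (x : ℝ) (n : ℕ) (a : Bool) (β : List Bool) (v : ℝ) (L : List ℝ)
    (hL : L.length = β.length) : (1 - kapL x a * v) * psi x n (a :: β) (-v :: L) =
      (1 + kapL x a * v) * psi x n (a :: β) (v :: L) := by
  by_cases h : (a :: β).count true = n ∧ (a :: β).count false = n
  · obtain ⟨n, rfl⟩ := counts_tail h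
    obtain ⟨δ, h0, h5, hδ⟩ := exists_small (2 * x - 1)
    have := list_ext h0 (m := β.length + 1)
      (p := (1 - C (kapL x a) * X 0) * negAt 0 (P x (n + 1) (a :: β)))
      (q := (1 + C (kapL x a) * X 0) * P x (n + 1) (a :: β)) (fun M hM hlen => by
        obtain ⟨w, M, rfl⟩ := List.exists_cons_of_length_eq_add_one hlen
        have e := eval_negAt [] M w (P x (n + 1) (a :: β))
        simp only [List.nil_append, List.length_nil] at e
        rw [map_mul, e]
        have := psi_left_of_genL h5 hδ a β h.1 h.2 w M (by simpa using hlen) hM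
        simpa [psi, toV] using this) (v :: L) (by simpa using hL)
    have e := eval_negAt [] L v (P x (n + 1) (a :: β))
    simp only [List.nil_append, List.length_nil] at e
    rw [map_mul, e] at this
    simpa [psi, toV] using this
  · rw [psi_eq_zero h, psi_eq_zero h, mul_zero, mul_zero]

end XXZOverlap

namespace XXZOverlap

open MvPolynomial

variable {x : ℝ} {n : ℕ}

lemma psi_right_base_up (v : ℝ) (L : List ℝ) (hL : L.length = (n + 1) + n) :
    psi x (n + 1) (List.replicate (n + 1) true ++ List.replicate n false ++ [false])
        (L ++ [-v]) =
      psi x (n + 1) (List.replicate (n + 1) true ++ List.replicate n false ++ [false])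
        (L ++ [v]) := by
  obtain ⟨B, R, rfl, hB, hR⟩ := exists_append_of_length hL
  have h := P_base x (n + 1)
  rw [List.replicate_succ' (a := false), ← List.append_assoc] at h
  rw [psi, psi, h, List.append_assoc, List.append_assoc,
    eval_base_list (by simpa using hB) (by simpa using hR),
    eval_base_list (by simpa using hB) (by simpa using hR), PR_neg]

lemma psi_right_base_down (hx : 0 < x) (w : ℝ) (L : List ℝ) (hg : GenL (1 / 5) (w :: L))
    (hL : L.length = n + (n + 1)) :
    (1 + (2 / x - 1) * w) * psi x (n + 1)
        (List.replicate n true ++ List.replicate (n + 1) false ++ [true]) (L ++ [-w]) =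
      (1 - (2 / x - 1) * w) * psi x (n + 1)
        (List.replicate n true ++ List.replicate (n + 1) false ++ [true]) (L ++ [w]) := by
  obtain ⟨A, B, rfl, hA, hB⟩ := exists_append_of_length hL
  have pw := hg.2 w (by simp)
  have aw : |w| < 1 / 5 := abs_lt_of_pos pw
  have aL : ∀ a ∈ A ++ B, |a| < 1 / 5 := fun a ha => abs_lt_of_pos (hg.2 a (by simp at ha ⊢; tauto))
  have s1 : GenS (1 / 5) (w :: (A ++ B)) := ⟨hg.1, fun a ha => abs_lt_of_pos (hg.2 a ha)⟩
  have s2 : GenS (1 / 5) (-w :: (A ++ B)) := by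
    refine ⟨?_, fun a ha => ?_⟩
    · rw [List.nodup_cons]
      refine ⟨fun h => ?_, (List.nodup_cons.1 hg.1).2⟩
      have := hg.2 _ (List.mem_cons_of_mem _ h)
      linarith [this.1, pw.1]
    · rcases List.mem_cons.1 ha with rfl | ha
      · rwa [abs_neg]
      · exact aL a ha
  have p : ∀ b : ℝ, (b :: (A ++ B)).Perm (A ++ B ++ [b]) := fun b => by
    exact (List.perm_append_singleton b (A ++ B)).symm
  have e1 := eval_chainR (x := x) (n := n + 1) A B [] w (s1.perm (p w)) (by omega)
    (by simpa using hB)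
  have e2 := eval_chainR (x := x) (n := n + 1) A B [] (-w) (s2.perm (p (-w))) (by omega)
    (by simpa using hB)
  have ev := sumR_even (w := w) (B := B) (A := A) hx
    ⟨by
      have := hg.1
      rw [List.nodup_cons, List.nodup_append] at this
      rw [List.nodup_cons]
      exact ⟨fun h => this.1 (by simp [h]), this.2.2.1⟩,
      fun a ha => hg.2 a (by simp at ha ⊢; tauto)⟩ (by omega)
  simp only [hA, hB] at e1 e2
  rw [psi, psi, P_last_down, e1, e2, PR_neg]
  linear_combination -PL (2 * x - 1) A * PR (B ++ [w]) * ev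

lemma psi_right_of_genL (hx : 0 < x)
    (a : Bool) (β : List Bool) (h1 : (β ++ [a]).count true = n + 1)
    (h2 : (β ++ [a]).count false = n + 1) : ∀ (v : ℝ) (L : List ℝ), L.length = β.length →
      GenL (1 / 5) (v :: L) → (1 + kapR x a * v) * psi x (n + 1) (β ++ [a]) (L ++ [-v]) =
      (1 - kapR x a * v) * psi x (n + 1) (β ++ [a]) (L ++ [v]) := by
  have step : ∀ l r, (∀ (v : ℝ) (L : List ℝ), L.length = (l ++ true :: false :: r).length →
      GenL (1 / 5) (v :: L) →
      (1 + kapR x a * v) * psi x (n + 1) (l ++ true :: false :: r ++ [a]) (L ++ [-v]) =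
      (1 - kapR x a * v) * psi x (n + 1) (l ++ true :: false :: r ++ [a]) (L ++ [v])) →
      (∀ (v : ℝ) (L : List ℝ), L.length = (l ++ false :: true :: r).length → GenL (1 / 5) (v :: L) →
      (1 + kapR x a * v) * psi x (n + 1) (l ++ false :: true :: r ++ [a]) (L ++ [-v]) =
      (1 - kapR x a * v) * psi x (n + 1) (l ++ false :: true :: r ++ [a]) (L ++ [v])) := by
    intro l r ih v L hL hg
    obtain ⟨lv, s, w, rv, rfl, hl, hr⟩ := exists_pair_of_length hL
    have p : (v :: (lv ++ s :: w :: rv)).Perm (v :: (lv ++ w :: s :: rv)) :=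
      ((List.Perm.swap _ _ _).append_left _).cons _
    have hsw : s - w ≠ 0 := by
      have := hg.1
      simp only [List.nodup_cons, List.nodup_append] at this
      exact sub_ne_zero.2 fun e => this.2.2.1.1 (by simp [e])
    have i1 := ih v (lv ++ s :: w :: rv) (by simp [hl, hr]) hg
    have i2 := ih v (lv ++ w :: s :: rv) (by simp [hl, hr]) (hg.perm p)
    have j1 := psi_du (x := x) (n := n + 1) (l := l) (r := r ++ [a]) (lv := lv) (rv := rv ++ [v])
      hl s w
    have j2 := psi_du (x := x) (n := n + 1) (l := l) (r := r ++ [a]) (lv := lv) (rv := rv ++ [-v])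
      hl s w
    simp only [List.cons_append, List.append_assoc] at j1 j2 i1 i2 ⊢
    apply mul_left_cancel₀ (mul_ne_zero two_ne_zero hsw)
    linear_combination (1 + kapR x a * v) * j2 - (1 - kapR x a * v) * j1 + D s w * i2 -
      (1 + 3 * w ^ 2) * i1
  rw [List.count_append] at h1 h2
  cases a
  · refine word_induction (Q := fun β => ∀ (v : ℝ) (L : List ℝ), L.length = β.length →
      GenL (1 / 5) (v :: L) → (1 + kapR x false * v) * psi x (n + 1) (β ++ [false]) (L ++ [-v]) =
      (1 - kapR x false * v) * psi x (n + 1) (β ++ [false]) (L ++ [v]))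
      (k := n + 1) (m := n) ?_ step β (by simpa using h1) (by simpa using h2)
    intro v L hL hg
    simp only [kapR, Bool.false_eq_true, if_false, zero_mul, sub_zero, add_zero, one_mul]
    exact psi_right_base_up v L (by simpa using hL)
  · refine word_induction (Q := fun β => ∀ (v : ℝ) (L : List ℝ), L.length = β.length →
      GenL (1 / 5) (v :: L) → (1 + kapR x true * v) * psi x (n + 1) (β ++ [true]) (L ++ [-v]) =
      (1 - kapR x true * v) * psi x (n + 1) (β ++ [true]) (L ++ [v]))
      (k := n) (m := n + 1) ?_ step β (by simpa using h1) (by simpa using h2)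
    intro v L hL hg
    simp only [kapR, if_true]
    exact psi_right_base_down hx v L hg (by simpa using hL)

lemma psi_right (hx : 0 < x) (n : ℕ) (a : Bool) (β : List Bool) (v : ℝ) (L : List ℝ)
    (hL : L.length = β.length) : (1 + kapR x a * v) * psi x n (β ++ [a]) (L ++ [-v]) =
      (1 - kapR x a * v) * psi x n (β ++ [a]) (L ++ [v]) := by
  by_cases h : (β ++ [a]).count true = n ∧ (β ++ [a]).count false = n
  · obtain ⟨n, rfl⟩ : ∃ k, n = k + 1 := by
      refine ⟨n - 1, ?_⟩
      cases a <;> simp at h <;> omega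
    have := list_ext (δ := 1 / 5) (by norm_num) (m := β.length + 1)
      (p := (1 + C (kapR x a) * X β.length) * negAt β.length (P x (n + 1) (β ++ [a])))
      (q := (1 - C (kapR x a) * X β.length) * P x (n + 1) (β ++ [a])) (fun M hM hlen => by
        obtain ⟨M, w, rfl, hw, hw'⟩ := exists_append_of_length (j := β.length) (k := 1) hlen
        obtain ⟨w, rfl⟩ := List.length_eq_one_iff.1 hw'
        have e := eval_negAt M [] w (P x (n + 1) (β ++ [a]))
        rw [hw] at e
        rw [map_mul, e]
        have := psi_right_of_genL hx a β h.1 h.2 w M hw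
          (hM.perm (List.perm_append_singleton w M))
        simpa [psi, ← hw] using this) (L ++ [v]) (by simpa using hL)
    have e := eval_negAt L [] v (P x (n + 1) (β ++ [a]))
    rw [hL] at e
    rw [map_mul, e] at this
    simpa [psi, ← hL] using this
  · rw [psi_eq_zero h, psi_eq_zero h, mul_zero, mul_zero]

end XXZOverlap

namespace XXZOverlap

open MvPolynomial

variable {x : ℝ} {n : ℕ}

/-- Restriction of a polynomial to the `i`-th coordinate axis. -/
def line (i : ℕ) (p : Poly) : Polynomial ℝ :=
  aeval (fun j => if j = i then Polynomial.X else 0) p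

/-- The homogeneous limit of the components. -/
def Z (x : ℝ) (n : ℕ) (α : List Bool) : ℝ := eval 0 (P x n α)

lemma toV_axis (i k : ℕ) (t : ℝ) : toV (List.replicate i 0 ++ t :: List.replicate k 0) =
    fun j => if j = i then t else 0 := by
  ext j
  simp only [toV, List.getD_eq_getElem?_getD]
  rcases lt_trichotomy j i with h | rfl | h
  · rw [List.getElem?_append_left (by simpa using h), if_neg h.ne]
    simp [h]
  · simp
  · rw [List.getElem?_append_right (by simpa using h.le), if_neg h.ne']
    obtain ⟨m, hm⟩ : ∃ m, j - i = m + 1 := ⟨j - i - 1, by omega⟩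
    simp only [List.length_replicate, hm, List.getElem?_cons_succ, List.getElem?_replicate]
    split_ifs <;> rfl

lemma eval_line (i : ℕ) (p : Poly) (t : ℝ) :
    (line i p).eval t = eval (fun j => if j = i then t else 0) p := by
  have h := MvPolynomial.map_aeval (fun j => if j = i then (Polynomial.X : Polynomial ℝ) else 0)
    (Polynomial.evalRingHom t) p
  rw [line, ← Polynomial.coe_evalRingHom, h]
  change eval₂ _ _ p = eval₂ _ _ p
  congr 1
  · ext r; simp
  · ext j; split_ifs <;> simp

lemma eval_line_P (i k : ℕ) (α : List Bool) (t : ℝ) :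
    (line i (P x n α)).eval t = psi x n α (List.replicate i 0 ++ t :: List.replicate k 0) := by
  rw [eval_line, psi, toV_axis]

lemma line_coeff_zero (i : ℕ) (α : List Bool) : (line i (P x n α)).coeff 0 = Z x n α := by
  rw [Polynomial.coeff_zero_eq_eval_zero, eval_line, Z]
  congr 2
  ext j; simp

lemma line_ne (l r : List Bool) (a : Bool) :
    (line (l.length + 1) (P x n (l ++ a :: (!a) :: r))).coeff 1 -
      (line l.length (P x n (l ++ a :: (!a) :: r))).coeff 1 =
      2 * Z x n (l ++ (!a) :: a :: r) - Z x n (l ++ a :: (!a) :: r) := by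
  have key : ∃ s : ℝ, (1 + Polynomial.C s * Polynomial.X ^ 2) *
      line l.length (P x n (l ++ a :: (!a) :: r)) +
      2 * Polynomial.X * line l.length (P x n (l ++ (!a) :: a :: r)) =
      (1 + Polynomial.X) * line (l.length + 1) (P x n (l ++ a :: (!a) :: r)) := by
    cases a
    · refine ⟨3, Polynomial.funext fun t => ?_⟩
      have := psi_ud (x := x) (n := n) (l := l) (r := r) (lv := List.replicate l.length 0)
        (rv := []) (by simp) t 0
      have e : List.replicate l.length (0 : ℝ) ++ 0 :: t :: [] =
        List.replicate (l.length + 1) 0 ++ t :: List.replicate 0 0 := by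
        simp [List.replicate_succ']
      rw [e] at this
      simp only [Polynomial.eval_add, Polynomial.eval_mul, Polynomial.eval_one, Polynomial.eval_C,
        Polynomial.eval_pow, Polynomial.eval_X, Polynomial.eval_ofNat,
        eval_line_P (k := 1) (i := l.length),
        eval_line_P (k := 0) (i := l.length + 1)]
      simp only [D, Bool.not_false, List.replicate_one] at *
      linear_combination this
    · refine ⟨0, Polynomial.funext fun t => ?_⟩
      have := psi_du (x := x) (n := n) (l := l) (r := r) (lv := List.replicate l.length 0)
        (rv := []) (by simp) t 0
      have e : List.replicate l.length (0 : ℝ) ++ 0 :: t :: [] =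
        List.replicate (l.length + 1) 0 ++ t :: List.replicate 0 0 := by
        simp [List.replicate_succ']
      rw [e] at this
      simp only [Polynomial.eval_add, Polynomial.eval_mul, Polynomial.eval_one, Polynomial.eval_C,
        Polynomial.eval_pow, Polynomial.eval_X, Polynomial.eval_ofNat,
        eval_line_P (k := 1) (i := l.length),
        eval_line_P (k := 0) (i := l.length + 1)]
      simp only [D, Bool.not_true, List.replicate_one] at *
      linear_combination this
  obtain ⟨s, key⟩ := key
  have := congrArg (fun p => p.coeff 1) key
  simp only [add_mul, one_mul, Polynomial.coeff_add, mul_assoc, Polynomial.coeff_C_mul,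
    Polynomial.coeff_X_pow_mul', Polynomial.coeff_ofNat_mul, Polynomial.coeff_X_mul,
    line_coeff_zero] at this
  norm_num [line_coeff_zero] at this
  linear_combination -this

lemma line_eq (l r : List Bool) (a : Bool) :
    (line (l.length + 1) (P x n (l ++ a :: a :: r))).coeff 1 -
      (line l.length (P x n (l ++ a :: a :: r))).coeff 1 = -2 * Z x n (l ++ a :: a :: r) := by
  have key : (1 - Polynomial.X) * line l.length (P x n (l ++ a :: a :: r)) =
      (1 + Polynomial.X) * line (l.length + 1) (P x n (l ++ a :: a :: r)) := by
    refine Polynomial.funext fun t => ?_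
    have := psi_eq (x := x) (n := n) (l := l) (r := r) (lv := List.replicate l.length 0)
      (rv := []) (by simp) a t 0
    have e : List.replicate l.length (0 : ℝ) ++ 0 :: t :: [] =
      List.replicate (l.length + 1) 0 ++ t :: List.replicate 0 0 := by
      simp [List.replicate_succ']
    rw [e] at this
    simp only [Polynomial.eval_add, Polynomial.eval_sub, Polynomial.eval_mul, Polynomial.eval_one,
      Polynomial.eval_X, eval_line_P (k := 1) (i := l.length),
      eval_line_P (k := 0) (i := l.length + 1)]
    simp only [D, List.replicate_one] at *
    linear_combination this
  have := congrArg (fun p => p.coeff 1) key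
  simp only [add_mul, sub_mul, one_mul, Polynomial.coeff_add, Polynomial.coeff_sub] at this
  norm_num [line_coeff_zero] at this
  linear_combination -this

lemma line_first (a : Bool) (β : List Bool) :
    (line 0 (P x n (a :: β))).coeff 1 = -kapL x a * Z x n (a :: β) := by
  have key : (1 - Polynomial.C (kapL x a) * Polynomial.X) *
      (line 0 (P x n (a :: β))).comp (Polynomial.C (-1) * Polynomial.X) =
      (1 + Polynomial.C (kapL x a) * Polynomial.X) * line 0 (P x n (a :: β)) := by
    refine Polynomial.funext fun t => ?_
    have := psi_left x n a β t (List.replicate β.length 0) (by simp)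
    simp only [Polynomial.eval_add, Polynomial.eval_sub, Polynomial.eval_mul, Polynomial.eval_one,
      Polynomial.eval_X, Polynomial.eval_C, Polynomial.eval_comp,
      eval_line_P (k := β.length)]
    simpa using this
  have := congrArg (fun p => p.coeff 1) key
  simp only [add_mul, sub_mul, one_mul, Polynomial.coeff_add, Polynomial.coeff_sub, mul_assoc,
    Polynomial.coeff_C_mul, Polynomial.comp_C_mul_X_coeff] at this
  rw [show (1 : ℕ) = 0 + 1 from rfl, Polynomial.coeff_X_mul, Polynomial.coeff_X_mul,
    Polynomial.comp_C_mul_X_coeff, line_coeff_zero] at this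
  linear_combination -this / 2

lemma line_last (hx : 0 < x) (a : Bool) (β : List Bool) :
    (line β.length (P x n (β ++ [a]))).coeff 1 = kapR x a * Z x n (β ++ [a]) := by
  have key : (1 + Polynomial.C (kapR x a) * Polynomial.X) *
      (line β.length (P x n (β ++ [a]))).comp (Polynomial.C (-1) * Polynomial.X) =
      (1 - Polynomial.C (kapR x a) * Polynomial.X) * line β.length (P x n (β ++ [a])) := by
    refine Polynomial.funext fun t => ?_
    have := psi_right hx n a β t (List.replicate β.length 0) (by simp)
    simp only [Polynomial.eval_add, Polynomial.eval_sub, Polynomial.eval_mul, Polynomial.eval_one,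
      Polynomial.eval_X, Polynomial.eval_C, Polynomial.eval_comp,
      eval_line_P (k := 0)]
    simpa using this
  have := congrArg (fun p => p.coeff 1) key
  simp only [add_mul, sub_mul, one_mul, Polynomial.coeff_add, Polynomial.coeff_sub, mul_assoc,
    Polynomial.coeff_C_mul, Polynomial.comp_C_mul_X_coeff] at this
  rw [show (1 : ℕ) = 0 + 1 from rfl, Polynomial.coeff_X_mul, Polynomial.coeff_X_mul,
    Polynomial.comp_C_mul_X_coeff, line_coeff_zero] at this
  linear_combination -this / 2

end XXZOverlap

namespace XXZOverlap

/-- The word of a spin configuration. -/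
def word {N : ℕ} (α : Conf N) : List Bool := List.ofFn fun i => decide (α i = 1)

lemma siteOp_mulVec {N : ℕ} (i : Fin N) (A : Matrix (Fin 2) (Fin 2) ℂ) (ψ : Conf N → ℂ)
    (α : Conf N) : (siteOp N i A).mulVec ψ α = ∑ b, A (α i) b * ψ (Function.update α i b) := by
  have hs : ∀ β : Conf N, siteOp N i A α β * ψ β =
      ∑ b, if β = Function.update α i b then A (α i) b * ψ (Function.update α i b) else 0 := by
    intro β
    rw [siteOp, Matrix.of_apply, Finset.prod_ite_zero, Finset.prod_const_one]
    by_cases h : ∀ j ∈ Finset.univ.erase i, α j = β j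
    · have hβ : ∀ b, (β = Function.update α i b ↔ β i = b) := by
        intro b
        constructor
        · intro e; rw [e]; simp
        · rintro rfl
          ext j
          rcases eq_or_ne j i with rfl | hj
          · simp
          · rw [Function.update_of_ne hj, h j (by simp [hj])]
      rw [if_pos h, mul_one]
      simp only [hβ]
      rw [Finset.sum_ite_eq, if_pos (Finset.mem_univ _), ← (hβ (β i)).2 rfl]
    · rw [if_neg h, mul_zero, zero_mul, eq_comm]
      apply Finset.sum_eq_zero
      intro b _
      rw [if_neg]
      rintro rfl
      exact h fun j hj => by rw [Function.update_of_ne (Finset.ne_of_mem_erase hj)]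
  simp only [Matrix.mulVec, dotProduct, hs]
  rw [Finset.sum_comm]
  simp

lemma exists_word_update {N : ℕ} (α : Conf N) (i : ℕ) (hi : i + 1 < N) :
    ∃ l r, l.length = i ∧ ∀ a b, word (Function.update (Function.update α ⟨i, by omega⟩ a)
      ⟨i + 1, hi⟩ b) = l ++ decide (a = 1) :: decide (b = 1) :: r := by
  refine ⟨(word α).take i, (word α).drop (i + 2), by simp [word]; omega, fun a b => ?_⟩
  apply List.ext_getElem
  · simp [word]; omega
  · intro j h1 h2
    have hj : j < N := by simpa [word] using h1
    simp only [word, List.getElem_ofFn]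
    rcases lt_trichotomy j i with h | rfl | h
    · rw [List.getElem_append_left (by simp; omega), Function.update_of_ne (by simp; omega),
        Function.update_of_ne (by simp; omega)]
      simp
    · rw [List.getElem_append_right (by simp), Function.update_of_ne (by simp),
        Function.update_self]
      simp [hj.le]
    · rcases Nat.lt_or_ge (i + 1) j with h' | h'
      · rw [List.getElem_append_right (by simp; omega), Function.update_of_ne (by simp; omega),
          Function.update_of_ne (by simp; omega)]
        obtain ⟨k, rfl⟩ : ∃ k, j = i + 2 + k := ⟨j - i - 2, by omega⟩
        have : i + 2 + k - ((List.ofFn fun i => decide (α i = 1)).take i).length = k + 2 := by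
          simp; omega
        simp only [this, List.getElem_cons_succ, List.getElem_drop, List.getElem_ofFn]
      · obtain rfl : j = i + 1 := by omega
        rw [List.getElem_append_right (by simp), Function.update_self]
        have : i + 1 - ((List.ofFn fun i => decide (α i = 1)).take i).length = 1 := by
          simp; omega
        simp only [this, List.getElem_cons_succ, List.getElem_cons_zero]

/-- The homogeneous component as a vector on configurations. -/
def Zv (x : ℝ) (n : ℕ) {N : ℕ} (α : Conf N) : ℂ := (Z x n (word α) : ℂ)

lemma bond_mulVec {N : ℕ} (x : ℝ) (n i : ℕ) (hi : i + 1 < N) (α : Conf N) :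
    (siteOp N ⟨i, by omega⟩ pauliX * siteOp N ⟨i + 1, hi⟩ pauliX +
      siteOp N ⟨i, by omega⟩ pauliY * siteOp N ⟨i + 1, hi⟩ pauliY -
      (1 / 2 : ℂ) • (siteOp N ⟨i, by omega⟩ pauliZ * siteOp N ⟨i + 1, hi⟩ pauliZ)).mulVec
        (Zv x n) α =
      (((line (i + 1) (P x n (word α))).coeff 1 - (line i (P x n (word α))).coeff 1 : ℝ) : ℂ) +
        3 / 2 * Zv x n α := by
  obtain ⟨l, r, hl, h⟩ := exists_word_update α i hi
  have hne : (⟨i + 1, hi⟩ : Fin N) ≠ ⟨i, by omega⟩ := by simp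
  have hw : word α = l ++ decide (α ⟨i, by omega⟩ = 1) :: decide (α ⟨i + 1, hi⟩ = 1) :: r := by
    rw [← h, Function.update_eq_self, Function.update_eq_self_iff.2]
    rfl
  have h2 : ∀ p : Fin 2, p = 0 ∨ p = 1 := by decide
  simp only [Matrix.sub_mulVec, Matrix.add_mulVec, Matrix.smul_mulVec, ← Matrix.mulVec_mulVec,
    Pi.add_apply, Pi.sub_apply, Pi.smul_apply, siteOp_mulVec, Function.update_of_ne hne, Zv, h, hw,
    Fin.sum_univ_two]
  have e0 := line_eq (x := x) (n := n) l r
  have e1 := line_ne (x := x) (n := n) l r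
  rw [hl] at e0 e1
  rcases h2 (α ⟨i, by omega⟩) with ha | ha <;> rcases h2 (α ⟨i + 1, hi⟩) with hb | hb <;>
    simp only [ha, hb, pauliX, pauliY, pauliZ]
  · have := e0 false
    simp [-Complex.ofReal_sub, this]
    linear_combination (Z x n (l ++ true :: true :: r) : ℂ) * Complex.I_sq
  · have := e1 false
    simp [-Complex.ofReal_sub] at this ⊢
    simp [-Complex.ofReal_sub, this]
    simp
    linear_combination (-Z x n (l ++ true :: false :: r) : ℂ) * Complex.I_sq
  · have := e1 true
    simp [-Complex.ofReal_sub] at this ⊢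
    simp [-Complex.ofReal_sub, this]
    simp
    linear_combination (-Z x n (l ++ false :: true :: r) : ℂ) * Complex.I_sq
  · have := e0 true
    simp [-Complex.ofReal_sub, this]
    linear_combination (Z x n (l ++ false :: false :: r) : ℂ) * Complex.I_sq

end XXZOverlap

namespace XXZOverlap

lemma siteOp_pauliZ {N : ℕ} (i : Fin N) (ψ : Conf N → ℂ) (α : Conf N) :
    (siteOp N i pauliZ).mulVec ψ α = (if α i = 1 then -1 else 1) * ψ α := by
  rw [siteOp_mulVec, Fin.sum_univ_two]
  have h2 : ∀ p : Fin 2, p = 0 ∨ p = 1 := by decide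
  rcases h2 (α i) with h | h
  · have := Function.update_eq_self i α
    rw [h] at this
    simp [h, pauliZ, this]
  · have := Function.update_eq_self i α
    rw [h] at this
    simp [h, pauliZ, this]

lemma XXZ_mulVec_Zv {N : ℕ} (hN : 0 < N) {x : ℝ} (hx : 0 < x) (n : ℕ) :
    (XXZ N hN x).mulVec (Zv x n) = ((E0 N x : ℝ) : ℂ) • (Zv x n : Conf N → ℂ) := by
  ext α
  obtain ⟨M, rfl⟩ : ∃ M, N = M + 1 := ⟨N - 1, by omega⟩
  rw [XXZ, Matrix.add_mulVec, Matrix.add_mulVec, Matrix.smul_mulVec, Matrix.smul_mulVec,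
    Matrix.smul_mulVec, Matrix.sum_mulVec, Pi.add_apply, Pi.add_apply, Pi.smul_apply,
    Pi.smul_apply, Pi.smul_apply, Pi.smul_apply, Finset.sum_apply, siteOp_pauliZ, siteOp_pauliZ]
  have hs : ∑ i : Fin M, ((((line (i.1 + 1) (P x n (word α))).coeff 1 -
      (line i.1 (P x n (word α))).coeff 1 : ℝ) : ℂ) + 3 / 2 * Zv x n α) =
      (((line M (P x n (word α))).coeff 1 - (line 0 (P x n (word α))).coeff 1 : ℝ) : ℂ) +
        M * (3 / 2 * Zv x n α) := by
    rw [Finset.sum_add_distrib, Fin.sum_univ_eq_sum_range (fun i =>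
      (((line (i + 1) (P x n (word α))).coeff 1 - (line i (P x n (word α))).coeff 1 : ℝ) : ℂ)) M]
    rw [← Complex.ofReal_sum,
      Finset.sum_range_sub (fun i => (line i (P x n (word α))).coeff 1)]
    simp
  have hb : ∀ i : Fin (M + 1 - 1), _ := fun i =>
    bond_mulVec x n i.1 (by have := i.2; omega) α
  rw [Finset.sum_congr rfl fun i _ => hb i]
  simp only [Nat.add_sub_cancel]
  have h1 : (line 0 (P x n (word α))).coeff 1 =
      -kapL x (decide (α 0 = 1)) * Z x n (word α) := by
    rw [word, List.ofFn_succ, line_first]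
  have h2 : (line M (P x n (word α))).coeff 1 =
      kapR x (decide (α (Fin.last M) = 1)) * Z x n (word α) := by
    have := line_last hx (n := n) (decide (α (Fin.last M) = 1))
      (List.ofFn fun i : Fin M => decide (α i.castSucc = 1))
    rw [List.length_ofFn] at this
    rw [word, List.ofFn_succ', List.concat_eq_append, this]
  have hl : (⟨M, by omega⟩ : Fin (M + 1)) = Fin.last M := rfl
  have h0 : (⟨0, hN⟩ : Fin (M + 1)) = 0 := rfl
  have hx' : (x : ℂ) ≠ 0 := by exact_mod_cast hx.ne'
  erw [hs]
  rw [hl, h0, h1, h2]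
  simp only [smul_eq_mul, Zv, pL, pR, E0, kapL, kapR]
  by_cases ha : α 0 = 1 <;> by_cases hb : α (Fin.last M) = 1 <;>
    simp [ha, hb] <;> field_simp <;> ring

lemma Z_base (x : ℝ) (n : ℕ) :
    Z x n (List.replicate n true ++ List.replicate n false) = 1 := by
  have hs : ∀ o k, seg (0 : ℕ → ℝ) o k = List.replicate k 0 := by
    intro o k
    induction k generalizing o with
    | zero => rfl
    | succ k ih => simp [seg, ih, List.replicate_succ]
  have hl : ∀ k c, PL c (List.replicate k (0 : ℝ)) = 1 := by
    intro k c
    induction k with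
    | zero => rfl
    | succ k ih => simp [PL, ih, List.replicate_succ, mL, D]
  have hr : ∀ k, PR (List.replicate k (0 : ℝ)) = 1 := by
    intro k
    induction k with
    | zero => rfl
    | succ k ih => simp [PR, ih, List.replicate_succ, mR, D]
  rw [Z, P_base, eval_base, hs, hs, hl, hr, mul_one]

lemma word_baseState (n : ℕ) :
    word (baseState (n + n)) = List.replicate n true ++ List.replicate n false := by
  apply List.ext_getElem
  · simp [word]
  · intro i h1 h2
    have h : (n + n) / 2 = n := by omega
    simp only [word, baseState, List.getElem_ofFn, List.getElem_append, h]
    by_cases hi : i < n <;> simp [hi]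

lemma IsGroundState.eq_Zv {x : ℝ} (hx : 0 < x) (n : ℕ) {ψ : Conf (n + n) → ℂ}
    (h : IsGroundState (n + n) x ψ) : ψ = Zv x n := by
  have hb : (Zv x n : Conf (n + n) → ℂ) (baseState (n + n)) = 1 := by
    rw [Zv, word_baseState, Z_base, Complex.ofReal_one]
  rw [IsGroundState] at h
  split_ifs at h with hN
  · obtain ⟨c, hc⟩ := h.2.1 _ (XXZ_mulVec_Zv hN hx n)
    rw [hc, Pi.smul_apply, h.2.2, smul_eq_mul, mul_one] at hb
    rw [hc, hb, one_smul]
  · obtain rfl : n = 0 := by omega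
    ext α
    rw [h α, ← hb, show α = baseState (0 + 0) from funext fun i => absurd i.2 (by simp)]

end XXZOverlap

namespace XXZOverlap

open MvPolynomial

variable {x : ℝ} {n : ℕ}

lemma psi_pair_eq {l r : List Bool} {lv rv : List ℝ} (h : l.length = lv.length) (a : Bool)
    {p w : ℝ} (hw : w * (1 - 3 * p) = 1 + p) :
    psi x n (l ++ a :: a :: r) (lv ++ p :: w :: rv) = 0 := by
  have h1 := psi_eq (x := x) (n := n) (r := r) (rv := rv) h a p w
  have h2 : D p w = 0 := by rw [D]; linear_combination -hw
  have h3 : D w p * (1 - 3 * p) = 2 + 6 * p ^ 2 := by rw [D]; linear_combination (3 * p + 1) * hw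
  rw [h2, zero_mul] at h1
  refine (mul_eq_zero.1 h1).resolve_left fun h4 => ?_
  rw [h4] at h3
  nlinarith [sq_nonneg p]

lemma psi_pair_ud {l r : List Bool} {lv rv : List ℝ} (h : l.length = lv.length)
    {p w : ℝ} (hp : 1 - 3 * p ≠ 0) (hw : w * (1 - 3 * p) = 1 + p) :
    psi x n (l ++ false :: true :: r) (lv ++ p :: w :: rv) =
      2 / (1 - 3 * p) * psi x n (l ++ true :: false :: r) (lv ++ p :: w :: rv) := by
  have h1 := psi_du (x := x) (n := n) (r := r) (rv := rv) h p w
  have h2 : D p w = 0 := by rw [D]; linear_combination -hw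
  rw [h2, zero_mul] at h1
  have h3 : (w - p) * (1 - 3 * p) = 1 + 3 * p ^ 2 := by linear_combination hw
  have h4 : (1 + 3 * w ^ 2) * (1 - 3 * p) = 4 * (w - p) := by
    apply mul_right_cancel₀ hp
    linear_combination (3 * (w * (1 - 3 * p) + 1 + p)- 4) * hw
  have h5 : w - p ≠ 0 := by
    intro h5; rw [h5] at h3; nlinarith [sq_nonneg p]
  generalize psi x n (l ++ false :: true :: r) (lv ++ p :: w :: rv) = A at h1 ⊢
  generalize psi x n (l ++ true :: false :: r) (lv ++ p :: w :: rv) = B at h1 ⊢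
  rw [div_mul_eq_mul_div, eq_div_iff hp]
  apply mul_left_cancel₀ h5
  linear_combination (-1 / 2 * (1 - 3 * p)) * h1 + B / 2 * h4

lemma psi_hop {l r : List Bool} {lv rv : List ℝ} (h : l.length = lv.length) (a : Bool)
    {s p w : ℝ} (hp : 1 - 3 * p ≠ 0) (hw : w * (1 - 3 * p) = 1 + p) (h1 : D p s ≠ 0)
    (h2 : D s p ≠ 0) :
    psi x n (l ++ a :: true :: false :: r) (lv ++ s :: p :: w :: rv) =
      psi x n (l ++ true :: false :: a :: r) (lv ++ p :: w :: s :: rv) := by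
  have hws : D w s * (1 - 3 * p) = 2 * D s p := by
    simp only [D]; linear_combination (3 * s + 1) * hw
  have hsw : D s w * (1 - 3 * p) = 4 * (s - p) := by
    simp only [D]; linear_combination (3 * s - 1) * hw
  have hw0 : D w s ≠ 0 := by
    intro h0; rw [h0, zero_mul] at hws; exact h2 (by linarith)
  have hl (b : Bool) (t : ℝ) : (l ++ [b]).length = (lv ++ [t]).length := by simp [h]
  have hud := psi_pair_ud (x := x) (n := n) (r := a :: r) (rv := s :: rv) h hp hw
  set κ := 2 / (1 - 3 * p) with hκ
  have hk : κ * (1 - 3 * p) = 2 := div_mul_cancel₀ _ hp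
  apply mul_left_cancel₀ (mul_ne_zero h1 hw0)
  have h3 : D w s = κ * D s p := by
    apply mul_right_cancel₀ hp; linear_combination hws - D s p * hk
  cases a with
  | false =>
    have e0 := psi_pair_eq (x := x) (n := n) (r := true :: r) (rv := s :: rv) h false hw
    have e1 := psi_du (x := x) (n := n) (r := r) (rv := rv) (hl false p) w s
    have e2 := psi_eq (x := x) (n := n) (r := r) (rv := rv) (hl true p) false s w
    have e3 := psi_ud (x := x) (n := n) (r := false :: r) (rv := w :: rv) h p s
    simp only [List.append_assoc, List.cons_append, List.nil_append] at e1 e2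
    have h4 : D s w = 2 * κ * (s - p) := by
      apply mul_right_cancel₀ hp; linear_combination hsw - 2 * (s - p) * hk
    have hD : D p s * D s p = (1 + 3 * p ^ 2) * (1 + 3 * s ^ 2) - 4 * (p - s) ^ 2 := by
      simp only [D]; ring
    rw [e0, hud] at e1
    linear_combination -D w s * e3 - (1 + 3 * p ^ 2) * e1 + 2 * (p - s) * e2 +
      psi x n (l ++ true :: false :: false :: r) (lv ++ p :: w :: s :: rv) *
        (2 * (p - s) * h4 - D p s * h3 - κ * hD)
  | true =>
    have e0 := psi_pair_eq (x := x) (n := n) (r := false :: r) (rv := s :: rv) h true hw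
    have e1 := psi_du (x := x) (n := n) (r := r) (rv := rv) (hl true p) w s
    have e2 := psi_eq (x := x) (n := n) (r := false :: r) (rv := w :: rv) h true s p
    simp only [List.append_assoc, List.cons_append, List.nil_append] at e1
    have h5 : 2 * (w - s) = κ * D p s := by
      apply mul_right_cancel₀ hp; rw [D]; linear_combination 2 * hw - (1 + 3 * p * s + p - s) * hk
    rw [e0] at e1
    linear_combination D w s * e2 - D s p * e1 +
      psi x n (l ++ true :: false :: true :: r) (lv ++ p :: w :: s :: rv) *
        (D s p * h5 - D p s * h3)

/-- The factor relating a pair of parameters to its removal. -/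
def mP (p k : ℝ) : ℝ := (1 - p) ^ 2 - k ^ 2 * (1 + 3 * p) ^ 2

/-- The total factor of the pair recursion. -/
def kap (x p : ℝ) (n : ℕ) (L : List ℝ) : ℝ :=
  (1 - (2 * x - 1) * p) * (2 / (1 - 3 * p)) ^ (2 * n) * (L.map (mP p)).prod

lemma kap_perm (x p : ℝ) (n : ℕ) {L L' : List ℝ} (h : L.Perm L') :
    kap x p n L = kap x p n L' := by
  rw [kap, kap, (h.map _).prod_eq]

lemma psi_move {l r : List Bool} {lv rv : List ℝ} (h : l.length = lv.length)
    {p w : ℝ} (hp : 1 - 3 * p ≠ 0) (hw : w * (1 - 3 * p) = 1 + p)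
    (h1 : ∀ s ∈ lv, D p s ≠ 0 ∧ D s p ≠ 0) :
    psi x n (l ++ true :: false :: r) (lv ++ p :: w :: rv) =
      psi x n (true :: false :: (l ++ r)) (p :: w :: (lv ++ rv)) := by
  induction l using List.reverseRecOn generalizing lv r rv with
  | nil =>
    obtain rfl : lv = [] := List.length_eq_zero_iff.1 h.symm
    rfl
  | append_singleton l a ih =>
    obtain ⟨lv, s, rfl⟩ : ∃ lv' s, lv = lv' ++ [s] := by
      rcases List.eq_nil_or_concat lv with rfl | ⟨lv', s, rfl⟩
      · simp at h
      · exact ⟨lv', s, by simp⟩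
    have h' : l.length = lv.length := by simpa using h
    simp only [List.append_assoc, List.cons_append, List.nil_append]
    rw [psi_hop h' a hp hw (h1 s (by simp)).1 (h1 s (by simp)).2,
      ih h' fun k hk => h1 k (by simp [hk])]

lemma PL_concat (c p : ℝ) (l : List ℝ) :
    PL c (l ++ [p]) = PL c l * (1 - c * p) * (l.map (mP p)).prod := by
  induction l with
  | nil => simp [PL]
  | cons a l ih =>
    simp only [List.cons_append, PL, ih, List.map_append, List.map_cons, List.prod_append,
      List.prod_cons, List.map_nil, List.prod_nil, mL, mP, D]
    ring

lemma psi_pair_front {γ : List Bool} {L : List ℝ} (hL : γ.length = L.length)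
    {p w : ℝ} (hp : 1 - 3 * p ≠ 0) (hw : w * (1 - 3 * p) = 1 + p)
    (h1 : ∀ s ∈ L, D p s ≠ 0 ∧ D s p ≠ 0) (hn : L.Nodup) :
    psi x (n + 1) (true :: false :: γ) (p :: w :: L) = kap x p n L * psi x n γ L := by
  by_cases hc : γ.count true = n ∧ γ.count false = n
  · have hw' : (1 + p) / (1 - 3 * p) = w := ((eq_div_iff hp).2 hw).symm
    revert L
    refine word_induction (Q := fun γ => ∀ {L : List ℝ}, γ.length = L.length →
      (∀ s ∈ L, D p s ≠ 0 ∧ D s p ≠ 0) → L.Nodup →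
      psi x (n + 1) (true :: false :: γ) (p :: w :: L) = kap x p n L * psi x n γ L)
      ?_ ?_ γ hc.1 hc.2
    · intro L hL h1 hn
      obtain ⟨lv, rv, rfl, hl, hr⟩ := exists_append_of_length (L := L) (j := n) (k := n)
        (by simpa using hL.symm)
      rw [← psi_move (by simp [hl]) hp hw fun s hs => h1 s (by simp [hs])]
      have e1 := P_base x n
      have e2 := P_base x (n + 1)
      rw [List.replicate_succ', List.replicate_succ] at e2
      simp only [List.append_assoc, List.cons_append, List.nil_append] at e2
      rw [psi, psi, e1, e2]
      have e3 := eval_base_list (x := x) (n := n + 1) (l := lv ++ [p]) (r := w :: rv)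
        (by simp [hl]) (by simp [hr])
      simp only [List.append_assoc, List.cons_append, List.nil_append] at e3
      have hR : (rv.map (mR w)).prod = (2 / (1 - 3 * p)) ^ (2 * n) * (rv.map (mP p)).prod := by
        rw [← hr, pow_mul]
        have : mR w = fun k => (2 / (1 - 3 * p)) ^ 2 * mP p k := by
          ext k
          rw [← hw', mR, mP, D, D]
          field_simp
          ring
        rw [this, List.prod_map_mul, List.map_const', List.prod_replicate]
      rw [eval_base_list hl hr, e3, PL_concat, PR, hR, kap, List.map_append, List.prod_append]
      ring
    · intro l r ih L hL h1 hn
      obtain ⟨lv, v, v', rv, rfl, hl, hr⟩ := exists_pair_of_length hL.symm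
      have hv : v - v' ≠ 0 := by
        rw [sub_ne_zero]; rintro rfl; simp [List.nodup_append] at hn
      have hp : (lv ++ v' :: v :: rv).Perm (lv ++ v :: v' :: rv) :=
        (List.Perm.swap _ _ _).append_left _
      have i1 := ih (L := lv ++ v :: v' :: rv) (by simp [hl, hr]) h1 hn
      have i2 := ih (L := lv ++ v' :: v :: rv) (by simp [hl, hr])
        (fun s hs => h1 s (hp.subset hs)) (hp.nodup_iff.2 hn)
      rw [kap_perm x p n hp] at i2
      have j1 := psi_du (x := x) (n := n) (r := r) (rv := rv) hl v v'
      have j2 := psi_du (x := x) (n := n + 1) (l := true :: false :: l) (lv := p :: w :: lv)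
        (r := r) (rv := rv) (by simp [hl]) v v'
      simp only [List.cons_append] at j2
      rw [i1, i2] at j2
      apply mul_left_cancel₀ (mul_ne_zero two_ne_zero hv)
      linear_combination j2 - kap x p n (lv ++ v :: v' :: rv) * j1
  · rw [psi_eq_zero hc, psi_eq_zero, mul_zero]
    simpa using hc

lemma psi_pair {l r : List Bool} {lv rv : List ℝ} (h : l.length = lv.length)
    (h' : r.length = rv.length) {p w : ℝ} (hp : 1 - 3 * p ≠ 0) (hw : w * (1 - 3 * p) = 1 + p)
    (h1 : ∀ s ∈ lv ++ rv, D p s ≠ 0 ∧ D s p ≠ 0) (hn : (lv ++ rv).Nodup) :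
    psi x (n + 1) (l ++ true :: false :: r) (lv ++ p :: w :: rv) =
      kap x p n (lv ++ rv) * psi x n (l ++ r) (lv ++ rv) := by
  rw [psi_move h hp hw fun s hs => h1 s (by simp [hs]),
    psi_pair_front (by simp [h, h']) hp hw h1 hn]

end XXZOverlap

namespace XXZOverlap

open MvPolynomial

variable {x : ℝ} {n : ℕ}

/-- Restriction of a polynomial to the line through `v` in the direction of coordinate `j`. -/
def lineAt (j : ℕ) (v : ℕ → ℝ) (p : Poly) : Polynomial ℝ :=
  aeval (fun i => if i = j then Polynomial.X else Polynomial.C (v i)) p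

lemma eval_lineAt (j : ℕ) (v : ℕ → ℝ) (p : Poly) (t : ℝ) :
    (lineAt j v p).eval t = eval (Function.update v j t) p := by
  have h := MvPolynomial.map_aeval
    (fun i => if i = j then (Polynomial.X : Polynomial ℝ) else Polynomial.C (v i))
    (Polynomial.evalRingHom t) p
  rw [lineAt, ← Polynomial.coe_evalRingHom, h]
  change eval₂ _ _ p = eval₂ _ _ p
  congr 1
  · ext r; simp
  · ext i; rcases eq_or_ne i j with rfl | hi <;> simp [*]

lemma update_toV (lv rv : List ℝ) (a t : ℝ) :
    Function.update (toV (lv ++ a :: rv)) lv.length t = toV (lv ++ t :: rv) := by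
  ext j
  rcases lt_trichotomy j lv.length with h | rfl | h
  · rw [Function.update_of_ne h.ne]
    simp [toV, List.getD_eq_getElem?_getD, List.getElem?_append_left h]
  · simp
  · rw [Function.update_of_ne h.ne']
    obtain ⟨m, hm⟩ : ∃ m, j - lv.length = m + 1 := ⟨j - lv.length - 1, by omega⟩
    simp [toV, List.getD_eq_getElem?_getD, List.getElem?_append_right h.le, hm]

/-- The values of `v` at indices below `k` other than `j` are distinct. -/
def InjOff (j k : ℕ) (v : ℕ → ℝ) : Prop :=
  ∀ a b, a < k → b < k → a ≠ b → a ≠ j → b ≠ j → v a ≠ v b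

lemma InjOff.sw {i j k : ℕ} {v : ℕ → ℝ} (hi : i + 1 < k) (h : InjOff j k v) :
    InjOff (Equiv.swap i (i + 1) j) k (sw i v) := by
  have hs : ∀ m, m < k → Equiv.swap i (i + 1) m < k := by
    intro m hm; rw [Equiv.swap_apply_def]; split_ifs <;> omega
  intro a b ha hb hab haj hbj
  refine h _ _ (hs a ha) (hs b hb) (fun e => hab (Equiv.injective _ e)) ?_ ?_ <;>
    · rintro rfl; simp at *

lemma natDegree_le_of_linear_mul {c d : ℝ} (hc : c ≠ 0) {q r : Polynomial ℝ} {k : ℕ}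
    (h : (Polynomial.C c * Polynomial.X + Polynomial.C d) * q = r) (hr : r.natDegree ≤ k + 1) :
    q.natDegree ≤ k := by
  rcases eq_or_ne q 0 with rfl | hq
  · simp
  · rw [← h, Polynomial.natDegree_mul _ hq, Polynomial.natDegree_linear hc] at hr
    · omega
    · intro h0
      have := Polynomial.natDegree_linear (b := d) hc
      rw [h0] at this
      simp at this

lemma natDegree_PL_le (c : ℝ) (l : List (Polynomial ℝ)) :
    (PL (Polynomial.C c) l).natDegree + (l.map Polynomial.natDegree).sum ≤
      2 * l.length * (l.map Polynomial.natDegree).sum := by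
  induction l with
  | nil => simp [PL]
  | cons a l ih =>
    have h1 : (1 - Polynomial.C c * a).natDegree ≤ a.natDegree := by compute_degree
    have h2 : ∀ l : List (Polynomial ℝ), (l.map (mL a)).prod.natDegree ≤
        2 * l.length * a.natDegree + 2 * (l.map Polynomial.natDegree).sum := by
      intro l
      induction l with
      | nil => simp
      | cons b l ih =>
        have h3 : (mL a b).natDegree ≤ 2 * a.natDegree + 2 * b.natDegree := by
          rw [mL, D, D]; compute_degree; omega
        simp only [List.map_cons, List.prod_cons, List.length_cons, List.sum_cons]
        refine Polynomial.natDegree_mul_le.trans ?_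
        linarith
    have h4 := h2 l
    have h5 : (PL (Polynomial.C c) (a :: l)).natDegree ≤ _ :=
      Polynomial.natDegree_mul_le.trans (add_le_add_left Polynomial.natDegree_mul_le _)
    simp only [List.map_cons, List.length_cons, List.sum_cons]
    nlinarith

lemma natDegree_PR_le (l : List (Polynomial ℝ)) :
    (PR l).natDegree + 2 * (l.map Polynomial.natDegree).sum ≤
      2 * l.length * (l.map Polynomial.natDegree).sum := by
  induction l with
  | nil => simp [PR]
  | cons a l ih =>
    have h2 : ∀ l : List (Polynomial ℝ), (l.map (mR a)).prod.natDegree ≤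
        2 * l.length * a.natDegree + 2 * (l.map Polynomial.natDegree).sum := by
      intro l
      induction l with
      | nil => simp
      | cons b l ih =>
        have h3 : (mR a b).natDegree ≤ 2 * a.natDegree + 2 * b.natDegree := by
          rw [mR, D, D]; compute_degree; omega
        simp only [List.map_cons, List.prod_cons, List.length_cons, List.sum_cons]
        refine Polynomial.natDegree_mul_le.trans ?_
        linarith
    have h4 := h2 l
    have h5 : (PR (a :: l)).natDegree ≤ _ := Polynomial.natDegree_mul_le
    simp only [List.map_cons, List.length_cons, List.sum_cons]
    nlinarith

lemma sum_seg_natDegree (j : ℕ) (v : ℕ → ℝ) (o k : ℕ) :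
    ((seg (fun i => if i = j then (Polynomial.X : Polynomial ℝ) else Polynomial.C (v i)) o k).map
      Polynomial.natDegree).sum = if o ≤ j ∧ j < o + k then 1 else 0 := by
  induction k generalizing o with
  | zero => simp [seg]
  | succ k ih =>
    rw [seg, List.map_cons, List.sum_cons, ih]
    by_cases h : o = j
    · subst h; simp
    · rw [if_neg h, Polynomial.natDegree_C, zero_add]
      congr 1
      simp; omega

lemma natDegree_lineAt_base (x : ℝ) (j : ℕ) (v : ℕ → ℝ) :
    (j < n → (lineAt j v (base x n)).natDegree + 1 ≤ 2 * n) ∧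
    (n ≤ j ∧ j < n + n → (lineAt j v (base x n)).natDegree + 2 ≤ 2 * n) := by
  have e : lineAt j v (base x n) =
      PL (Polynomial.C (2 * x - 1))
        (seg (fun i => if i = j then Polynomial.X else Polynomial.C (v i)) 0 n) *
      PR (seg (fun i => if i = j then Polynomial.X else Polynomial.C (v i)) n n) := by
    have hf : ∀ o k, (seg X o k).map
        (aeval (fun i => if i = j then Polynomial.X else Polynomial.C (v i)) :
          Poly →ₐ[ℝ] Polynomial ℝ).toRingHom = seg (fun i => if i = j then Polynomial.X else
            Polynomial.C (v i)) o k := by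
      intro o k
      rw [map_seg]
      congr 1
      ext1 i
      simp
    change (aeval (fun i => if i = j then Polynomial.X else Polynomial.C (v i)) :
          Poly →ₐ[ℝ] Polynomial ℝ).toRingHom _ = _
    rw [base, map_mul, map_PL, map_PR, hf, hf]
    simp
  have h1 := natDegree_PL_le (2 * x - 1)
    (seg (fun i => if i = j then (Polynomial.X : Polynomial ℝ) else Polynomial.C (v i)) 0 n)
  have h2 := natDegree_PR_le
    (seg (fun i => if i = j then (Polynomial.X : Polynomial ℝ) else Polynomial.C (v i)) n n)
  rw [sum_seg_natDegree, length_seg] at h1 h2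
  have h3 := Polynomial.natDegree_mul_le (p := PL (Polynomial.C (2 * x - 1))
        (seg (fun i => if i = j then Polynomial.X else Polynomial.C (v i)) 0 n))
        (q := PR (seg (fun i => if i = j then Polynomial.X else Polynomial.C (v i)) n n))
  rw [← e] at h3
  constructor
  · intro h
    rw [if_pos (by omega)] at h1
    rw [if_neg (by omega)] at h2
    omega
  · intro h
    rw [if_neg (by omega)] at h1
    rw [if_pos (by omega)] at h2
    omega

end XXZOverlap

namespace XXZOverlap

open MvPolynomial

variable {x : ℝ} {n : ℕ}

lemma sw_update (i j : ℕ) (v : ℕ → ℝ) (t : ℝ) :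
    sw i (Function.update v j t) = Function.update (sw i v) (Equiv.swap i (i + 1) j) t := by
  ext k
  rcases eq_or_ne k (Equiv.swap i (i + 1) j) with rfl | h
  · simp [sw]
  · rw [Function.update_of_ne h]
    simp only [sw, Function.comp]
    rw [Function.update_of_ne]
    rintro rfl
    simp at h

lemma natDegree_lineAt (β : List Bool) (h1 : β.count true = n) (h2 : β.count false = n) :
    ∀ (j : ℕ) (v : ℕ → ℝ), InjOff j β.length v →
      (β[j]? = some true → (lineAt j v (P x n β)).natDegree + 1 ≤ 2 * n) ∧
      (β[j]? = some false → (lineAt j v (P x n β)).natDegree + 2 ≤ 2 * n) := by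
  refine word_induction (Q := fun β => ∀ (j : ℕ) (v : ℕ → ℝ), InjOff j β.length v →
      (β[j]? = some true → (lineAt j v (P x n β)).natDegree + 1 ≤ 2 * n) ∧
      (β[j]? = some false → (lineAt j v (P x n β)).natDegree + 2 ≤ 2 * n)) ?_ ?_ β h1 h2
  · intro j v _
    rw [P_base]
    have := natDegree_lineAt_base (n := n) x j v
    constructor
    · intro h
      apply this.1
      by_contra hj
      rw [List.getElem?_append_right (by simpa using hj)] at h
      simp [List.getElem?_replicate] at h
    · intro h
      apply this.2
      have hj := (List.getElem?_eq_some_iff.1 h).1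
      refine ⟨?_, by simpa using hj⟩
      by_contra hj
      rw [List.getElem?_append_left (by simpa using hj)] at h
      simp [List.getElem?_replicate] at h
  · intro l r ih j v hv
    rw [P_ud]
    set f := P x n (l ++ true :: false :: r)
    set i := l.length with hi
    have hlen : (l ++ false :: true :: r).length = (l ++ true :: false :: r).length := by simp
    have hik : i + 1 < (l ++ true :: false :: r).length := by simp [hi]
    rw [hlen] at hv
    have hv' := hv.sw hik
    have i1 := ih _ _ hv
    have i2 := ih _ _ hv'
    have key : ∀ t, _ := fun t => T_spec i f (Function.update v j t)
    simp only [sw_update] at key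
    by_cases hj : j = i
    · subst hj
      have e1 : (l ++ true :: false :: r)[i]? = some true := by simp [hi]
      have e2 : (l ++ true :: false :: r)[i + 1]? = some false := by simp [hi]
      rw [Equiv.swap_apply_left] at i2
      have d1 := i1.1 e1
      have d2 := i2.2 e2
      refine ⟨by simp [hi], fun _ => ?_⟩
      suffices h : (lineAt i v (T i f)).natDegree ≤ 2 * n - 2 by omega
      refine natDegree_le_of_linear_mul (c := 2) (d := -2 * v (i + 1)) two_ne_zero
        (r := (1 + Polynomial.C (3 * v (i + 1)) * Polynomial.X + Polynomial.X -
          Polynomial.C (v (i + 1))) * lineAt (i + 1) (sw i v) f -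
          Polynomial.C (1 + 3 * v (i + 1) ^ 2) * lineAt i v f) ?_ ?_
      · refine Polynomial.funext fun t => ?_
        have := key t
        simp [D] at this
        simp [eval_lineAt]
        linear_combination this
      · have g1 : (1 + Polynomial.C (3 * v (i + 1)) * Polynomial.X + Polynomial.X -
          Polynomial.C (v (i + 1)) : Polynomial ℝ).natDegree ≤ 1 := by compute_degree
        have g2 := Polynomial.natDegree_mul_le (p := (1 + Polynomial.C (3 * v (i + 1)) *
          Polynomial.X + Polynomial.X - Polynomial.C (v (i + 1)) : Polynomial ℝ))
          (q := lineAt (i + 1) (sw i v) f)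
        refine (Polynomial.natDegree_sub_le _ _).trans (max_le (by omega) ?_)
        exact (Polynomial.natDegree_C_mul_le _ _).trans (by omega)
    · by_cases hj' : j = i + 1
      · subst hj'
        have e1 : (l ++ true :: false :: r)[i]? = some true := by simp [hi]
        have e2 : (l ++ true :: false :: r)[i + 1]? = some false := by simp [hi]
        rw [Equiv.swap_apply_right] at i2
        have d1 := i1.2 e2
        have d2 := i2.1 e1
        refine ⟨fun _ => ?_, by simp [hi]⟩
        suffices h : (lineAt (i + 1) v (T i f)).natDegree ≤ 2 * n - 1 by omega
        refine natDegree_le_of_linear_mul (c := -2) (d := 2 * v i) (by norm_num)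
          (r := (1 + Polynomial.C (3 * v i) * Polynomial.X - Polynomial.X +
            Polynomial.C (v i)) * lineAt i (sw i v) f -
            (1 + 3 * Polynomial.X ^ 2) * lineAt (i + 1) v f) ?_ ?_
        · refine Polynomial.funext fun t => ?_
          have := key t
          simp [D] at this
          simp [eval_lineAt]
          linear_combination this
        · have g1 : (1 + Polynomial.C (3 * v i) * Polynomial.X - Polynomial.X +
            Polynomial.C (v i) : Polynomial ℝ).natDegree ≤ 1 := by compute_degree
          have g2 := Polynomial.natDegree_mul_le (p := (1 + Polynomial.C (3 * v i) *
            Polynomial.X - Polynomial.X + Polynomial.C (v i) : Polynomial ℝ))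
            (q := lineAt i (sw i v) f)
          have g3 : (1 + 3 * Polynomial.X ^ 2 : Polynomial ℝ).natDegree ≤ 2 := by compute_degree
          have g4 := Polynomial.natDegree_mul_le (p := (1 + 3 * Polynomial.X ^ 2 : Polynomial ℝ))
            (q := lineAt (i + 1) v f)
          exact (Polynomial.natDegree_sub_le _ _).trans (max_le (by omega) (by omega))
      · rw [Equiv.swap_apply_of_ne_of_ne hj hj'] at i2
        have e : (l ++ false :: true :: r)[j]? = (l ++ true :: false :: r)[j]? := by
          rcases Nat.lt_or_ge j i with h | h
          · rw [List.getElem?_append_left h, List.getElem?_append_left h]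
          · obtain ⟨m, hm⟩ : ∃ m, j - l.length = m + 1 + 1 := ⟨j - i - 2, by omega⟩
            rw [List.getElem?_append_right h, List.getElem?_append_right h, hm]
            rfl
        rw [e]
        have hd : ∀ k, (lineAt j (sw i v) f).natDegree ≤ k → (lineAt j v f).natDegree ≤ k →
            (lineAt j v (T i f)).natDegree ≤ k := by
          intro k k1 k2
          have hvv : v i - v (i + 1) ≠ 0 := sub_ne_zero.2
            (hv i (i + 1) (by omega) (by omega) (by omega) (Ne.symm hj) (Ne.symm hj'))
          have : Polynomial.C (2 * (v i - v (i + 1))) * lineAt j v (T i f) =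
              Polynomial.C (D (v i) (v (i + 1))) * lineAt j (sw i v) f -
              Polynomial.C (1 + 3 * v (i + 1) ^ 2) * lineAt j v f := by
            refine Polynomial.funext fun t => ?_
            have := key t
            rw [Equiv.swap_apply_of_ne_of_ne hj hj'] at this
            simp only [Function.update_of_ne (Ne.symm hj), Function.update_of_ne (Ne.symm hj')]
              at this
            simp only [Polynomial.eval_mul, Polynomial.eval_sub, Polynomial.eval_C, eval_lineAt]
            linear_combination this
          rw [← Polynomial.natDegree_C_mul (mul_ne_zero two_ne_zero hvv), this]
          exact (Polynomial.natDegree_sub_le _ _).trans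
            (max_le ((Polynomial.natDegree_C_mul_le _ _).trans k1)
              ((Polynomial.natDegree_C_mul_le _ _).trans k2))
        constructor
        · intro hjt
          have := hd (2 * n - 1) (by have := i2.1 hjt; omega) (by have := i1.1 hjt; omega)
          have := i1.1 hjt
          omega
        · intro hjt
          have := hd (2 * n - 2) (by have := i2.2 hjt; omega) (by have := i1.2 hjt; omega)
          have := i1.2 hjt
          omega

lemma injOff_toV {lv rv : List ℝ} (h : (lv ++ rv).Nodup) (a : ℝ) :
    InjOff lv.length (lv ++ a :: rv).length (toV (lv ++ a :: rv)) := by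
  have key : ∀ i, i < (lv ++ a :: rv).length → i ≠ lv.length →
      ∃ (m : ℕ) (hm : m < (lv ++ rv).length), toV (lv ++ a :: rv) i = (lv ++ rv)[m] ∧
        i = if m < lv.length then m else m + 1 := by
    intro i hi hne
    simp only [List.length_append, List.length_cons] at hi
    rcases lt_or_gt_of_ne hne with h | h
    · refine ⟨i, by simp; omega, ?_, by rw [if_pos h]⟩
      simp [toV, List.getD_eq_getElem?_getD, List.getElem?_append_left h,
        List.getElem_append_left h, h]
    · obtain ⟨m, rfl⟩ : ∃ m, i = lv.length + (m + 1) := ⟨i - lv.length - 1, by omega⟩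
      have hm : m < rv.length := by omega
      refine ⟨lv.length + m, by simp; omega, ?_, by rw [if_neg (by omega)]; omega⟩
      simp [toV, List.getD_eq_getElem?_getD, List.getElem_append_right, hm]
  intro i j hi hj hij hi' hj' e
  obtain ⟨m, hm, h1, h2⟩ := key i hi hi'
  obtain ⟨m', hm', h3, h4⟩ := key j hj hj'
  rw [h1, h3, h.getElem_inj_iff] at e
  subst e
  exact hij (h2.trans h4.symm)

/-- Each component is polynomial in each spectral parameter, of controlled degree. -/
lemma exists_psi_poly (x : ℝ) (n : ℕ) {l r : List Bool} {lv rv : List ℝ}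
    (hl : l.length = lv.length) (hr : r.length = rv.length) (h : (lv ++ rv).Nodup) (a : Bool) :
    ∃ q : Polynomial ℝ, q.natDegree ≤ 2 * n - (if a then 1 else 2) ∧
      ∀ t, psi x n (l ++ a :: r) (lv ++ t :: rv) = q.eval t := by
  by_cases hc : (l ++ a :: r).count true = n ∧ (l ++ a :: r).count false = n
  · refine ⟨lineAt lv.length (toV (lv ++ 0 :: rv)) (P x n (l ++ a :: r)), ?_, fun t => ?_⟩
    · have hi := injOff_toV h 0
      have := natDegree_lineAt (x := x) _ hc.1 hc.2 lv.length (toV (lv ++ 0 :: rv))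
        (by simpa [hl, hr] using hi)
      cases a
      · have := this.2 (by simp [← hl])
        simp; omega
      · have := this.1 (by simp [← hl])
        simp; omega
    · rw [eval_lineAt, update_toV, psi]
  · exact ⟨0, by simp, fun t => by rw [psi_eq_zero hc]; simp⟩

end XXZOverlap

namespace XXZOverlap

open MvPolynomial

variable {x : ℝ} {n : ℕ}

/-- The sum over all words of length `m`. -/
def sumW : ℕ → (List Bool → ℝ) → ℝ
  | 0, g => g []
  | m + 1, g => sumW m (fun β => g (true :: β)) + sumW m (fun β => g (false :: β))

lemma sumW_congr {m : ℕ} {g h : List Bool → ℝ} (e : ∀ α, α.length = m → g α = h α) :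
    sumW m g = sumW m h := by
  induction m generalizing g h with
  | zero => exact e [] rfl
  | succ m ih =>
    rw [sumW, sumW, ih fun α hα => e (true :: α) (by simp [hα]),
      ih fun α hα => e (false :: α) (by simp [hα])]

lemma sumW_add (m : ℕ) (g h : List Bool → ℝ) :
    sumW m (fun α => g α + h α) = sumW m g + sumW m h := by
  induction m generalizing g h with
  | zero => rfl
  | succ m ih => simp only [sumW, ih]; ring

lemma sumW_mul (m : ℕ) (c : ℝ) (g : List Bool → ℝ) :
    sumW m (fun α => c * g α) = c * sumW m g := by
  induction m generalizing g with
  | zero => rfl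
  | succ m ih => simp only [sumW, ih]; ring

lemma sumW_comm (j k : ℕ) (g : List Bool → List Bool → ℝ) :
    sumW j (fun α => sumW k (fun β => g α β)) = sumW k (fun β => sumW j (fun α => g α β)) := by
  induction j generalizing g with
  | zero => rfl
  | succ j ih => simp only [sumW, ih, sumW_add]

lemma sumW_append (j k : ℕ) (g : List Bool → ℝ) :
    sumW (j + k) g = sumW j (fun α => sumW k (fun β => g (α ++ β))) := by
  induction j generalizing g with
  | zero => simp [sumW]
  | succ j ih => rw [Nat.succ_add]; simp only [sumW, ih, List.cons_append]

lemma sumW_pair (j k : ℕ) (g : List Bool → ℝ) :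
    sumW (j + (k + 2)) g = sumW j (fun l => sumW k (fun r =>
      g (l ++ true :: true :: r) + g (l ++ true :: false :: r) +
        (g (l ++ false :: true :: r) + g (l ++ false :: false :: r)))) := by
  rw [sumW_append]
  simp only [sumW, sumW_add]

lemma exists_sumW_poly {m d : ℕ} {g : List Bool → ℝ → ℝ}
    (h : ∀ α, α.length = m → ∃ q : Polynomial ℝ, q.natDegree ≤ d ∧ ∀ t, g α t = q.eval t) :
    ∃ q : Polynomial ℝ, q.natDegree ≤ d ∧ ∀ t, sumW m (fun α => g α t) = q.eval t := by
  induction m generalizing g with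
  | zero => exact h [] rfl
  | succ m ih =>
    obtain ⟨q1, h1, e1⟩ := ih (g := fun β => g (true :: β)) fun α hα => h _ (by simp [hα])
    obtain ⟨q2, h2, e2⟩ := ih (g := fun β => g (false :: β)) fun α hα => h _ (by simp [hα])
    refine ⟨q1 + q2, (Polynomial.natDegree_add_le _ _).trans (max_le h1 h2), fun t => ?_⟩
    rw [sumW, Polynomial.eval_add, ← e1, ← e2]

/-- The weight of a word. -/
def wt : List Bool → List ℝ → ℝ
  | a :: α, v :: L => (if a then 1 else 1 + 3 * v ^ 2) * wt α L
  | _, _ => 1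

lemma wt_append {α β : List Bool} {A B : List ℝ} (h : α.length = A.length) :
    wt (α ++ β) (A ++ B) = wt α A * wt β B := by
  induction α generalizing A with
  | nil => obtain rfl := List.length_eq_zero_iff.1 h.symm; simp [wt]
  | cons a α ih =>
    obtain ⟨v, A, rfl⟩ := List.exists_cons_of_length_eq_add_one (by simpa using h.symm)
    simp only [List.cons_append, wt, ih (by simpa using h), mul_assoc]

/-- The exchange relations between components. -/
structure Exch (G : List Bool → List ℝ → ℝ) : Prop where
  du : ∀ {l r : List Bool} {lv rv : List ℝ}, l.length = lv.length → r.length = rv.length →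
    ∀ v w, (1 + 3 * w ^ 2) * G (l ++ true :: false :: r) (lv ++ v :: w :: rv) +
      2 * (v - w) * G (l ++ false :: true :: r) (lv ++ v :: w :: rv) =
      D v w * G (l ++ true :: false :: r) (lv ++ w :: v :: rv)
  ud : ∀ {l r : List Bool} {lv rv : List ℝ}, l.length = lv.length → r.length = rv.length →
    ∀ v w, (1 + 3 * v ^ 2) * G (l ++ false :: true :: r) (lv ++ v :: w :: rv) +
      2 * (v - w) * G (l ++ true :: false :: r) (lv ++ v :: w :: rv) =
      D v w * G (l ++ false :: true :: r) (lv ++ w :: v :: rv)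
  eq : ∀ {l r : List Bool} {lv rv : List ℝ}, l.length = lv.length → r.length = rv.length →
    ∀ a v w, D w v * G (l ++ a :: a :: r) (lv ++ v :: w :: rv) =
      D v w * G (l ++ a :: a :: r) (lv ++ w :: v :: rv)

lemma exch_psi (x : ℝ) (n : ℕ) : Exch (psi x n) :=
  ⟨fun h _ => psi_du h, fun h _ => psi_ud h, fun h _ => psi_eq h⟩

lemma Exch.right {G : List Bool → List ℝ → ℝ} (h : Exch G) {α : List Bool} {A : List ℝ}
    (hα : α.length = A.length) : Exch fun β B => G (α ++ β) (A ++ B) := by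
  constructor <;> intro l r lv rv hl hr
  · simpa using h.du (l := α ++ l) (lv := A ++ lv) (by simp [hα, hl]) hr
  · simpa using h.ud (l := α ++ l) (lv := A ++ lv) (by simp [hα, hl]) hr
  · simpa using h.eq (l := α ++ l) (lv := A ++ lv) (by simp [hα, hl]) hr

lemma Exch.left {G : List Bool → List ℝ → ℝ} (h : Exch G) {β : List Bool} {B : List ℝ}
    (hβ : β.length = B.length) : Exch fun α A => G (α ++ β) (A ++ B) := by
  constructor <;> intro l r lv rv hl hr
  · simpa using h.du (r := r ++ β) (rv := rv ++ B) hl (by simp [hβ, hr])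
  · simpa using h.ud (r := r ++ β) (rv := rv ++ B) hl (by simp [hβ, hr])
  · simpa using h.eq (r := r ++ β) (rv := rv ++ B) hl (by simp [hβ, hr])

/-- The pairing of two families of components. -/
def bil (m : ℕ) (G H : List Bool → List ℝ → ℝ) (L : List ℝ) : ℝ :=
  sumW m fun α => wt α L * G α L * H α (L.map Neg.neg)

lemma bil_swap {G H : List Bool → List ℝ → ℝ} (hG : Exch G) (hH : Exch H) {m : ℕ}
    {lv rv : List ℝ} {v w : ℝ} (hm : m = lv.length + (rv.length + 2)) (h1 : D v w ≠ 0)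
    (h2 : D w v ≠ 0) : bil m G H (lv ++ v :: w :: rv) = bil m G H (lv ++ w :: v :: rv) := by
  rw [bil, bil, hm, sumW_pair, sumW_pair]
  refine sumW_congr fun l hl => sumW_congr fun r hr => ?_
  have hl' : l.length = (lv.map Neg.neg).length := by simp [hl]
  have hr' : r.length = (rv.map Neg.neg).length := by simp [hr]
  simp only [wt_append hl, wt, List.map_append, List.map_cons, if_true, if_false, one_mul,
    Bool.false_eq_true]
  have g1 := hG.du hl hr v w
  have g2 := hG.ud hl hr v w
  have g3 := hG.eq hl hr true v w
  have g4 := hG.eq hl hr false v w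
  have k1 := hH.du hl' hr' (-v) (-w)
  have k2 := hH.ud hl' hr' (-v) (-w)
  have k3 := hH.eq hl' hr' true (-v) (-w)
  have k4 := hH.eq hl' hr' false (-v) (-w)
  have d1 : D (-v) (-w) = D w v := by simp only [D]; ring
  have d2 : D (-w) (-v) = D v w := by simp only [D]; ring
  rw [d1] at k1 k2 k3 k4
  rw [d2] at k3 k4
  have hD : D v w * D w v = (1 + 3 * v ^ 2) * (1 + 3 * w ^ 2) - 4 * (v - w) ^ 2 := by
    simp only [D]; ring
  generalize G (l ++ true :: false :: r) (lv ++ v :: w :: rv) = a1 at *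
  generalize G (l ++ false :: true :: r) (lv ++ v :: w :: rv) = a2 at *
  generalize G (l ++ true :: true :: r) (lv ++ v :: w :: rv) = a3 at *
  generalize G (l ++ false :: false :: r) (lv ++ v :: w :: rv) = a4 at *
  generalize G (l ++ true :: false :: r) (lv ++ w :: v :: rv) = b1 at *
  generalize G (l ++ false :: true :: r) (lv ++ w :: v :: rv) = b2 at *
  generalize G (l ++ true :: true :: r) (lv ++ w :: v :: rv) = b3 at *
  generalize G (l ++ false :: false :: r) (lv ++ w :: v :: rv) = b4 at *
  generalize H (l ++ true :: false :: r) (lv.map Neg.neg ++ -v :: -w :: rv.map Neg.neg) = c1 at *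
  generalize H (l ++ false :: true :: r) (lv.map Neg.neg ++ -v :: -w :: rv.map Neg.neg) = c2 at *
  generalize H (l ++ true :: true :: r) (lv.map Neg.neg ++ -v :: -w :: rv.map Neg.neg) = c3 at *
  generalize H (l ++ false :: false :: r) (lv.map Neg.neg ++ -v :: -w :: rv.map Neg.neg) = c4 at *
  generalize H (l ++ true :: false :: r) (lv.map Neg.neg ++ -w :: -v :: rv.map Neg.neg) = d1 at *
  generalize H (l ++ false :: true :: r) (lv.map Neg.neg ++ -w :: -v :: rv.map Neg.neg) = d2 at *
  generalize H (l ++ true :: true :: r) (lv.map Neg.neg ++ -w :: -v :: rv.map Neg.neg) = d3 at *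
  generalize H (l ++ false :: false :: r) (lv.map Neg.neg ++ -w :: -v :: rv.map Neg.neg) = d4 at *
  apply mul_left_cancel₀ (mul_ne_zero h1 h2)
  linear_combination (wt l lv * wt r rv) *
    (g3 * (D v w * c3) + D v w * b3 * k3 +
      (1 + 3 * v ^ 2) * (1 + 3 * w ^ 2) * (g4 * (D v w * c4) + D v w * b4 * k4) +
      hD * ((1 + 3 * w ^ 2) * a1 * c1 + (1 + 3 * v ^ 2) * a2 * c2) +
      (1 + 3 * v ^ 2) * (g1 * (D w v * d1) +
        ((1 + 3 * w ^ 2) * a1 + 2 * (v - w) * a2) * k1) +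
      (1 + 3 * w ^ 2) * (g2 * (D w v * d2) +
        ((1 + 3 * v ^ 2) * a2 + 2 * (v - w) * a1) * k2))

/-- The inhomogeneous overlap. -/
def F (x : ℝ) (n1 n2 : ℕ) (L1 L2 : List ℝ) : ℝ :=
  sumW (2 * n1) fun α => sumW (2 * n2) fun β => wt α L1 * wt β L2 *
    psi x (n1 + n2) (α ++ β) (L1 ++ L2) * psi x n1 α (L1.map Neg.neg) *
      psi x n2 β (L2.map Neg.neg)

lemma F_eq_right (x : ℝ) (n1 n2 : ℕ) (L1 L2 : List ℝ) :
    F x n1 n2 L1 L2 = sumW (2 * n1) fun α => wt α L1 * psi x n1 α (L1.map Neg.neg) *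
      bil (2 * n2) (fun β B => psi x (n1 + n2) (α ++ β) (L1 ++ B)) (psi x n2) L2 := by
  refine sumW_congr fun α _ => ?_
  rw [bil, ← sumW_mul]
  exact sumW_congr fun β _ => by ring

lemma F_eq_left (x : ℝ) (n1 n2 : ℕ) (L1 L2 : List ℝ) :
    F x n1 n2 L1 L2 = sumW (2 * n2) fun β => wt β L2 * psi x n2 β (L2.map Neg.neg) *
      bil (2 * n1) (fun α A => psi x (n1 + n2) (α ++ β) (A ++ L2)) (psi x n1) L1 := by
  rw [F, sumW_comm]
  refine sumW_congr fun β _ => ?_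
  rw [bil, ← sumW_mul]
  exact sumW_congr fun α _ => by ring

lemma F_swap_right {n1 n2 : ℕ} {L1 lv rv : List ℝ} {v w : ℝ} (h1 : L1.length = 2 * n1)
    (h2 : 2 * n2 = lv.length + (rv.length + 2)) (hv : D v w ≠ 0) (hw : D w v ≠ 0) :
    F x n1 n2 L1 (lv ++ v :: w :: rv) = F x n1 n2 L1 (lv ++ w :: v :: rv) := by
  rw [F_eq_right, F_eq_right]
  refine sumW_congr fun α hα => ?_
  rw [bil_swap ((exch_psi x _).right (hα.trans h1.symm)) (exch_psi x _) h2 hv hw]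

lemma F_swap_left {n1 n2 : ℕ} {L2 lv rv : List ℝ} {v w : ℝ} (h1 : L2.length = 2 * n2)
    (h2 : 2 * n1 = lv.length + (rv.length + 2)) (hv : D v w ≠ 0) (hw : D w v ≠ 0) :
    F x n1 n2 (lv ++ v :: w :: rv) L2 = F x n1 n2 (lv ++ w :: v :: rv) L2 := by
  rw [F_eq_left, F_eq_left]
  refine sumW_congr fun α hα => ?_
  rw [bil_swap ((exch_psi x _).left (hα.trans h1.symm)) (exch_psi x _) h2 hv hw]

end XXZOverlap

namespace XXZOverlap

open MvPolynomial

variable {x : ℝ} {n : ℕ}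

lemma bil_pair {G H G' H' : List Bool → List ℝ → ℝ} {m : ℕ} {L : List ℝ} {p w a b : ℝ}
    (hH : Exch H) (hL : L.length = m) (hp : 1 - 3 * p ≠ 0) (hw : w * (1 - 3 * p) = 1 + p)
    (h0 : ∀ r, r.length = m → ∀ c, G (c :: c :: r) (p :: w :: L) = 0)
    (h1 : ∀ r, r.length = m → G (false :: true :: r) (p :: w :: L) =
      2 / (1 - 3 * p) * G (true :: false :: r) (p :: w :: L))
    (h2 : ∀ r, r.length = m → G (true :: false :: r) (p :: w :: L) = a * G' r L)
    (h3 : ∀ r, r.length = m → H (true :: false :: r) (-w :: -p :: L.map Neg.neg) =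
      b * H' r (L.map Neg.neg)) :
    bil (m + 2) G H (p :: w :: L) = D w p * a * b * bil m G' H' L := by
  rw [bil, bil, ← sumW_mul, ← Nat.zero_add (m + 2), sumW_pair, sumW]
  refine sumW_congr fun r hr => ?_
  have e := hH.du (l := []) (lv := []) rfl (r := r) (rv := L.map Neg.neg)
    (by simp [hr, hL]) (-p) (-w)
  have hd : D (-p) (-w) = D w p := by simp only [D]; ring
  have hκ : (1 + 3 * p ^ 2) * (2 / (1 - 3 * p)) = 2 * (w - p) := by
    rw [← mul_div_assoc, div_eq_iff hp]; linear_combination -2 * hw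
  simp only [List.nil_append, hd] at e
  simp only [List.nil_append, h0 r hr, h1 r hr, h2 r hr, wt, List.map_cons, if_true, if_false,
    Bool.false_eq_true]
  rw [h3 r hr] at e
  linear_combination (wt r L * a * G' r L) * (e + H (false :: true :: r)
    (-p :: -w :: L.map Neg.neg) * hκ)

lemma pair_neg {p w : ℝ} (hw : w * (1 - 3 * p) = 1 + p) :
    1 - 3 * (-w) ≠ 0 ∧ (-p) * (1 - 3 * (-w)) = 1 + -w := by
  constructor
  · intro h
    have : (1 - 3 * (-w)) * (1 - 3 * p) = 4 := by linear_combination 3 * hw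
    rw [h] at this; norm_num at this
  · linear_combination hw

lemma psi_pair_neg {r : List Bool} {L : List ℝ} {p w : ℝ} (hr : r.length = L.length)
    (hw : w * (1 - 3 * p) = 1 + p)
    (h1 : ∀ s ∈ L, D s p ≠ 0 ∧ s ≠ p) (hn : L.Nodup) :
    psi x (n + 1) (true :: false :: r) (-w :: -p :: L.map Neg.neg) =
      kap x (-w) n (L.map Neg.neg) * psi x n r (L.map Neg.neg) := by
  obtain ⟨q1, q2⟩ := pair_neg hw
  refine psi_pair_front (by simp [hr]) q1 q2 ?_ (hn.map neg_injective)
  intro s hs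
  obtain ⟨s, hs', rfl⟩ := List.mem_map.1 hs
  have hws : D (-s) (-w) * (1 - 3 * p) = 2 * D s p := by
    simp only [D]; linear_combination (3 * s + 1) * hw
  have hsw : D (-w) (-s) * (1 - 3 * p) = 4 * (s - p) := by
    simp only [D]; linear_combination (3 * s - 1) * hw
  constructor <;> intro h0
  · rw [h0] at hsw; exact (h1 s hs').2 (by linarith)
  · rw [h0] at hws; exact (h1 s hs').1 (by linarith)

lemma F_pair_right {n1 n2 : ℕ} {L1 L2 : List ℝ} {p w : ℝ} (hl1 : L1.length = 2 * n1)
    (hl2 : L2.length = 2 * n2) (hp : 1 - 3 * p ≠ 0) (hw : w * (1 - 3 * p) = 1 + p)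
    (h1 : ∀ s ∈ L1 ++ L2, D p s ≠ 0 ∧ D s p ≠ 0) (hs : p ∉ L2) (hn : (L1 ++ L2).Nodup) :
    F x n1 (n2 + 1) L1 (p :: w :: L2) =
      D w p * kap x p (n1 + n2) (L1 ++ L2) * kap x (-w) n2 (L2.map Neg.neg) * F x n1 n2 L1 L2 := by
  rw [F_eq_right, F_eq_right, ← sumW_mul]
  refine sumW_congr fun α hα => ?_
  have hαL := hα.trans hl1.symm
  have := bil_pair (G := fun β B => psi x (n1 + (n2 + 1)) (α ++ β) (L1 ++ B))
    (H := psi x (n2 + 1)) (G' := fun β B => psi x (n1 + n2) (α ++ β) (L1 ++ B))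
    (H' := psi x n2) (m := 2 * n2) (L := L2) (a := kap x p (n1 + n2) (L1 ++ L2))
    (b := kap x (-w) n2 (L2.map Neg.neg)) (exch_psi x _) hl2 hp hw
    (fun r _ c => psi_pair_eq hαL c hw) (fun r _ => psi_pair_ud hαL hp hw)
    (fun r hr => psi_pair hαL (hr.trans hl2.symm) hp hw h1 hn)
    (fun r hr => psi_pair_neg (hr.trans hl2.symm) hw
      (fun s hs' => ⟨(h1 s (by simp [hs'])).2, fun e => hs (e ▸ hs')⟩)
      (List.nodup_append.1 hn).2.1)
  rw [show 2 * (n2 + 1) = 2 * n2 + 2 by ring, this]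
  ring

lemma F_pair_left {n1 n2 : ℕ} {L1 L2 : List ℝ} {p w : ℝ} (hl1 : L1.length = 2 * n1)
    (hl2 : L2.length = 2 * n2) (hp : 1 - 3 * p ≠ 0) (hw : w * (1 - 3 * p) = 1 + p)
    (h1 : ∀ s ∈ L1 ++ L2, D p s ≠ 0 ∧ D s p ≠ 0) (hs : p ∉ L1) (hn : (L1 ++ L2).Nodup) :
    F x (n1 + 1) n2 (p :: w :: L1) L2 =
      D w p * kap x p (n1 + n2) (L1 ++ L2) * kap x (-w) n1 (L1.map Neg.neg) * F x n1 n2 L1 L2 := by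
  rw [F_eq_left, F_eq_left, ← sumW_mul]
  refine sumW_congr fun β hβ => ?_
  have hβL := hβ.trans hl2.symm
  have hN : n1 + 1 + n2 = n1 + n2 + 1 := by omega
  have := bil_pair (G := fun α A => psi x (n1 + 1 + n2) (α ++ β) (A ++ L2))
    (H := psi x (n1 + 1)) (G' := fun α A => psi x (n1 + n2) (α ++ β) (A ++ L2))
    (H' := psi x n1) (m := 2 * n1) (L := L1) (a := kap x p (n1 + n2) (L1 ++ L2))
    (b := kap x (-w) n1 (L1.map Neg.neg)) (exch_psi x _) hl1 hp hw
    (fun r _ c => psi_pair_eq (l := []) (lv := []) rfl c hw)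
    (fun r _ => psi_pair_ud (l := []) (lv := []) rfl hp hw)
    (fun r hr => by
      rw [hN]
      exact psi_pair_front (by simp [hr, hl1, hβL]) hp hw h1 hn)
    (fun r hr => psi_pair_neg (hr.trans hl1.symm) hw
      (fun s hs' => ⟨(h1 s (by simp [hs'])).2, fun e => hs (e ▸ hs')⟩)
      (List.nodup_append.1 hn).1)
  rw [show 2 * (n1 + 1) = 2 * n1 + 2 by ring, this]
  ring

lemma F_even_left {n1 n2 : ℕ} {L1 L2 : List ℝ} {v : ℝ} (hl1 : L1.length + 1 = 2 * n1)
    (hl2 : L2.length = 2 * n2) (hv : 1 - (2 * x - 1) ^ 2 * v ^ 2 ≠ 0) :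
    F x n1 n2 (-v :: L1) L2 = F x n1 n2 (v :: L1) L2 := by
  refine sumW_congr fun α hα => sumW_congr fun β hβ => ?_
  obtain ⟨a, α, rfl⟩ := List.exists_cons_of_length_eq_add_one (hα.trans hl1.symm)
  have hα' : α.length = L1.length := by simp at hα; omega
  have e1 := psi_left x (n1 + n2) a (α ++ β) v (L1 ++ L2) (by simp [hα', hβ, hl2])
  have e2 := psi_left x n1 a α v (L1.map Neg.neg) (by simp [hα'])
  have hk : (1 - kapL x a * v) * (1 + kapL x a * v) ≠ 0 := by
    cases a
    · simp [kapL]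
    · simp only [kapL, if_true]
      convert hv using 1
      ring
  simp only [wt, List.cons_append, List.map_cons, neg_neg, neg_sq]
  apply mul_left_cancel₀ hk
  linear_combination ((if a = true then 1 else 1 + 3 * v ^ 2) * wt α L1 * wt β L2 *
    psi x n2 β (L2.map Neg.neg)) *
      (e1 * (1 + kapL x a * v) * psi x n1 (a :: α) (v :: L1.map Neg.neg) -
      e2 * (1 + kapL x a * v) * psi x (n1 + n2) (a :: (α ++ β)) (v :: (L1 ++ L2)))

lemma wt_concat {α : List Bool} {L : List ℝ} (h : α.length = L.length) (a : Bool) (v : ℝ) :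
    wt (α ++ [a]) (L ++ [v]) = wt α L * (if a then 1 else 1 + 3 * v ^ 2) := by
  simp [wt_append h, wt]

lemma F_even_right {n1 n2 : ℕ} {L1 L2 : List ℝ} {v : ℝ} (hx : 0 < x) (hl1 : L1.length = 2 * n1)
    (hl2 : L2.length + 1 = 2 * n2) (hv : 1 - (2 / x - 1) ^ 2 * v ^ 2 ≠ 0) :
    F x n1 n2 L1 (L2 ++ [-v]) = F x n1 n2 L1 (L2 ++ [v]) := by
  refine sumW_congr fun α hα => sumW_congr fun β hβ => ?_
  obtain ⟨β, a, rfl⟩ : ∃ β' a, β = β' ++ [a] := by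
    rcases List.eq_nil_or_concat β with rfl | ⟨β', a, rfl⟩
    · simp at hβ; omega
    · exact ⟨β', a, by simp⟩
  have hβ' : β.length = L2.length := by simp at hβ; omega
  have e1 := psi_right hx (n1 + n2) a (α ++ β) v (L1 ++ L2) (by simp [hα, hβ', hl1])
  have e2 := psi_right hx n2 a β v (L2.map Neg.neg) (by simp [hβ'])
  have hk : (1 - kapR x a * v) * (1 + kapR x a * v) ≠ 0 := by
    cases a
    · simp [kapR]
    · simp only [kapR, if_true]
      convert hv using 1
      ring
  simp only [List.append_assoc] at e1
  simp only [wt_concat hβ', List.map_append, List.map_cons, List.map_nil, neg_neg, neg_sq]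
  apply mul_left_cancel₀ hk
  linear_combination ((if a = true then 1 else 1 + 3 * v ^ 2) * wt α L1 * wt β L2 *
    psi x n1 α (L1.map Neg.neg)) *
      (e1 * (1 - kapR x a * v) * psi x n2 (β ++ [a]) (L2.map Neg.neg ++ [v]) -
      e2 * (1 - kapR x a * v) * psi x (n1 + n2) (α ++ (β ++ [a])) (L1 ++ (L2 ++ [v])))

end XXZOverlap

namespace XXZOverlap

open Polynomial

/-- The cubic `X (X + 3)²`. -/
def cubic : ℝ[X] := X * (X + C 3) ^ 2

/-- The columns `1, g, T, g T, T², g T², …`, where `T` is the cubic. -/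
def col (g : ℝ[X]) (j : ℕ) : ℝ[X] := cubic ^ (j / 2) * g ^ (j % 2)

/-- The determinant of the remainders of the columns modulo a polynomial. -/
def detRem (g : ℝ[X]) (m : ℕ) (q : ℝ[X]) : ℝ :=
  Matrix.det (Matrix.of fun i j : Fin m => (col g j %ₘ q).coeff i)

/-- The monic polynomial with the given roots. -/
def rootPoly {m : ℕ} (a : Fin m → ℝ) : ℝ[X] := ∏ k, (X - C (a k))

lemma rootPoly_monic {m : ℕ} (a : Fin m → ℝ) : (rootPoly a).Monic :=
  monic_prod_of_monic _ _ fun k _ => monic_X_sub_C (a k)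

lemma rootPoly_natDegree {m : ℕ} (a : Fin m → ℝ) : (rootPoly a).natDegree = m := by
  simp [rootPoly, natDegree_prod_of_monic _ _ fun k _ => monic_X_sub_C (a k)]

lemma eval_eq_sum_rem {m : ℕ} (a : Fin m → ℝ) (p : ℝ[X]) (i : Fin m) :
    p.eval (a i) = ∑ k : Fin m, a i ^ (k : ℕ) * (p %ₘ rootPoly a).coeff k := by
  have h0 : (rootPoly a).eval (a i) = 0 := by
    rw [rootPoly, eval_prod]
    exact Finset.prod_eq_zero (Finset.mem_univ i) (by simp)
  have h1 : p.eval (a i) = (p %ₘ rootPoly a).eval (a i) := by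
    conv_lhs => rw [← modByMonic_add_div p (rootPoly a)]
    simp [h0]
  rcases Nat.eq_zero_or_pos m with rfl | hm
  · exact i.elim0
  have hd : (p %ₘ rootPoly a).natDegree < m := by
    have := natDegree_modByMonic_lt p (rootPoly_monic a) fun h => by
      have := rootPoly_natDegree a
      rw [h, natDegree_one] at this
      omega
    rwa [rootPoly_natDegree] at this
  rw [h1, eval_eq_sum_range' hd, Finset.sum_range]
  exact Finset.sum_congr rfl fun k _ => mul_comm _ _

lemma det_col_eval (g : ℝ[X]) {m : ℕ} (a : Fin m → ℝ) :
    Matrix.det (Matrix.of fun i j : Fin m => (col g j).eval (a i)) =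
      (Matrix.vandermonde a).det * detRem g m (rootPoly a) := by
  rw [detRem, ← Matrix.det_mul]
  congr 1
  ext i j
  simp only [Matrix.of_apply, Matrix.mul_apply, Matrix.vandermonde_apply]
  exact eval_eq_sum_rem a _ i

lemma det_of_row_zero {m : ℕ} (N : Matrix (Fin (m + 1)) (Fin (m + 1)) ℝ)
    (h : ∀ j : Fin m, N 0 j.succ = 0) : N.det = N 0 0 * (N.submatrix Fin.succ Fin.succ).det := by
  rw [Matrix.det_succ_row_zero, Fin.sum_univ_succ, Finset.sum_eq_zero fun j _ => by rw [h]; ring]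
  simp

lemma det_of_rows_zero {m : ℕ} (N : Matrix (Fin (m + 2)) (Fin (m + 2)) ℝ)
    (h0 : ∀ j : Fin m, N 0 j.succ.succ = 0) (h1 : ∀ j : Fin m, N 1 j.succ.succ = 0) :
    N.det = (N 0 0 * N 1 1 - N 0 1 * N 1 0) *
      (Matrix.of fun i j : Fin m => N i.succ.succ j.succ.succ).det := by
  rw [Matrix.det_succ_row_zero, Fin.sum_univ_succ, Fin.sum_univ_succ,
    Finset.sum_eq_zero fun j _ => by rw [h0]; ring]
  rw [det_of_row_zero _ fun j => by simpa using h1 j, det_of_row_zero _ fun j => by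
    simpa [Fin.succAbove, Fin.lt_def] using h1 j]
  have e : ((N.submatrix Fin.succ (Fin.succAbove 0)).submatrix Fin.succ Fin.succ) =
      Matrix.of fun i j : Fin m => N i.succ.succ j.succ.succ := by
    ext i j; simp
  have e' : ((N.submatrix Fin.succ (Fin.succAbove (Fin.succ 0))).submatrix Fin.succ Fin.succ) =
      Matrix.of fun i j : Fin m => N i.succ.succ j.succ.succ := by
    ext i j; simp [Fin.succAbove, Fin.lt_def]
  rw [e, e']
  simp
  ring

lemma det_col_pair (g : ℝ[X]) {m : ℕ} (a : Fin m → ℝ) {b c : ℝ}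
    (h : cubic.eval b = cubic.eval c) :
    Matrix.det (Matrix.of fun i j : Fin (m + 2) =>
      (col g j).eval ((Fin.cons b (Fin.cons c a) : Fin (m + 2) → ℝ) i)) =
      (g.eval c - g.eval b) * (∏ k, (cubic.eval (a k) - cubic.eval b)) *
        Matrix.det (Matrix.of fun i j : Fin m => (col g j).eval (a i)) := by
  set t := cubic.eval b with ht
  set A : Matrix (Fin (m + 2)) (Fin (m + 2)) ℝ := Matrix.of fun i j : Fin (m + 2) =>
      (col g j).eval ((Fin.cons b (Fin.cons c a) : Fin (m + 2) → ℝ) i) with hA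
  set U : Matrix (Fin (m + 2)) (Fin (m + 2)) ℝ := Matrix.of fun i j =>
    if i = j then 1 else if (i : ℕ) + 2 = j then -t else 0 with hU
  have hdU : U.det = 1 := by
    rw [Matrix.det_of_isUpperTriangular]
    · simp [hU]
    · intro i j hij
      have hij' : j < i := hij
      simp only [hU, Matrix.of_apply]
      rw [if_neg hij'.ne', if_neg]
      have : (j : ℕ) < i := hij'
      omega
  have hcol : ∀ j, col g (j + 2) = cubic * col g j := by
    intro j
    rw [col, col, show (j + 2) / 2 = j / 2 + 1 by omega, Nat.add_mod_right]
    ring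
  have e0 : ∀ i, (A * U) i 0 = 1 := by
    intro i
    rw [Matrix.mul_apply, Finset.sum_eq_single 0]
    · simp [hA, hU, col]
    · intro k _ hk
      simp [hU, hk]
    · simp
  have e1 : ∀ i, (A * U) i 1 = g.eval ((Fin.cons b (Fin.cons c a) : Fin (m + 2) → ℝ) i) := by
    intro i
    rw [Matrix.mul_apply, Finset.sum_eq_single 1]
    · simp [hA, hU, col]
    · intro k _ hk
      simp [hU, hk]
    · simp
  have e2 : ∀ i (j : Fin m), (A * U) i j.succ.succ =
      (cubic.eval ((Fin.cons b (Fin.cons c a) : Fin (m + 2) → ℝ) i) - t) *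
        (col g j).eval ((Fin.cons b (Fin.cons c a) : Fin (m + 2) → ℝ) i) := by
    intro i j
    rw [Matrix.mul_apply, ← Finset.add_sum_erase _ _ (Finset.mem_univ j.succ.succ),
      Finset.sum_eq_single j.castSucc.castSucc]
    · have hne : j.castSucc.castSucc ≠ j.succ.succ := by
        intro h; have := congrArg Fin.val h; simp at this; omega
      simp only [hA, hU, Matrix.of_apply, if_true, Fin.val_succ, Fin.val_castSucc, if_neg hne]
      rw [show (j : ℕ) + 1 + 1 = j + 2 by ring, hcol, eval_mul]
      ring
    · intro k hk hk'
      have h1 : k ≠ j.succ.succ := (Finset.mem_erase.1 hk).1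
      simp only [hU, Matrix.of_apply, if_neg h1]
      rw [if_neg, mul_zero]
      intro h2
      apply hk'
      ext
      simp at h2 ⊢
      omega
    · intro hk
      exfalso
      apply hk
      simp only [Finset.mem_erase, Finset.mem_univ, and_true]
      intro h; have := congrArg Fin.val h; simp at this; omega
  rw [← mul_one A.det, ← hdU, ← Matrix.det_mul]
  rw [det_of_rows_zero _ (fun j => by rw [e2]; simp [ht]) (fun j => by
    rw [e2, show (1 : Fin (m + 2)) = Fin.succ 0 from rfl, Fin.cons_succ, Fin.cons_zero, ← h]
    ring), e0, e0, e1, e1]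
  have key : (Matrix.of fun i j : Fin m => (A * U) i.succ.succ j.succ.succ).det =
      (∏ k, (cubic.eval (a k) - t)) *
        Matrix.det (Matrix.of fun i j : Fin m => (col g j).eval (a i)) := by
    rw [← Matrix.det_mul_column]
    congr 1
    ext i j
    simp only [Matrix.of_apply, e2, Fin.cons_succ]
  rw [key, show (1 : Fin (m + 2)) = Fin.succ 0 from rfl, Fin.cons_succ, Fin.cons_zero,
    Fin.cons_zero]
  ring

end XXZOverlap

namespace XXZOverlap

open Polynomial

lemma exists_rem_coeff (p : ℝ[X]) (m i : ℕ) : ∃ P : MvPolynomial (Fin m) ℝ,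
    ∀ a : Fin m → ℝ, (p %ₘ rootPoly a).coeff i = MvPolynomial.eval a P := by
  refine ⟨((p.map MvPolynomial.C) %ₘ ∏ k : Fin m, (X - C (MvPolynomial.X k))).coeff i,
    fun a => ?_⟩
  rw [← coeff_map, map_modByMonic _ (monic_prod_of_monic _ _ fun k _ => monic_X_sub_C _),
    Polynomial.map_map, Polynomial.map_prod]
  have h : (MvPolynomial.eval a).comp MvPolynomial.C = RingHom.id ℝ := by
    ext r; simp
  rw [h, Polynomial.map_id]
  simp [rootPoly]

lemma exists_detRem (g : ℝ[X]) (m : ℕ) : ∃ P : MvPolynomial (Fin m) ℝ,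
    ∀ a : Fin m → ℝ, detRem g m (rootPoly a) = MvPolynomial.eval a P := by
  choose P hP using fun i j : Fin m => exists_rem_coeff (col g j) m i
  refine ⟨(Matrix.of P).det, fun a => ?_⟩
  rw [RingHom.map_det, detRem]
  congr 1
  ext i j
  simp [hP]

lemma detRem_zero (g : ℝ[X]) (m : ℕ) : detRem g m (rootPoly (0 : Fin m → ℝ)) =
    Matrix.det (Matrix.of fun i j : Fin m => (col g j).coeff i) := by
  rw [detRem]
  congr 1
  ext i j
  have h : rootPoly (0 : Fin m → ℝ) = X ^ m := by simp [rootPoly]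
  have := modByMonic_add_div (col g j) (X ^ m : ℝ[X])
  rw [Matrix.of_apply, Matrix.of_apply, h]
  conv_rhs => rw [← this]
  simp [coeff_X_pow_mul', i.2]

lemma det_vandermonde_cons {m : ℕ} (t : ℝ) (a : Fin m → ℝ) :
    (Matrix.vandermonde (Fin.cons t a : Fin (m + 1) → ℝ)).det =
      (∏ k, (a k - t)) * (Matrix.vandermonde a).det := by
  rw [Matrix.det_vandermonde, Matrix.det_vandermonde, Fin.prod_univ_succ, Fin.prod_Ioi_zero]
  simp

lemma exists_detRem_cons (g : ℝ[X]) {m k e : ℕ} (hm : m + 1 = 2 * k) (hg : g.natDegree ≤ e)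
    (he : 1 ≤ e) {a : Fin m → ℝ} (ha : Function.Injective a) :
    ∃ q : ℝ[X], q.natDegree + 2 ≤ k + e ∧
      ∀ t, detRem g (m + 1) (rootPoly (Fin.cons t a : Fin (m + 1) → ℝ)) = q.eval t := by
  obtain ⟨P, hP⟩ := exists_detRem g (m + 1)
  set q : ℝ[X] := MvPolynomial.aeval (Fin.cons X (fun i => C (a i)) : Fin (m + 1) → ℝ[X]) P
    with hq
  have hqt : ∀ t, detRem g (m + 1) (rootPoly (Fin.cons t a : Fin (m + 1) → ℝ)) = q.eval t := by
    intro t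
    rw [hP, hq, ← Polynomial.coe_evalRingHom, MvPolynomial.aeval_def, MvPolynomial.eval₂_eq',
      MvPolynomial.eval_eq', map_sum]
    refine Finset.sum_congr rfl fun d _ => ?_
    simp [Fin.prod_univ_succ, eval_prod]
  refine ⟨q, ?_, hqt⟩
  have hV : (Matrix.vandermonde a).det ≠ 0 := Matrix.det_vandermonde_ne_zero_iff.2 ha
  set Q : ℝ[X] := ∑ j : Fin (m + 1), col g j * C ((-1) ^ (j : ℕ) *
    ((Matrix.of fun i j : Fin (m + 1) => (col g j).eval
      ((Fin.cons 0 a : Fin (m + 1) → ℝ) i)).submatrix Fin.succ (Fin.succAbove j)).det) with hQ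
  have hdeg : Q.natDegree ≤ 3 * (k - 1) + e := by
    refine natDegree_sum_le_of_forall_le _ _ fun j _ => ?_
    refine (natDegree_mul_C_le _ _).trans ?_
    rw [col]
    refine natDegree_mul_le.trans ?_
    have h1 : (cubic ^ ((j : ℕ) / 2)).natDegree ≤ ((j : ℕ) / 2) * 3 :=
      natDegree_pow_le_of_le _ (by rw [cubic]; compute_degree)
    have h2 : (g ^ ((j : ℕ) % 2)).natDegree ≤ ((j : ℕ) % 2) * e :=
      natDegree_pow_le_of_le _ hg
    have h3 := j.2
    have h4 : ((j : ℕ) % 2) * e ≤ 1 * e := Nat.mul_le_mul_right _ (by omega)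
    omega
  have hQe : Q = C (Matrix.vandermonde a).det * rootPoly a * (C ((-1) ^ m) * q) := by
    apply Polynomial.funext
    intro t
    have h1 := det_col_eval g (Fin.cons t a : Fin (m + 1) → ℝ)
    rw [det_vandermonde_cons, hqt] at h1
    have h2 : ∏ k, (a k - t) = (-1) ^ m * (rootPoly a).eval t := by
      rw [rootPoly, eval_prod]
      simp only [eval_sub, eval_X, eval_C]
      rw [← Finset.prod_congr rfl fun k _ => neg_sub t (a k), Finset.prod_neg]
      simp
    rw [h2] at h1
    have h3 : Q.eval t = Matrix.det (Matrix.of fun i j : Fin (m + 1) =>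
        (col g j).eval ((Fin.cons t a : Fin (m + 1) → ℝ) i)) := by
      rw [hQ, eval_finsetSum, Matrix.det_succ_row_zero]
      refine Finset.sum_congr rfl fun j _ => ?_
      rw [eval_mul, eval_C]
      have : ∀ s : ℝ, (Matrix.of fun i j : Fin (m + 1) => (col g j).eval
          ((Fin.cons s a : Fin (m + 1) → ℝ) i)).submatrix Fin.succ (Fin.succAbove j) =
          Matrix.of fun (i : Fin m) (l : Fin m) => (col g (Fin.succAbove j l)).eval (a i) := by
        intro s; ext i l; simp
      rw [this, this]
      simp
      ring
    rw [h3, h1]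
    simp
    ring
  by_cases hq0 : q = 0
  · rw [hq0]; simp; omega
  have hC : C (Matrix.vandermonde a).det ≠ 0 := by simpa using hV
  have h1 : (C ((-1) ^ m) * q : ℝ[X]) ≠ 0 := mul_ne_zero (by simp) hq0
  have := congrArg natDegree hQe
  rw [natDegree_mul (mul_ne_zero hC (rootPoly_monic a).ne_zero) h1,
    natDegree_mul hC (rootPoly_monic a).ne_zero, rootPoly_natDegree,
    natDegree_mul (by simp) hq0] at this
  simp only [natDegree_C, zero_add] at this
  have h0 : (C ((-1 : ℝ) ^ m)).natDegree = 0 := natDegree_C _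
  omega

lemma detRem_pair (g : ℝ[X]) {m : ℕ} {a : Fin m → ℝ} (ha : Function.Injective a) {b c : ℝ}
    (hbc : b ≠ c) (h : cubic.eval b = cubic.eval c) (hb : ∀ k, a k ≠ b) (hc : ∀ k, a k ≠ c) :
    detRem g (m + 2) (rootPoly (Fin.cons b (Fin.cons c a) : Fin (m + 2) → ℝ)) * (c - b) =
      (g.eval c - g.eval b) * (∏ k, (a k + 6 + b + c)) * detRem g m (rootPoly a) := by
  have h1 := det_col_pair g a h
  rw [det_col_eval, det_col_eval, det_vandermonde_cons, det_vandermonde_cons,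
    Fin.prod_univ_succ] at h1
  simp only [Fin.cons_zero, Fin.cons_succ] at h1
  have hV : (Matrix.vandermonde a).det ≠ 0 := Matrix.det_vandermonde_ne_zero_iff.2 ha
  have hb' : ∏ k, (a k - b) ≠ 0 := Finset.prod_ne_zero_iff.2 fun k _ => sub_ne_zero.2 (hb k)
  have hc' : ∏ k, (a k - c) ≠ 0 := Finset.prod_ne_zero_iff.2 fun k _ => sub_ne_zero.2 (hc k)
  have hroot : b ^ 2 + b * c + c ^ 2 + 6 * (b + c) + 9 = 0 := by
    simp only [cubic, eval_mul, eval_X, eval_pow, eval_add, eval_C] at h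
    apply mul_left_cancel₀ (sub_ne_zero.2 hbc)
    linear_combination h
  have hp : ∏ k, (cubic.eval (a k) - cubic.eval b) =
      (∏ k, (a k - b)) * (∏ k, (a k - c)) * ∏ k, (a k + 6 + b + c) := by
    rw [← Finset.prod_mul_distrib, ← Finset.prod_mul_distrib]
    refine Finset.prod_congr rfl fun k _ => ?_
    simp only [cubic, eval_mul, eval_X, eval_pow, eval_add, eval_C]
    linear_combination (a k - b) * hroot
  rw [hp] at h1
  apply mul_left_cancel₀ (mul_ne_zero (mul_ne_zero hV hb') hc')
  linear_combination h1

/-- `detRem` for the polynomial whose roots are listed. -/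
def ratio (g : ℝ[X]) (L : List ℝ) : ℝ := detRem g L.length (L.map fun a => X - C a).prod

lemma ratio_perm (g : ℝ[X]) {L L' : List ℝ} (h : L.Perm L') : ratio g L = ratio g L' := by
  rw [ratio, ratio, h.length_eq, (h.map _).prod_eq]

lemma prod_eq_rootPoly (L : List ℝ) : (L.map fun a => X - C a).prod = rootPoly L.get := by
  rw [rootPoly, ← List.prod_ofFn]
  congr 1
  conv_lhs => rw [← List.ofFn_get L, List.map_ofFn]
  rfl

lemma ratio_eq (g : ℝ[X]) (L : List ℝ) : ratio g L = detRem g L.length (rootPoly L.get) := by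
  rw [ratio, prod_eq_rootPoly]

lemma ratio_cons (g : ℝ[X]) (t : ℝ) (L : List ℝ) : ratio g (t :: L) =
    detRem g (L.length + 1) (rootPoly (Fin.cons t L.get : Fin (L.length + 1) → ℝ)) := by
  rw [ratio, List.map_cons, List.prod_cons, prod_eq_rootPoly]
  simp [rootPoly, Fin.prod_univ_succ]

lemma exists_ratio_poly (g : ℝ[X]) {k e : ℕ} {L : List ℝ} (hm : L.length + 1 = 2 * k)
    (hg : g.natDegree ≤ e) (he : 1 ≤ e) (hL : L.Nodup) :
    ∃ q : ℝ[X], q.natDegree + 2 ≤ k + e ∧ ∀ t, ratio g (t :: L) = q.eval t := by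
  simp only [ratio_cons]
  exact exists_detRem_cons g hm hg he hL.injective_get

lemma ratio_pair (g : ℝ[X]) {L : List ℝ} (hL : L.Nodup) {b c : ℝ} (hbc : b ≠ c)
    (h : cubic.eval b = cubic.eval c) (hb : b ∉ L) (hc : c ∉ L) :
    ratio g (b :: c :: L) * (c - b) =
      (g.eval c - g.eval b) * (L.map fun a => a + 6 + b + c).prod * ratio g L := by
  have h1 := detRem_pair g hL.injective_get hbc h (fun k e => hb (e ▸ L.get_mem k))
    (fun k e => hc (e ▸ L.get_mem k))
  have e : (L.map fun a => a + 6 + b + c).prod = ∏ k, (L.get k + 6 + b + c) := by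
    rw [← List.prod_ofFn]
    congr 1
    conv_lhs => rw [← List.ofFn_get L, List.map_ofFn]
    rfl
  rw [e, ratio_eq g L, ← h1, ratio, List.map_cons, List.prod_cons, List.map_cons, List.prod_cons,
    prod_eq_rootPoly]
  simp [rootPoly, Fin.prod_univ_succ]

end XXZOverlap

namespace XXZOverlap

open MvPolynomial

variable {x : ℝ} {n : ℕ}

lemma exists_bil_poly {n n2 m d : ℕ} {G : List Bool → List ℝ → ℝ} {lv rv : List ℝ}
    (hn2 : 1 ≤ n2) (hn : 1 ≤ n) (hm : lv.length + (rv.length + 1) = m) (hN : (lv ++ rv).Nodup)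
    (hd : 2 * n + 2 * n2 ≤ d + 2)
    (hG : ∀ (l : List Bool) (b : Bool) (r : List Bool), l.length = lv.length →
      r.length = rv.length → ∃ q : Polynomial ℝ,
      q.natDegree ≤ 2 * n - (if b then 1 else 2) ∧
        ∀ t, G (l ++ b :: r) (lv ++ t :: rv) = q.eval t) :
    ∃ q : Polynomial ℝ, q.natDegree ≤ d ∧
      ∀ t, bil m G (psi x n2) (lv ++ t :: rv) = q.eval t := by
  refine exists_sumW_poly fun β hβ => ?_
  obtain ⟨l, b, r, rfl, hl, hr⟩ : ∃ l b r, β = l ++ b :: r ∧ l.length = lv.length ∧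
      r.length = rv.length := by
    obtain ⟨l, r', rfl, hl, hr'⟩ := exists_append_of_length (hβ.trans hm.symm)
    obtain ⟨b, r, rfl⟩ := List.exists_cons_of_length_eq_add_one hr'
    exact ⟨l, b, r, rfl, hl, by simpa using hr'⟩
  obtain ⟨q1, d1, e1⟩ := hG l b r hl hr
  obtain ⟨q2, d2, e2⟩ := exists_psi_poly x n2 (l := l) (r := r)
    (lv := lv.map Neg.neg) (rv := rv.map Neg.neg) (by simp [hl]) (by simp [hr])
    (by rw [← List.map_append]; exact hN.map neg_injective) b
  refine ⟨(if b then 1 else 1 + Polynomial.C 3 * Polynomial.X ^ 2) *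
    Polynomial.C (wt l lv * wt r rv) * q1 * q2.comp (-Polynomial.X), ?_, fun t => ?_⟩
  · have h0 : (if b then 1 else 1 + Polynomial.C 3 * Polynomial.X ^ 2 :
        Polynomial ℝ).natDegree ≤ if b then 0 else 2 := by
      cases b
      · simp only [Bool.false_eq_true, if_false]; compute_degree
      · simp
    have h1 : (q2.comp (-Polynomial.X)).natDegree ≤ q2.natDegree := by
      refine Polynomial.natDegree_comp_le.trans ?_
      simp
    refine Polynomial.natDegree_mul_le.trans ?_
    have h2 := Polynomial.natDegree_mul_le (p := (if b then 1 else 1 + Polynomial.C 3 *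
      Polynomial.X ^ 2 : Polynomial ℝ) * Polynomial.C (wt l lv * wt r rv)) (q := q1)
    have h3 := Polynomial.natDegree_mul_C_le (if b then 1 else 1 + Polynomial.C 3 *
      Polynomial.X ^ 2 : Polynomial ℝ) (wt l lv * wt r rv)
    cases b <;> simp only [Bool.false_eq_true, if_false, if_true] at * <;> omega
  · rw [wt_append hl, wt, e1, List.map_append, List.map_cons, e2]
    cases b
    · simp [-mul_eq_mul_right_iff, -mul_eq_mul_left_iff]
      ring
    · simp [-mul_eq_mul_right_iff, -mul_eq_mul_left_iff]

lemma exists_F_poly_right {n1 n2 : ℕ} {L1 lv rv : List ℝ} (hn : 1 ≤ n2)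
    (h1 : L1.length = 2 * n1) (h2 : lv.length + (rv.length + 1) = 2 * n2)
    (hN : (L1 ++ (lv ++ rv)).Nodup) :
    ∃ q : Polynomial ℝ, q.natDegree ≤ 2 * (n1 + n2) + 2 * n2 - 2 ∧
      ∀ t, F x n1 n2 L1 (lv ++ t :: rv) = q.eval t := by
  simp only [F_eq_right]
  refine exists_sumW_poly fun α hα => ?_
  obtain ⟨q, d, e⟩ := exists_bil_poly (x := x) (n := n1 + n2)
    (G := fun β B => psi x (n1 + n2) (α ++ β) (L1 ++ B)) (d := 2 * (n1 + n2) + 2 * n2 - 2)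
    hn (by omega) h2 (List.nodup_append.1 hN).2.1 (by omega) fun l b r hl hr => by
      have := exists_psi_poly x (n1 + n2) (l := α ++ l) (r := r) (lv := L1 ++ lv) (rv := rv)
        (by simp [hα, hl, h1]) hr (by simpa using hN) b
      simpa using this
  refine ⟨Polynomial.C (wt α L1 * psi x n1 α (L1.map Neg.neg)) * q,
    (Polynomial.natDegree_C_mul_le _ _).trans d, fun t => ?_⟩
  rw [e, Polynomial.eval_mul, Polynomial.eval_C]

lemma exists_F_poly_left {n1 n2 : ℕ} {L2 lv rv : List ℝ} (hn : 1 ≤ n1)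
    (h1 : L2.length = 2 * n2) (h2 : lv.length + (rv.length + 1) = 2 * n1)
    (hN : ((lv ++ rv) ++ L2).Nodup) :
    ∃ q : Polynomial ℝ, q.natDegree ≤ 2 * (n1 + n2) + 2 * n1 - 2 ∧
      ∀ t, F x n1 n2 (lv ++ t :: rv) L2 = q.eval t := by
  simp only [F_eq_left]
  refine exists_sumW_poly fun β hβ => ?_
  obtain ⟨q, d, e⟩ := exists_bil_poly (x := x) (n := n1 + n2)
    (G := fun α A => psi x (n1 + n2) (α ++ β) (A ++ L2)) (d := 2 * (n1 + n2) + 2 * n1 - 2)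
    hn (by omega) h2 (List.nodup_append.1 hN).1 (by omega) fun l b r hl hr => by
      have := exists_psi_poly x (n1 + n2) (l := l) (r := r ++ β) (lv := lv) (rv := rv ++ L2)
        hl (by simp [hβ, hr, h1]) (by simpa using hN) b
      simpa using this
  refine ⟨Polynomial.C (wt β L2 * psi x n2 β (L2.map Neg.neg)) * q,
    (Polynomial.natDegree_C_mul_le _ _).trans d, fun t => ?_⟩
  rw [e, Polynomial.eval_mul, Polynomial.eval_C]

end XXZOverlap

namespace XXZOverlap

open MvPolynomial

variable {x : ℝ} {n : ℕ}

/-- A radius below which no exchange or reflection factor vanishes. -/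
structure Radius (x δ : ℝ) : Prop where
  pos : 0 < δ
  le : δ ≤ 1 / 5
  left : ∀ v, |v| < δ → 1 - (2 * x - 1) ^ 2 * v ^ 2 ≠ 0
  right : ∀ v, |v| < δ → 1 - (2 / x - 1) ^ 2 * v ^ 2 ≠ 0

lemma exists_radius (x : ℝ) : ∃ δ, Radius x δ := by
  have key : ∀ c d v : ℝ, 0 ≤ d → |v| < 1 / (5 * (1 + |c| + d)) → 1 - c ^ 2 * v ^ 2 ≠ 0 := by
    intro c d v hd hv
    have h0 := abs_nonneg c
    rw [lt_div_iff₀ (by positivity)] at hv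
    have h1 : |c * v| < 1 := by
      rw [abs_mul]
      nlinarith [abs_nonneg v, mul_nonneg h0 (abs_nonneg v), mul_nonneg (abs_nonneg v) hd]
    have := (sq_lt_one_iff_abs_lt_one (c * v)).2 h1
    rw [← mul_pow]
    linarith
  refine ⟨1 / (5 * (1 + |2 * x - 1| + |2 / x - 1|)), by positivity, ?_, ?_, ?_⟩
  · apply one_div_le_one_div_of_le (by norm_num)
    nlinarith [abs_nonneg (2 * x - 1), abs_nonneg (2 / x - 1)]
  · intro v hv
    exact key _ _ v (abs_nonneg _) hv
  · intro v hv
    refine key _ _ v (abs_nonneg (2 * x - 1)) (hv.trans_eq ?_)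
    ring

/-- The symmetries of the overlap as a function of one of the two groups of variables. -/
structure Sym (δ : ℝ) (m d : ℕ) (B : List ℝ) (Φ : List ℝ → ℝ) : Prop where
  perm : ∀ {M M' : List ℝ}, M.Perm M' → (∀ a ∈ M, |a| < δ) → M.length = m → Φ M = Φ M'
  flip : ∀ {v : ℝ} {M : List ℝ}, |v| < δ → (∀ a ∈ M, |a| < δ) → M.length + 1 = m →
    Φ (-v :: M) = Φ (v :: M)
  poly : ∀ {lv rv : List ℝ}, lv.length + (rv.length + 1) = m → (B ++ (lv ++ rv)).Nodup →
    ∃ q : Polynomial ℝ, q.natDegree ≤ d ∧ ∀ t, Φ (lv ++ t :: rv) = q.eval t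

lemma D_ne_zero_of_abs {δ v w : ℝ} (h : δ ≤ 1 / 5) (hv : |v| < δ) (hw : |w| < δ) : D v w ≠ 0 :=
  (D_pos (hv.trans_le h) (hw.trans_le h)).ne'

lemma perm_of_swap {δ : ℝ} {m : ℕ} {Φ : List ℝ → ℝ}
    (h : ∀ {lv rv : List ℝ} {v w : ℝ}, |v| < δ → |w| < δ → m = lv.length + (rv.length + 2) →
      Φ (lv ++ v :: w :: rv) = Φ (lv ++ w :: v :: rv))
    {M M' : List ℝ} (hM : M.Perm M') (hs : ∀ a ∈ M, |a| < δ) (hl : M.length = m) : Φ M = Φ M' := by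
  suffices H : ∀ lv : List ℝ, lv.length + M.length = m → Φ (lv ++ M) = Φ (lv ++ M') by
    simpa using H [] (by simpa using hl)
  clear hl
  induction hM with
  | nil => intros; rfl
  | cons a _ ih =>
    intro lv hlv
    simpa using ih (fun b hb => hs b (List.mem_cons_of_mem _ hb)) (lv ++ [a])
      (by simp at hlv ⊢; omega)
  | swap a b l =>
    intro lv hlv
    exact h (hs _ (by simp)) (hs _ (by simp)) (by simpa using hlv.symm)
  | trans h1 _ ih1 ih2 =>
    intro lv hlv
    rw [ih1 hs lv hlv, ih2 (fun a ha => hs a (h1.mem_iff.2 ha)) lv (h1.length_eq ▸ hlv)]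

lemma sym_right {δ : ℝ} (hx : 0 < x) (hδ : Radius x δ) {n1 n2 : ℕ} (hn : 1 ≤ n2) {L1 : List ℝ}
    (h1 : L1.length = 2 * n1) :
    Sym δ (2 * n2) (2 * (n1 + n2) + 2 * n2 - 2) L1 (F x n1 n2 L1) := by
  have hp : ∀ {M M' : List ℝ}, M.Perm M' → (∀ a ∈ M, |a| < δ) → M.length = 2 * n2 →
      F x n1 n2 L1 M = F x n1 n2 L1 M' := perm_of_swap fun hv hw hm =>
    F_swap_right h1 hm (D_ne_zero_of_abs hδ.le hv hw) (D_ne_zero_of_abs hδ.le hw hv)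
  refine ⟨hp, ?_, fun hl hN => exists_F_poly_right hn h1 hl hN⟩
  intro v M hv hM hl
  rw [hp (List.perm_append_singleton (-v) M).symm (by simpa [hv] using hM) (by simpa using hl),
    hp (List.perm_append_singleton v M).symm (by simpa [hv] using hM) (by simpa using hl),
    F_even_right hx h1 hl (hδ.right v hv)]

lemma sym_left {δ : ℝ} (hδ : Radius x δ) {n1 n2 : ℕ} (hn : 1 ≤ n1) {L2 : List ℝ}
    (h2 : L2.length = 2 * n2) :
    Sym δ (2 * n1) (2 * (n1 + n2) + 2 * n1 - 2) L2 (fun L => F x n1 n2 L L2) := by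
  refine ⟨perm_of_swap (Φ := fun L => F x n1 n2 L L2) fun hv hw hm =>
    F_swap_left h2 hm (D_ne_zero_of_abs hδ.le hv hw) (D_ne_zero_of_abs hδ.le hw hv), ?_,
    fun hl hN => exists_F_poly_left hn h2 hl (List.nodup_append_comm.1 hN)⟩
  intro v M hv _ hl
  exact F_even_left hl h2 (hδ.left v hv)

lemma poly_eq_of_small {δ : ℝ} (hδ : 0 < δ) {q q' : Polynomial ℝ}
    (h : ∀ t, |t| < δ → q.eval t = q'.eval t) : q = q' := by
  refine Polynomial.eq_of_infinite_eval_eq _ _ ((Set.Ioo_infinite hδ).mono fun t ht => ?_)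
  exact h t (by rw [abs_of_pos ht.1]; exact ht.2)

section

variable {δ : ℝ} {m d : ℕ} {B : List ℝ} {Φ : List ℝ → ℝ}

lemma Sym.flip_head (h : Sym δ m d B Φ) (hδ : 0 < δ) {M : List ℝ} (hM : ∀ a ∈ M, |a| < δ)
    (hl : M.length + 1 = m) (hN : (B ++ M).Nodup) (t : ℝ) : Φ (-t :: M) = Φ (t :: M) := by
  obtain ⟨q, -, e⟩ := h.poly (lv := []) (rv := M) (by simpa using hl) hN
  simp only [List.nil_append] at e
  have : q.comp (-Polynomial.X) = q := poly_eq_of_small hδ fun t ht => by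
    have := h.flip ht hM hl
    rw [e, e] at this
    simpa using this
  rw [e, e]
  conv_rhs => rw [← this]
  simp

lemma Sym.flip_second (h : Sym δ m d B Φ) (hδ : 0 < δ) {M : List ℝ} {s : ℝ} (hs : |s| < δ)
    (hM : ∀ a ∈ M, |a| < δ) (hl : M.length + 2 = m) (hN : (B ++ s :: M).Nodup)
    (hN' : (B ++ -s :: M).Nodup) (t : ℝ) : Φ (t :: -s :: M) = Φ (t :: s :: M) := by
  obtain ⟨q, -, e⟩ := h.poly (lv := []) (rv := s :: M) (by simpa using hl) hN
  obtain ⟨q', -, e'⟩ := h.poly (lv := []) (rv := -s :: M) (by simpa using hl) hN'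
  simp only [List.nil_append] at e e'
  have : q' = q := poly_eq_of_small hδ fun t ht => by
    have hsm : ∀ u, |u| < δ → ∀ a ∈ t :: u :: M, |a| < δ := by
      intro u hu
      simpa [hu, ht] using hM
    rw [← e, ← e', h.perm (List.Perm.swap _ _ _) (hsm _ (by simpa using hs)) (by simpa using hl),
      h.perm (List.Perm.swap s t M) (hsm _ hs) (by simpa using hl)]
    exact h.flip hs (by simpa [ht] using hM) (by simpa using hl)
  rw [e, e', this]

lemma Sym.swap_head (h : Sym δ m d B Φ) (hδ : 0 < δ) {M : List ℝ} {s : ℝ} (hs : |s| < δ)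
    (hM : ∀ a ∈ M, |a| < δ) (hl : M.length + 2 = m) (hN : (B ++ s :: M).Nodup) (t : ℝ) :
    Φ (t :: s :: M) = Φ (s :: t :: M) := by
  obtain ⟨q, -, e⟩ := h.poly (lv := []) (rv := s :: M) (by simpa using hl) hN
  obtain ⟨q', -, e'⟩ := h.poly (lv := [s]) (rv := M) (by simp; omega) (by simpa using hN)
  simp only [List.nil_append, List.cons_append] at e e'
  have : q' = q := poly_eq_of_small hδ fun t ht => by
    rw [← e, ← e']
    exact h.perm (List.Perm.swap _ _ _) (by simpa [ht, hs] using hM) (by simpa using hl)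
  rw [e, e', this]

lemma Sym.reduce (h : Sym δ m d B Φ) (hδ : 0 < δ) {M : List ℝ} {s : ℝ} (hs : |s| < δ)
    (hM : ∀ a ∈ M, |a| < δ) (hl : M.length + 2 = m) (hN : (B ++ s :: M).Nodup)
    (hN' : (B ++ -s :: M).Nodup) {t w p : ℝ} (ht : t = w ∨ t = -w) (hp : p = s ∨ p = -s) :
    Φ (t :: s :: M) = Φ (p :: w :: M) := by
  have e1 : Φ (t :: s :: M) = Φ (w :: s :: M) := by
    rcases ht with rfl | rfl
    · rfl
    · exact h.flip_head hδ (by simpa [hs] using hM) (by simpa using hl) hN w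
  rw [e1]
  rcases hp with rfl | rfl
  · exact h.swap_head hδ hs hM hl hN w
  · rw [← h.flip_second hδ hs hM hl hN hN']
    exact h.swap_head hδ (by simpa using hs) hM hl hN' w

end

end XXZOverlap

namespace XXZOverlap

variable {x : ℝ}

/-- The variable in which the inhomogeneous overlap factorizes. -/
def al (v : ℝ) : ℝ := 4 / (1 + 3 * v ^ 2) - 4

/-- The quadratic polynomial carrying the dependence on the boundary parameter. -/
def gG (x : ℝ) : Polynomial ℝ :=
  Polynomial.C (3 * x ^ 2 + 3) * Polynomial.X + Polynomial.C (x ^ 2 - x + 1) * Polynomial.X ^ 2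

/-- The product of the powers `(1 + 3 s²) ^ e`. -/
def PP (e : ℕ) (L : List ℝ) : ℝ := (L.map fun s => (1 + 3 * s ^ 2) ^ e).prod

lemma PP_cons (e : ℕ) (s : ℝ) (L : List ℝ) : PP e (s :: L) = (1 + 3 * s ^ 2) ^ e * PP e L := by
  simp [PP]

lemma PP_pos (e : ℕ) (L : List ℝ) : 0 < PP e L := by
  induction L with
  | nil => simp [PP]
  | cons s L ih => rw [PP_cons]; positivity

lemma PP_add (e f : ℕ) (L : List ℝ) : PP (e + f) L = PP e L * PP f L := by
  induction L with
  | nil => simp [PP]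
  | cons s L ih => rw [PP_cons, PP_cons, PP_cons, ih, pow_add]; ring

/-- The normalization constant. -/
def cc (n1 n2 : ℕ) : ℝ :=
  1 / (3 ^ (n1 + n2) * 9 ^ ((n1 + n2).choose 2 + n1.choose 2 + n2.choose 2))

lemma cc_succ (n1 n2 : ℕ) : cc n1 (n2 + 1) * (3 * 9 ^ (n1 + n2 + n2)) = cc n1 n2 := by
  have : ∀ k : ℕ, (k + 1).choose 2 = k.choose 2 + k := by
    intro k
    rw [Nat.choose_succ_succ' k 1, Nat.choose_one_right, add_comm]
  rw [cc, cc, ← add_assoc, this, this]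
  field_simp
  ring

/-- The factorized form of the inhomogeneous overlap. -/
def R (x : ℝ) (n1 n2 : ℕ) (L1 L2 : List ℝ) : ℝ :=
  cc n1 n2 * (PP (n1 + n2 + n1) L1 / PP 1 L1) * (PP (n1 + n2 + n2) L2 / PP 1 L2) *
    ratio Polynomial.X (L1.map al) * ratio Polynomial.X (L2.map al) *
      ratio (gG x) ((L1 ++ L2).map al)

lemma R_comm (x : ℝ) (n1 n2 : ℕ) (L1 L2 : List ℝ) : R x n1 n2 L1 L2 = R x n2 n1 L2 L1 := by
  rw [R, R, ratio_perm (gG x) ((List.perm_append_comm (l₁ := L1) (l₂ := L2)).map al), cc, cc,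
    add_comm n1 n2, add_assoc ((n2 + n1).choose 2), add_comm (n1.choose 2), ← add_assoc]
  ring

lemma al_inj {v w : ℝ} (h : al v = al w) : v ^ 2 = w ^ 2 := by
  have hv : (0 : ℝ) < 1 + 3 * v ^ 2 := by positivity
  have hw : (0 : ℝ) < 1 + 3 * w ^ 2 := by positivity
  rw [al, al, sub_left_inj, div_eq_div_iff hv.ne' hw.ne'] at h
  linarith

lemma al_root {p w : ℝ} (hw : w * (1 - 3 * p) = 1 + p) :
    (1 + 3 * w ^ 2) * (1 - 3 * p) ^ 2 = 4 * (1 + 3 * p ^ 2) ∧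
      al w = (1 - 3 * p) ^ 2 / (1 + 3 * p ^ 2) - 4 := by
  have h1 : (1 + 3 * w ^ 2) * (1 - 3 * p) ^ 2 = 4 * (1 + 3 * p ^ 2) := by
    linear_combination 3 * (w * (1 - 3 * p) + (1 + p)) * hw
  refine ⟨h1, ?_⟩
  have hv : (0 : ℝ) < 1 + 3 * p ^ 2 := by positivity
  have hw : (0 : ℝ) < 1 + 3 * w ^ 2 := by positivity
  rw [al, sub_left_inj, div_eq_div_iff hw.ne' hv.ne']
  linear_combination -h1

lemma mP_eq {p w k : ℝ} (hw : w * (1 - 3 * p) = 1 + p) :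
    9 ⁻¹ * (3 * (1 + 3 * p ^ 2)) * ((1 + 3 * k ^ 2) * (al k + 6 + al w + al p)) = mP p k := by
  rw [(al_root hw).2, al, al, mP]
  have hv : (0 : ℝ) < 1 + 3 * p ^ 2 := by positivity
  have hw : (0 : ℝ) < 1 + 3 * k ^ 2 := by positivity
  field_simp
  ring

lemma prod_mP {p w : ℝ} (hw : w * (1 - 3 * p) = 1 + p) (L : List ℝ) :
    (L.map (mP p)).prod = (9⁻¹ * (3 * (1 + 3 * p ^ 2))) ^ L.length *
      (PP 1 L * ((L.map al).map fun a => a + 6 + al w + al p).prod) := by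
  induction L with
  | nil => simp [PP]
  | cons k L ih =>
    rw [List.map_cons, List.prod_cons, ih, PP_cons, ← mP_eq hw]
    simp only [List.map_cons, List.prod_cons, List.length_cons, pow_succ]
    ring

lemma kap_neg {p w : ℝ} (hp : 1 - 3 * p ≠ 0) (hw : w * (1 - 3 * p) = 1 + p) {n : ℕ} {L : List ℝ}
    (hL : L.length = 2 * n) : kap x (-w) n (L.map Neg.neg) =
      (1 + (2 * x - 1) * w) * (4 / (1 - 3 * p) ^ 2) ^ n * (L.map (mP p)).prod := by
  have h3 : (1 - 3 * -w) * (1 - 3 * p) = 4 := by linear_combination 3 * hw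
  have hw0 : 1 - 3 * -w ≠ 0 := fun h => by rw [h] at h3; norm_num at h3
  have h1 : 2 / (1 - 3 * -w) = (1 - 3 * p) / 2 := by
    rw [div_eq_div_iff hw0 two_ne_zero]; linarith
  have h2 : ((L.map Neg.neg).map (mP (-w))).prod =
      (4 / (1 - 3 * p) ^ 2) ^ L.length * (L.map (mP p)).prod := by
    clear hL
    induction L with
    | nil => simp
    | cons k L ih =>
      simp only [List.map_cons, List.prod_cons, ih, List.length_cons, pow_succ]
      have : mP (-w) (-k) = 4 / (1 - 3 * p) ^ 2 * mP p k := by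
        rw [div_mul_eq_mul_div, eq_div_iff (pow_ne_zero 2 hp), mP, mP]
        have e1 : (1 + w) * (1 - 3 * p) = 2 * (1 - p) := by linear_combination hw
        have e2 : (1 - 3 * w) * (1 - 3 * p) = -2 * (1 + 3 * p) := by linear_combination -3 * hw
        linear_combination ((1 + w) * (1 - 3 * p) + 2 * (1 - p)) * e1 -
          k ^ 2 * ((1 - 3 * w) * (1 - 3 * p) - 2 * (1 + 3 * p)) * e2
      rw [this]; ring
  rw [kap, h1, h2, hL, pow_mul, pow_mul]
  have h4 : (((1 - 3 * p) / 2) ^ 2) ^ n * ((4 / (1 - 3 * p) ^ 2) ^ 2) ^ n =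
      (4 / (1 - 3 * p) ^ 2) ^ n := by
    rw [← mul_pow]
    congr 1
    field_simp
    norm_num
  rw [← h4]
  ring

lemma R_pair {n1 n2 : ℕ} {L1 L2 : List ℝ} {δ s p w : ℝ} (hδ : δ ≤ 1 / 5)
    (hl1 : L1.length = 2 * n1) (hl2 : L2.length = 2 * n2) (hG : GenL δ (s :: (L1 ++ L2)))
    (hps : p = s ∨ p = -s) (hw : w * (1 - 3 * p) = 1 + p) :
    R x n1 (n2 + 1) L1 (w :: s :: L2) =
      D w p * kap x p (n1 + n2) (L1 ++ L2) * kap x (-w) n2 (L2.map Neg.neg) * R x n1 n2 L1 L2 := by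
  have hs := hG.2 s (by simp)
  have hsq : s ^ 2 = p ^ 2 := by rcases hps with rfl | rfl <;> ring
  have hals : al s = al p := by rw [al, al, hsq]
  have hpb : -(1 / 5) < p ∧ p < 1 / 5 := by
    rcases hps with rfl | rfl <;> constructor <;> linarith
  have hp : 1 - 3 * p ≠ 0 := by linarith [hpb.1]
  have hw5 : 1 / 5 < w := by
    by_contra! h
    nlinarith
  have hPpos : (0 : ℝ) < 1 + 3 * p ^ 2 := by positivity
  have hsmall : ∀ k ∈ s :: (L1 ++ L2), al k ≠ al w := by
    intro k hk h
    have := al_inj h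
    have hk' := hG.2 k hk
    nlinarith
  have hnd : ((s :: (L1 ++ L2)).map al).Nodup := by
    refine hG.1.map_on fun a ha b hb h => ?_
    have h1 := al_inj h
    exact (sq_eq_sq₀ (hG.2 a ha).1.le (hG.2 b hb).1.le).1 h1
  have hne : al w ≠ al p := by rw [← hals]; exact (hsmall s (by simp)).symm
  have hcub : (cubic.eval (al w)) = cubic.eval (al p) := by
    simp only [cubic, Polynomial.eval_mul, Polynomial.eval_pow, Polynomial.eval_add,
      Polynomial.eval_X, Polynomial.eval_C]
    rw [(al_root hw).2, al]
    field_simp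
    ring
  rw [List.map_cons, List.nodup_cons] at hnd
  have hpair : ∀ (g : Polynomial ℝ) (A : List ℝ), A.Sublist (L1 ++ L2) →
      ratio g (al w :: al p :: A.map al) * (al p - al w) = (g.eval (al p) - g.eval (al w)) *
        ((A.map al).map fun a => a + 6 + al w + al p).prod * ratio g (A.map al) := by
    intro g A hA
    refine ratio_pair g (hnd.2.sublist (hA.map al)) hne hcub ?_ ?_
    · intro h
      obtain ⟨k, hk, e⟩ := List.mem_map.1 h
      exact hsmall k (by simp [-List.mem_append, hA.subset hk]) e
    · intro h
      exact hnd.1 (hals ▸ (hA.map al).subset h)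
  have hX := hpair Polynomial.X L2 (List.sublist_append_right _ _)
  have hGG := hpair (gG x) (L1 ++ L2) (List.Sublist.refl _)
  have hne' : al p - al w ≠ 0 := sub_ne_zero.2 hne.symm
  have eX : ratio Polynomial.X (al w :: al p :: L2.map al) =
      ((L2.map al).map fun a => a + 6 + al w + al p).prod * ratio Polynomial.X (L2.map al) := by
    simp only [Polynomial.eval_X] at hX
    apply mul_right_cancel₀ hne'
    linear_combination hX
  have eG : ratio (gG x) (al w :: al p :: (L1 ++ L2).map al) =
      (3 * x ^ 2 + 3 + (x ^ 2 - x + 1) * (al p + al w)) *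
        (((L1 ++ L2).map al).map fun a => a + 6 + al w + al p).prod *
          ratio (gG x) ((L1 ++ L2).map al) := by
    simp only [gG, Polynomial.eval_add, Polynomial.eval_mul, Polynomial.eval_C,
      Polynomial.eval_pow, Polynomial.eval_X] at hGG
    apply mul_right_cancel₀ hne'
    rw [gG]
    linear_combination hGG
  have hperm : ((L1 ++ w :: s :: L2).map al).Perm (al w :: al p :: (L1 ++ L2).map al) := by
    rw [← hals]
    refine (List.Perm.map al ?_ : List.Perm _ ((w :: s :: (L1 ++ L2)).map al))
    exact List.perm_middle.trans (List.Perm.cons _ List.perm_middle)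
  rw [R, R, ratio_perm _ hperm, eG, List.map_cons, List.map_cons, hals, eX, kap, kap_neg hp hw hl2,
    ← cc_succ n1 n2]
  simp only [List.map_append, List.prod_append, PP_cons, hsq]
  rw [prod_mP hw L1, prod_mP hw L2, hl1, hl2,
    show n1 + (n2 + 1) + n1 = n1 + n2 + n1 + 1 by ring,
    show n1 + (n2 + 1) + (n2 + 1) = n1 + n2 + n2 + 1 + 1 by ring, PP_add _ 1 L1, PP_add _ 1 L2,
    PP_add _ 1 L2]
  have hscal : D w p * (1 - (2 * x - 1) * p) * (1 + (2 * x - 1) * w) * 3 =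
      (1 + 3 * w ^ 2) * (1 + 3 * p ^ 2) * (3 * x ^ 2 + 3 + (x ^ 2 - x + 1) * (al p + al w)) := by
    have hwe : w = (1 + p) / (1 - 3 * p) := by rw [eq_div_iff hp]; exact hw
    rw [(al_root hw).2, al, hwe, D]
    field_simp
    ring
  have hW : 1 + 3 * w ^ 2 = 4 / (1 - 3 * p) ^ 2 * (1 + 3 * p ^ 2) := by
    have := (al_root hw).1
    field_simp
    linarith
  have h2 : (2 / (1 - 3 * p)) ^ (2 * (n1 + n2)) = (4 / (1 - 3 * p) ^ 2) ^ (n1 + n2) := by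
    rw [pow_mul]; congr 1; rw [div_pow]; norm_num
  have hWpos : (0 : ℝ) < 1 + 3 * w ^ 2 := by positivity
  have hp1 := (PP_pos 1 L1).ne'
  have hp2 := (PP_pos 1 L2).ne'
  rw [h2]
  set r := 4 / (1 - 3 * p) ^ 2 with hr
  set W := 1 + 3 * w ^ 2 with hWd
  set P := 1 + 3 * p ^ 2 with hP
  have hpw : (W * P) ^ (n1 + n2 + n2) = (r ^ (n1 + n2) * r ^ n2) *
      ((9⁻¹ * (3 * P)) ^ (2 * n1) * (9⁻¹ * (3 * P)) ^ (2 * n2) * (9⁻¹ * (3 * P)) ^ (2 * n2)) *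
        9 ^ (n1 + n2 + n2) := by
    have : ∀ k : ℕ, (9⁻¹ * (3 * P)) ^ (2 * k) = (P ^ 2) ^ k * (9⁻¹) ^ k := by
      intro k
      rw [pow_mul, ← mul_pow]; congr 1; ring
    rw [this, this, hW]
    have h9 : (9 : ℝ)⁻¹ ^ (n1 + n2 + n2) * 9 ^ (n1 + n2 + n2) = 1 := by
      rw [← mul_pow]; norm_num
    simp only [pow_add] at h9 ⊢
    simp only [mul_pow, ← pow_mul]
    linear_combination (-(r ^ n1 * r ^ n2 * r ^ n2 * (P ^ (2 * n1) * P ^ (2 * n2) *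
      P ^ (2 * n2)))) * h9
  have hq : ∀ e : ℕ, W ^ (e + 1 + 1) * (P ^ (e + 1 + 1) * (PP e L2 * PP 1 L2 * PP 1 L2)) /
      (W ^ 1 * (P ^ 1 * PP 1 L2)) = (W * P) ^ e * (W * P) * PP e L2 * PP 1 L2 := by
    intro e
    rw [mul_pow]
    field_simp
    ring
  have hq' : ∀ e : ℕ, PP e L1 * PP 1 L1 / PP 1 L1 = PP e L1 := fun e => by field_simp
  have hq2 : PP (n1 + n2 + n1) L1 = PP (n1 + n2 + n1) L1 / PP 1 L1 * PP 1 L1 := by field_simp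
  have hq3 : PP (n1 + n2 + n2) L2 = PP (n1 + n2 + n2) L2 / PP 1 L2 * PP 1 L2 := by field_simp
  rw [hq, hq', hpw]
  generalize PP (n1 + n2 + n1) L1 / PP 1 L1 = a1 at *
  generalize PP (n1 + n2 + n2) L2 / PP 1 L2 = a2 at *
  rw [hq2, hq3]
  linear_combination (-(cc n1 (n2 + 1) * (a1 * PP 1 L1) *
    (r ^ (n1 + n2) * r ^ n2 *
      ((9⁻¹ * (3 * P)) ^ (2 * n1) * (9⁻¹ * (3 * P)) ^ (2 * n2) * (9⁻¹ * (3 * P)) ^ (2 * n2)) *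
        9 ^ (n1 + n2 + n2)) * (a2 * PP 1 L2) * PP 1 L2 *
    ratio Polynomial.X (L1.map al) * ratio Polynomial.X (L2.map al) *
    ((L2.map al).map fun a => a + 6 + al w + al p).prod *
    (((L1.map al).map fun a => a + 6 + al w + al p).prod *
      ((L2.map al).map fun a => a + 6 + al w + al p).prod) *
    ratio (gG x) (L1.map al ++ L2.map al))) * hscal

end XXZOverlap

namespace XXZOverlap

open Polynomial

variable {x : ℝ}

lemma exists_al_poly (q : ℝ[X]) {d : ℕ} (hq : q.natDegree ≤ d) :
    ∃ r : ℝ[X], r.natDegree ≤ 2 * d ∧ ∀ t, (1 + 3 * t ^ 2) ^ d * q.eval (al t) = r.eval t := by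
  have h2 : (X ^ 2 : ℝ[X]).natDegree = 2 := natDegree_X_pow 2
  have hA : (C (-12) * X ^ 2 : ℝ[X]).natDegree ≤ 2 := (natDegree_C_mul_le _ _).trans h2.le
  have hB : (1 + C 3 * X ^ 2 : ℝ[X]).natDegree ≤ 2 :=
    natDegree_add_le_of_degree_le (by simp) ((natDegree_C_mul_le _ _).trans h2.le)
  refine ⟨∑ k ∈ Finset.range (d + 1), C (q.coeff k) * (C (-12) * X ^ 2) ^ k *
    (1 + C 3 * X ^ 2) ^ (d - k), natDegree_sum_le_of_forall_le _ _ fun k hk => ?_, fun t => ?_⟩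
  · have hk' : k ≤ d := Nat.lt_succ_iff.1 (Finset.mem_range.1 hk)
    refine natDegree_mul_le.trans ((add_le_add ((natDegree_C_mul_le _ _).trans
      (natDegree_pow_le.trans (Nat.mul_le_mul_left k hA)))
      (natDegree_pow_le.trans (Nat.mul_le_mul_left (d - k) hB))).trans ?_)
    omega
  · rw [eval_eq_sum_range' (Nat.lt_succ_iff.2 hq), Finset.mul_sum, eval_finsetSum]
    refine Finset.sum_congr rfl fun k hk => ?_
    have hk' : k ≤ d := Nat.lt_succ_iff.1 (Finset.mem_range.1 hk)
    have ht : (0 : ℝ) < 1 + 3 * t ^ 2 := by positivity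
    have e : (1 + 3 * t ^ 2) * al t = -12 * t ^ 2 := by
      rw [al]; field_simp; ring
    simp only [eval_mul, eval_C, eval_pow, eval_add, eval_one, eval_X]
    rw [← e, mul_pow]
    conv_lhs => rw [← Nat.add_sub_of_le hk', pow_add]
    ring

lemma nodup_al {δ : ℝ} {L : List ℝ} (h : GenL δ L) : (L.map al).Nodup :=
  h.1.map_on fun a ha b hb e => (sq_eq_sq₀ (h.2 a ha).1.le (h.2 b hb).1.le).1 (al_inj e)

lemma exists_R_poly {δ : ℝ} {n1 n2 : ℕ} {L M : List ℝ} (h1 : L.length = 2 * n1)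
    (h2 : M.length + 1 = 2 * n2) (hG : GenL δ (L ++ M)) :
    ∃ r : ℝ[X], r.natDegree ≤ 2 * (n1 + n2) + 2 * n2 - 2 ∧
      ∀ t, R x n1 n2 L (t :: M) = r.eval t := by
  have hN := nodup_al (hG.perm List.perm_append_comm)
  rw [List.map_append] at hN
  have hg : (gG x).natDegree ≤ 2 := by
    unfold gG
    compute_degree
  obtain ⟨qS, dS, eS⟩ := exists_ratio_poly Polynomial.X (L := M.map al) (k := n2) (e := 1)
    (by simpa using h2) (by simp) le_rfl hN.of_append_left
  obtain ⟨qG, dG, eG⟩ := exists_ratio_poly (gG x) (L := M.map al ++ L.map al) (k := n1 + n2)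
    (e := 2) (by simp; omega) hg (by norm_num) hN
  obtain ⟨r, hr, er⟩ := exists_al_poly (qS * qG) (d := n1 + n2 + n2 - 1)
    (natDegree_mul_le.trans (by omega))
  refine ⟨C (cc n1 n2 * (PP (n1 + n2 + n1) L / PP 1 L) * (PP (n1 + n2 + n2) M / PP 1 M) *
    ratio Polynomial.X (L.map al)) * r, (natDegree_C_mul_le _ _).trans (hr.trans (by omega)),
    fun t => ?_⟩
  have hp : ((L ++ t :: M).map al).Perm (al t :: (M.map al ++ L.map al)) := by
    rw [← List.map_append]
    exact (List.perm_append_comm (l₁ := L) (l₂ := t :: M)).map al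
  have ht : (0 : ℝ) < 1 + 3 * t ^ 2 := by positivity
  rw [R, ratio_perm _ hp, List.map_cons, eS, eG, eval_mul, eval_C, ← er, eval_mul, PP_cons, PP_cons]
  obtain ⟨e, he⟩ : ∃ e, n1 + n2 + n2 = e + 1 := ⟨n1 + n2 + n2 - 1, by omega⟩
  rw [he, Nat.add_sub_cancel, pow_succ]
  have := (PP_pos 1 M).ne'
  field_simp

lemma exists_points {δ : ℝ} (hδ : δ ≤ 1 / 5) {M : List ℝ} (hM : GenL δ M) :
    ∃ S : Finset ℝ, S.card = 4 * M.length ∧ ∀ t ∈ S, ∃ s ∈ M, ∃ p w : ℝ,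
      (p = s ∨ p = -s) ∧ w * (1 - 3 * p) = 1 + p ∧ (t = w ∨ t = -w) := by
  set f : ℝ → ℝ := fun p => (1 + p) / (1 - 3 * p) with hf
  have hfb : ∀ p, |p| < 1 / 5 → 0 < f p ∧ f p * (1 - 3 * p) = 1 + p := by
    intro p hp
    rw [abs_lt] at hp
    have : 0 < 1 - 3 * p := by linarith
    exact ⟨div_pos (by linarith) this, div_mul_cancel₀ _ this.ne'⟩
  have hinj : ∀ p q, |p| < 1 / 5 → |q| < 1 / 5 → f p = f q → p = q := by
    intro p q hp hq h
    have h1 := (hfb p hp).2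
    have h2 := (hfb q hq).2
    have h3 := (hfb q hq).1
    rw [h] at h1
    have : (p - q) * (1 + 3 * f q) = 0 := by linear_combination h2 - h1
    rcases mul_eq_zero.1 this with h | h
    · linarith
    · linarith
  have hsm : ∀ s ∈ M, |s| < 1 / 5 := fun s hs => by
    rw [abs_of_pos (hM.2 s hs).1]; linarith [(hM.2 s hs).2]
  have hN : (M ++ M.map Neg.neg).Nodup := by
    refine List.Nodup.append hM.1 (hM.1.map neg_injective) fun a ha hb => ?_
    obtain ⟨b, hb', rfl⟩ := List.mem_map.1 hb
    linarith [(hM.2 _ ha).1, (hM.2 _ hb').1]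
  have hmem : ∀ p ∈ M ++ M.map Neg.neg, |p| < 1 / 5 ∧ ∃ s ∈ M, p = s ∨ p = -s := by
    intro p hp
    rcases List.mem_append.1 hp with h | h
    · exact ⟨hsm p h, p, h, Or.inl rfl⟩
    · obtain ⟨s, hs, rfl⟩ := List.mem_map.1 h
      exact ⟨by rw [abs_neg]; exact hsm s hs, s, hs, Or.inr rfl⟩
  set A := (M ++ M.map Neg.neg).map f with hA
  have hNA : A.Nodup := hN.map_on fun a ha b hb e => hinj a b (hmem a ha).1 (hmem b hb).1 e
  have hposA : ∀ a ∈ A, 0 < a := by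
    intro a ha
    obtain ⟨p, hp, rfl⟩ := List.mem_map.1 ha
    exact (hfb p (hmem p hp).1).1
  have hNB : (A ++ A.map Neg.neg).Nodup := by
    refine List.Nodup.append hNA (hNA.map neg_injective) fun a ha hb => ?_
    obtain ⟨b, hb', rfl⟩ := List.mem_map.1 hb
    linarith [hposA _ ha, hposA _ hb']
  refine ⟨(A ++ A.map Neg.neg).toFinset, ?_, fun t ht => ?_⟩
  · rw [List.toFinset_card_of_nodup hNB]
    simp [hA]
    ring
  · rw [List.mem_toFinset] at ht
    obtain ⟨a, ha, hta⟩ : ∃ a ∈ A, t = a ∨ t = -a := by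
      rcases List.mem_append.1 ht with h | h
      · exact ⟨t, h, Or.inl rfl⟩
      · obtain ⟨a, ha, rfl⟩ := List.mem_map.1 h
        exact ⟨a, ha, Or.inr rfl⟩
    obtain ⟨p, hp, rfl⟩ := List.mem_map.1 ha
    obtain ⟨hp5, s, hs, hps⟩ := hmem p hp
    exact ⟨s, hs, p, f p, hps, (hfb p hp5).2, hta⟩

lemma Sym.perm_tail {δ : ℝ} {m d : ℕ} {B : List ℝ} {Φ : List ℝ → ℝ} (h : Sym δ m d B Φ)
    (hδ : 0 < δ) {M M' : List ℝ} (hM : ∀ a ∈ M, |a| < δ) (hl : M.length + 1 = m)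
    (hN : (B ++ M).Nodup) (hp : M.Perm M') (t : ℝ) : Φ (t :: M) = Φ (t :: M') := by
  obtain ⟨q, -, e⟩ := h.poly (lv := []) (rv := M) (by simpa using hl) hN
  obtain ⟨q', -, e'⟩ := h.poly (lv := []) (rv := M') (by simp [← hl, hp.length_eq])
    ((hp.append_left B).nodup_iff.1 hN)
  simp only [List.nil_append] at e e'
  have : q' = q := poly_eq_of_small hδ fun t ht => by
    rw [← e, ← e']
    exact (h.perm (hp.cons t) (by simpa [ht] using hM) (by simpa using hl)).symm
  rw [e, e', this]

/-- Two functions of the head variable agree as soon as they agree at the reduction points and at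
the points of an extra finite set. -/
lemma Sym.interpolate {δ : ℝ} {x : ℝ} (hδ : Radius x δ) {m d : ℕ} {B : List ℝ}
    {Φ : List ℝ → ℝ} (h : Sym δ m d B Φ) {M : List ℝ} (hG : GenL δ (B ++ M))
    (hl : M.length + 1 = m) {Ψ : ℝ → ℝ} (hΨ : ∃ r : ℝ[X], r.natDegree ≤ d ∧ ∀ t, Ψ t = r.eval t)
    (hpt : ∀ s M', M.Perm (s :: M') → ∀ p w t : ℝ, (p = s ∨ p = -s) →
      w * (1 - 3 * p) = 1 + p → (t = w ∨ t = -w) → Φ (p :: w :: M') = Ψ t)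
    (E : Finset ℝ) (hE : ∀ t ∈ E, Φ (t :: M) = Ψ t)
    (hE' : ∀ t ∈ E, ∀ s ∈ M, ∀ p w : ℝ, (p = s ∨ p = -s) → w * (1 - 3 * p) = 1 + p →
      t ≠ w ∧ t ≠ -w)
    (hd : d < 4 * M.length + E.card) (t : ℝ) : Φ (t :: M) = Ψ t := by
  have hGM : GenL δ M := ⟨hG.1.of_append_right, fun a ha => hG.2 a (by simp [ha])⟩
  have habs : ∀ a ∈ M, |a| < δ := fun a ha => by
    rw [abs_of_pos (hGM.2 a ha).1]; exact (hGM.2 a ha).2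
  obtain ⟨q, hq, eq⟩ := h.poly (lv := []) (rv := M) (by simpa using hl) hG.1
  obtain ⟨r, hr, er⟩ := hΨ
  obtain ⟨S, hS, hSp⟩ := exists_points hδ.le hGM
  simp only [List.nil_append] at eq
  have hdisj : Disjoint S E := by
    rw [Finset.disjoint_left]
    intro u hu hu'
    obtain ⟨s, hs, p, w, hp, hw, ht⟩ := hSp u hu
    have := hE' u hu' s hs p w hp hw
    tauto
  have key : q = r := by
    refine eq_of_natDegree_lt_card_of_eval_eq' q r (S ∪ E) (fun u hu => ?_) ?_
    · rw [← eq, ← er]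
      rcases Finset.mem_union.1 hu with hu | hu
      · obtain ⟨s, hs, p, w, hp, hw, ht⟩ := hSp u hu
        obtain ⟨M', hM'⟩ : ∃ M', M.Perm (s :: M') := ⟨_, List.perm_cons_erase hs⟩
        have hG' : GenL δ (B ++ s :: M') := hG.perm (hM'.append_left B)
        have hs' : s ∈ B ++ s :: M' := by simp
        have hN' : (B ++ -s :: M').Nodup := by
          refine List.nodup_middle.2 (List.nodup_cons.2 ⟨fun hm => ?_,
            (List.nodup_cons.1 (List.nodup_middle.1 hG'.1)).2⟩)
          have h1 := (hG'.2 (-s) (by simp at hm ⊢; tauto)).1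
          have h2 := (hG'.2 s hs').1
          linarith
        have hl' := hM'.length_eq
        rw [List.length_cons] at hl'
        rw [h.perm_tail hδ.pos habs hl hG.1 hM' u, ← hpt s M' hM' p w u hp hw ht]
        refine h.reduce hδ.pos (habs s hs) (fun a ha => habs a (hM'.mem_iff.2 (by simp [ha])))
          (by omega) hG'.1 hN' ht hp
      · exact hE u hu
    · rw [Finset.card_union_of_disjoint hdisj, hS]
      omega
  rw [eq, er, key]

end XXZOverlap

namespace XXZOverlap

variable {x : ℝ}

lemma R_congr {n1 n2 : ℕ} {L M M' : List ℝ} {t w : ℝ} (h : t = w ∨ t = -w) (hM : M.Perm M') :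
    R x n1 n2 L (t :: M) = R x n1 n2 L (w :: M') := by
  have hsq : t ^ 2 = w ^ 2 := by rcases h with rfl | rfl <;> ring
  have hPP : ∀ e, PP e M = PP e M' := fun e => (hM.map _).prod_eq
  have hal : al t = al w := by rw [al, al, hsq]
  have hp : ((L ++ t :: M).map al).Perm ((L ++ w :: M').map al) := by
    rw [List.map_append, List.map_append, List.map_cons, List.map_cons, hal]
    exact ((hM.map al).cons _).append_left _
  rw [R, R, ratio_perm _ hp, PP_cons, PP_cons, PP_cons, PP_cons, hPP, hPP, hsq, List.map_cons,
    List.map_cons, hal, ratio_perm _ ((hM.map al).cons (al w))]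

lemma genL_small {δ p s : ℝ} {A B : List ℝ} (hδ : δ ≤ 1 / 5) (hG : GenL δ (A ++ s :: B))
    (hps : p = s ∨ p = -s) : 1 - 3 * p ≠ 0 ∧ (∀ u ∈ A ++ B, D p u ≠ 0 ∧ D u p ≠ 0) ∧ p ∉ B ∧
      GenL δ (s :: (A ++ B)) := by
  have hs := hG.2 s (by simp)
  have hG' : GenL δ (s :: (A ++ B)) := hG.perm List.perm_middle
  have hp : |p| < δ := by
    rcases hps with rfl | rfl
    · rw [abs_of_pos hs.1]; exact hs.2
    · rw [abs_neg, abs_of_pos hs.1]; exact hs.2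
  refine ⟨?_, fun u hu => ?_, fun hB => ?_, hG'⟩
  · have := abs_lt.1 hp
    intro h
    linarith [this.2]
  · have hu' := hG'.2 u (List.mem_cons_of_mem _ hu)
    have hu'' : |u| < δ := by rw [abs_of_pos hu'.1]; exact hu'.2
    exact ⟨D_ne_zero_of_abs hδ hp hu'', D_ne_zero_of_abs hδ hu'' hp⟩
  · rcases hps with rfl | rfl
    · exact (List.nodup_cons.1 hG'.1).1 (by simp [hB])
    · linarith [(hG'.2 (-s) (by simp [hB])).1]

lemma F_eq_R_right {δ : ℝ} (hx : 0 < x) (hδ : Radius x δ) {n1 n2 : ℕ}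
    (ih : ∀ L1 L2 : List ℝ, L1.length = 2 * n1 → L2.length = 2 * n2 → GenL δ (L1 ++ L2) →
      F x n1 n2 L1 L2 = R x n1 n2 L1 L2) {L M : List ℝ} (h1 : L.length = 2 * n1)
    (h2 : M.length + 1 = 2 * (n2 + 1)) (hG : GenL δ (L ++ M)) (E : Finset ℝ)
    (hE : ∀ t ∈ E, F x n1 (n2 + 1) L (t :: M) = R x n1 (n2 + 1) L (t :: M))
    (hE' : ∀ t ∈ E, ∀ s ∈ M, ∀ p w : ℝ, (p = s ∨ p = -s) → w * (1 - 3 * p) = 1 + p →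
      t ≠ w ∧ t ≠ -w)
    (hd : 2 * n1 < 4 * n2 + 2 + E.card) (t : ℝ) :
    F x n1 (n2 + 1) L (t :: M) = R x n1 (n2 + 1) L (t :: M) := by
  refine (sym_right hx hδ (by omega) h1).interpolate hδ (Ψ := fun t => R x n1 (n2 + 1) L (t :: M))
    hG h2 (exists_R_poly h1 h2 hG) ?_ E hE hE' (by omega) t
  intro s M' hM p w t hps hw ht
  have hl : M'.length = 2 * n2 := by
    have := hM.length_eq
    simp at this
    omega
  obtain ⟨g1, g2, g3, g4⟩ := genL_small hδ.le (hG.perm (hM.append_left L)) hps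
  have hG' : GenL δ (L ++ M') := ⟨(List.nodup_cons.1 g4.1).2, fun a ha => g4.2 a (by simp_all)⟩
  rw [F_pair_right h1 hl g1 hw g2 g3 hG'.1, ih L M' h1 hl hG', ← R_pair hδ.le h1 hl g4 hps hw]
  exact (R_congr ht hM).symm

lemma F_eq_R_left {δ : ℝ} (hδ : Radius x δ) {n1 n2 : ℕ}
    (ih : ∀ L1 L2 : List ℝ, L1.length = 2 * n1 → L2.length = 2 * n2 → GenL δ (L1 ++ L2) →
      F x n1 n2 L1 L2 = R x n1 n2 L1 L2) {L M : List ℝ} (h1 : L.length = 2 * n2)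
    (h2 : M.length + 1 = 2 * (n1 + 1)) (hG : GenL δ (L ++ M)) (hd : n2 < 2 * n1 + 1) (t : ℝ) :
    F x (n1 + 1) n2 (t :: M) L = R x (n1 + 1) n2 (t :: M) L := by
  rw [R_comm]
  refine (sym_left hδ (by omega) h1).interpolate hδ (Ψ := fun t => R x n2 (n1 + 1) L (t :: M))
    hG h2 ?_ ?_ ∅ (by simp) (by simp) (by simp; omega) t
  · obtain ⟨r, hr, e⟩ := exists_R_poly (x := x) h1 h2 hG
    exact ⟨r, by omega, e⟩
  intro s M' hM p w t hps hw ht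
  have hl : M'.length = 2 * n1 := by
    have := hM.length_eq
    simp at this
    omega
  obtain ⟨g1, g2, g3, g4⟩ := genL_small hδ.le (hG.perm (hM.append_left L)) hps
  have hG' : GenL δ (L ++ M') := ⟨(List.nodup_cons.1 g4.1).2, fun a ha => g4.2 a (by simp_all)⟩
  have hG'' : GenL δ (M' ++ L) := hG'.perm List.perm_append_comm
  have e := F_pair_left (x := x) hl h1 g1 hw
    (fun u hu => g2 u (by simp at hu ⊢; tauto)) g3 hG''.1
  rw [e, ih M' L hl h1 hG'', R_congr ht hM, R_pair hδ.le h1 hl g4 hps hw, R_comm x n2 n1,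
    add_comm n2 n1, kap_perm x p (n1 + n2) (List.perm_append_comm (l₁ := L) (l₂ := M'))]

lemma psi_one_du (v w : ℝ) : psi x 1 [true, false] [v, w] = 1 - (2 * x - 1) * v := by
  have h := P_base x 1
  simp only [List.replicate_one, List.singleton_append] at h
  rw [psi, h]
  simp [base, seg, PL, PR, toV]

lemma psi_one_ud {v w : ℝ} (h : v ≠ w) : psi x 1 [false, true] [v, w] = x + (2 - x) * w := by
  have := psi_du (x := x) (n := 1) (l := []) (r := []) (lv := []) (rv := []) rfl v w
  simp only [List.nil_append, psi_one_du] at this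
  have h' : 2 * (v - w) ≠ 0 := mul_ne_zero two_ne_zero (sub_ne_zero.2 h)
  apply mul_left_cancel₀ h'
  rw [D] at this
  linear_combination this

lemma ratio_two (g : Polynomial ℝ) (u v : ℝ) :
    ratio g [u, v] * (v - u) = g.eval v - g.eval u := by
  have h := det_col_eval g ![u, v]
  have e : ratio g [u, v] = detRem g 2 (rootPoly ![u, v]) := by
    rw [ratio_eq]
    congr 1
  rw [e]
  simp [Matrix.det_fin_two, col, Matrix.vandermonde_apply] at h
  linarith

lemma F_one_one_cross {δ : ℝ} (hδ : δ ≤ 1 / 5) {a b s w : ℝ} (hG : GenL δ [a, b, s])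
    (hw : w * (1 - 3 * b) = 1 + b) : F x 1 1 [a, b] [w, s] = R x 1 1 [a, b] [w, s] := by
  have ha := hG.2 a (by simp)
  have hb := hG.2 b (by simp)
  have hs := hG.2 s (by simp)
  have hN := hG.1
  simp only [List.nodup_cons, List.mem_cons, List.not_mem_nil, or_false, not_or] at hN
  have hb0 : 1 - 3 * b ≠ 0 := by linarith [hb.2]
  have hw5 : 1 / 5 < w := by
    by_contra! h
    nlinarith
  have z : ∀ α L, ¬ (α.count true = 1 ∧ α.count false = 1) → psi x 1 α L = 0 := fun α L h =>
    psi_eq_zero h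
  have hD : ∀ u ∈ [a] ++ [s], D b u ≠ 0 ∧ D u b ≠ 0 := by
    have h5 : ∀ u, 0 < u → u < δ → D b u ≠ 0 ∧ D u b ≠ 0 := fun u h0 h1 =>
      ⟨D_ne_zero_of_abs hδ (by rw [abs_of_pos hb.1]; exact hb.2) (by rw [abs_of_pos h0]; exact h1),
        D_ne_zero_of_abs hδ (by rw [abs_of_pos h0]; exact h1) (by rw [abs_of_pos hb.1]; exact hb.2)⟩
    simp only [List.singleton_append, List.mem_cons, List.not_mem_nil, or_false]
    rintro u (rfl | rfl)
    · exact h5 _ ha.1 ha.2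
    · exact h5 _ hs.1 hs.2
  have e1 : ∀ c d e : Bool, psi x 2 [c, d, d, e] [a, b, w, s] = 0 := fun c d e =>
    psi_pair_eq (l := [c]) (r := [e]) (lv := [a]) (rv := [s]) rfl d hw
  have e2 : ∀ c e : Bool, psi x 2 [c, true, false, e] [a, b, w, s] =
      kap x b 1 [a, s] * psi x 1 [c, e] [a, s] := fun c e =>
    psi_pair (l := [c]) (r := [e]) (lv := [a]) (rv := [s]) rfl rfl hb0 hw hD (by simpa using hN.1.2)
  have e3 : ∀ c e : Bool, psi x 2 [c, false, true, e] [a, b, w, s] =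
      2 / (1 - 3 * b) * (kap x b 1 [a, s] * psi x 1 [c, e] [a, s]) := fun c e => by
    rw [← e2]
    exact psi_pair_ud (l := [c]) (r := [e]) (lv := [a]) (rv := [s]) rfl hb0 hw
  have hF : F x 1 1 [a, b] [w, s] = kap x b 1 [a, s] *
      (2 / (1 - 3 * b) * ((1 + 3 * b ^ 2) * (1 + 3 * s ^ 2)) * (1 - (2 * x - 1) * a) *
        (1 + (2 * x - 1) * a) * (1 + (2 * x - 1) * w) +
      (1 + 3 * a ^ 2) * (1 + 3 * w ^ 2) * (x + (2 - x) * s) * (x - (2 - x) * b) *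
        (x - (2 - x) * s)) := by
    have n1 : -a ≠ -b := fun h => hN.1.1 (neg_injective h)
    have n2 : -w ≠ -s := fun h => by have := neg_injective h; linarith
    simp only [F, sumW, wt, List.map_cons, List.map_nil, mul_one, List.cons_append,
      List.nil_append]
    rw [z [true, true], z [false, false] [-a, -b], z [false, false] [-w, -s]]
    · simp only [psi_one_du, psi_one_ud n1, psi_one_ud n2, psi_one_ud hN.1.2, one_add_one_eq_two,
        e1, e2, e3, z [true, true] _ (by simp), if_true]
      norm_num
      ring
    all_goals simp
  have hA : (0 : ℝ) < 1 + 3 * a ^ 2 := by positivity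
  have hB : (0 : ℝ) < 1 + 3 * b ^ 2 := by positivity
  have hS : (0 : ℝ) < 1 + 3 * s ^ 2 := by positivity
  have hW : (0 : ℝ) < 1 + 3 * w ^ 2 := by positivity
  have hW' := (al_root hw).1
  have hal : ∀ u v : ℝ, 0 < u → 0 < v → u ≠ v → al u ≠ al v := fun u v hu hv h e =>
    h ((sq_eq_sq₀ hu.le hv.le).1 (al_inj e))
  have h0w : 0 < w := by linarith
  have hXr : ∀ u v : ℝ, u ≠ v → ratio Polynomial.X [u, v] = 1 := by
    intro u v h
    have := ratio_two Polynomial.X u v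
    rw [Polynomial.eval_X, Polynomial.eval_X] at this
    exact mul_right_cancel₀ (sub_ne_zero.2 h.symm) (this.trans (one_mul _).symm)
  have hne : al w ≠ al b := hal _ _ h0w hb.1 (by linarith)
  have hnas : al a ≠ al s := hal _ _ ha.1 hs.1 hN.1.2
  have hg2 : ratio (gG x) [al a, al s] = 3 * x ^ 2 + 3 + (x ^ 2 - x + 1) * (al a + al s) := by
    have := ratio_two (gG x) (al a) (al s)
    simp only [gG, Polynomial.eval_add, Polynomial.eval_mul, Polynomial.eval_C,
      Polynomial.eval_pow, Polynomial.eval_X] at this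
    apply mul_right_cancel₀ (sub_ne_zero.2 hnas.symm)
    rw [gG]
    linear_combination this
  have hcub : cubic.eval (al w) = cubic.eval (al b) := by
    simp only [cubic, Polynomial.eval_mul, Polynomial.eval_pow, Polynomial.eval_add,
      Polynomial.eval_X, Polynomial.eval_C]
    rw [(al_root hw).2, al]
    field_simp
    ring
  have hg4 := ratio_pair (gG x) (L := [al a, al s]) (by simpa using hnas) hne hcub
    (by simp [hal _ _ h0w ha.1 (by linarith), hal _ _ h0w hs.1 (by linarith)])
    (by simp [hal _ _ hb.1 ha.1 (Ne.symm hN.1.1), hal _ _ hb.1 hs.1 hN.2.1])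
  have hg4' : ratio (gG x) [al w, al b, al a, al s] =
      (3 * x ^ 2 + 3 + (x ^ 2 - x + 1) * (al b + al w)) * ((al a + 6 + al w + al b) *
        (al s + 6 + al w + al b)) * ratio (gG x) [al a, al s] := by
    simp only [gG, Polynomial.eval_add, Polynomial.eval_mul, Polynomial.eval_C,
      Polynomial.eval_pow, Polynomial.eval_X, List.map_cons, List.map_nil, List.prod_cons,
      List.prod_nil, mul_one] at hg4
    apply mul_right_cancel₀ (sub_ne_zero.2 hne.symm)
    rw [gG]
    linear_combination hg4
  have hperm : [al a, al b, al w, al s].Perm [al w, al b, al a, al s] := by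
    refine (List.Perm.cons _ (List.Perm.swap _ _ _)).trans ((List.Perm.swap _ _ _).trans
      (List.Perm.cons _ (List.Perm.swap _ _ _)))
  rw [hF, R]
  simp only [List.map_cons, List.map_nil, List.cons_append, List.nil_append, PP_cons]
  rw [ratio_perm _ hperm, hg4', hg2, hXr _ _ (hal _ _ ha.1 hb.1 hN.1.1),
    hXr _ _ (hal _ _ h0w hs.1 (by linarith)), kap]
  simp only [List.map_cons, List.map_nil, List.prod_cons, List.prod_nil, ← mP_eq hw, cc, PP]
  have hscal : D w b * (1 - (2 * x - 1) * b) * (1 + (2 * x - 1) * w) * 3 =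
      (1 + 3 * w ^ 2) * (1 + 3 * b ^ 2) * (3 * x ^ 2 + 3 + (x ^ 2 - x + 1) * (al b + al w)) := by
    have hwe : w = (1 + b) / (1 - 3 * b) := by rw [eq_div_iff hb0]; exact hw
    rw [(al_root hw).2, al, hwe, D]
    field_simp
    ring
  have hkey : 3 * (2 / (1 - 3 * b) * ((1 + 3 * b ^ 2) * (1 + 3 * s ^ 2)) *
      (1 - (2 * x - 1) * a) * (1 + (2 * x - 1) * a) * (1 + (2 * x - 1) * w) +
      (1 + 3 * a ^ 2) * (1 + 3 * w ^ 2) * (x + (2 - x) * s) * (x - (2 - x) * b) *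
        (x - (2 - x) * s)) = D w b * (1 + (2 * x - 1) * w) * ((1 + 3 * a ^ 2) * (1 + 3 * s ^ 2) *
          (3 * x ^ 2 + 3 + (x ^ 2 - x + 1) * (al a + al s))) := by
    have hwe : w = (1 + b) / (1 - 3 * b) := by rw [eq_div_iff hb0]; exact hw
    rw [al, al, hwe, D]
    field_simp
    ring
  have hr : (2 / (1 - 3 * b)) ^ (2 * 1) * (1 + 3 * b ^ 2) = 1 + 3 * w ^ 2 := by
    have hwe : w = (1 + b) / (1 - 3 * b) := by rw [eq_div_iff hb0]; exact hw
    rw [mul_one, hwe]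
    field_simp
    ring
  rw [show (1 + 1 : ℕ).choose 2 = 1 from rfl, show (1 : ℕ).choose 2 = 0 from rfl]
  simp only [mul_one, pow_one]
  clear hF hcub hg4 hg4' hperm hg2 hXr
  generalize 2 / (1 - 3 * b) * ((1 + 3 * b ^ 2) * (1 + 3 * s ^ 2)) *
      (1 - (2 * x - 1) * a) * (1 + (2 * x - 1) * a) * (1 + (2 * x - 1) * w) +
      (1 + 3 * a ^ 2) * (1 + 3 * w ^ 2) * (x + (2 - x) * s) * (x - (2 - x) * b) *
        (x - (2 - x) * s) = Q at *
  have hdiv : ∀ u v : ℝ, 0 < u → 0 < v → u ^ (1 + 1 + 1) * v ^ (1 + 1 + 1) / (u * v) =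
      u ^ 2 * v ^ 2 := by
    intro u v hu hv
    field_simp
  rw [hdiv _ _ hA hB, hdiv _ _ hW hS]
  generalize 3 * x ^ 2 + 3 + (x ^ 2 - x + 1) * (al a + al s) = G at *
  generalize 3 * x ^ 2 + 3 + (x ^ 2 - x + 1) * (al b + al w) = H at *
  generalize al a + 6 + al w + al b = ka at *
  generalize al s + 6 + al w + al b = ks at *
  generalize (2 / (1 - 3 * b)) ^ (2 * 1) = r at *
  generalize 1 + 3 * a ^ 2 = A at *
  generalize 1 + 3 * b ^ 2 = B at *
  generalize 1 + 3 * s ^ 2 = S at *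
  generalize 1 + 3 * w ^ 2 = W at *
  rw [← hr] at hscal ⊢
  linear_combination ((1 - (2 * x - 1) * b) * r * B ^ 2 * A * S * ka * ks / 27) * hkey +
    (r * B ^ 2 * A ^ 2 * S ^ 2 * ka * ks * G / 81) * hscal

/-- The factorization of the inhomogeneous overlap. -/
theorem F_eq_R {δ : ℝ} (hx : 0 < x) (hδ : Radius x δ) (n : ℕ) : ∀ n1 n2 : ℕ, n1 + n2 = n →
    ∀ L1 L2 : List ℝ, L1.length = 2 * n1 → L2.length = 2 * n2 → GenL δ (L1 ++ L2) →
      F x n1 n2 L1 L2 = R x n1 n2 L1 L2 := by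
  induction n with
  | zero =>
    intro n1 n2 h L1 L2 h1 h2 _
    obtain ⟨rfl, rfl⟩ : n1 = 0 ∧ n2 = 0 := by omega
    obtain rfl := List.length_eq_zero_iff.1 h1
    obtain rfl := List.length_eq_zero_iff.1 h2
    have e : psi x 0 [] [] = 1 := by
      have := P_base x 0
      simp only [List.replicate_zero, List.append_nil] at this
      rw [psi, this]
      simp [base, seg, PL, PR]
    have hr : ∀ g : Polynomial ℝ, ratio g [] = 1 := fun g => Matrix.det_fin_zero
    simp [F, R, sumW, wt, cc, PP, hr, e]
  | succ n ih =>
    intro n1 n2 h L1 L2 h1 h2 hG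
    rcases le_or_gt n1 n2 with hle | hlt
    · obtain ⟨n2, rfl⟩ : ∃ k, n2 = k + 1 := ⟨n2 - 1, by omega⟩
      obtain ⟨t, M, rfl⟩ := List.exists_cons_of_length_pos (l := L2) (by omega)
      have hG' : GenL δ (L1 ++ M) :=
        have h' := hG.perm List.perm_middle
        ⟨(List.nodup_cons.1 h'.1).2, fun a ha => h'.2 a (List.mem_cons_of_mem _ ha)⟩
      by_cases h11 : n1 = 1 ∧ n2 = 0
      · obtain ⟨rfl, rfl⟩ := h11
        obtain ⟨a, b, rfl⟩ := List.length_eq_two.1 h1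
        obtain ⟨s, rfl⟩ := List.length_eq_one_iff.1 (by simpa using h2)
        have hb := hG'.2 b (by simp)
        have hs := hG'.2 s (by simp)
        have h5 := hδ.le
        have hb0 : 1 - 3 * b ≠ 0 := by linarith [hb.2]
        have hwb := div_mul_cancel₀ (1 + b) hb0
        have hbs : b ≠ s := by
          have := hG'.1
          simp at this
          tauto
        refine F_eq_R_right hx hδ (ih 1 0 (by omega)) h1 h2 hG' {(1 + b) / (1 - 3 * b)} ?_ ?_
          (by simp) t
        · simp only [Finset.mem_singleton, forall_eq]
          exact F_one_one_cross hδ.le hG' hwb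
        · simp only [Finset.mem_singleton, forall_eq, List.mem_singleton]
          intro p w hp hw
          generalize (1 + b) / (1 - 3 * b) = u at hwb
          have hu : 0 < u := by
            by_contra! h0
            nlinarith
          have hw0 : 0 < w := by
            by_contra! h0
            rcases hp with rfl | rfl <;> nlinarith
          refine ⟨?_, by linarith⟩
          rintro rfl
          have e : (b - p) * (1 + 3 * u) = 0 := by linear_combination hw - hwb
          rcases mul_eq_zero.1 e with e | e
          · rcases hp with rfl | rfl
            · exact hbs (by linarith)
            · linarith
          · linarith
      · exact F_eq_R_right hx hδ (ih n1 n2 (by omega)) h1 h2 hG' ∅ (by simp) (by simp)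
          (by simp; omega) t
    · obtain ⟨n1, rfl⟩ : ∃ k, n1 = k + 1 := ⟨n1 - 1, by omega⟩
      obtain ⟨t, M, rfl⟩ := List.exists_cons_of_length_pos (l := L1) (by omega)
      have hG' : GenL δ (L2 ++ M) := by
        refine GenL.perm ?_ List.perm_append_comm
        exact ⟨(List.nodup_cons.1 hG.1).2, fun a ha => hG.2 a (List.mem_cons_of_mem _ ha)⟩
      exact F_eq_R_left hδ (ih n1 n2 (by omega)) h2 h1 hG' (by omega) t

end XXZOverlap

namespace XXZOverlap

variable {x : ℝ}

lemma continuous_sumW {g : ℝ → List Bool → ℝ} (m : ℕ) (h : ∀ l, Continuous fun e => g e l) :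
    Continuous fun e => sumW m (g e) := by
  induction m generalizing g with
  | zero => exact h []
  | succ m ih => exact (ih fun l => h _).add (ih fun l => h _)

lemma continuous_wt (α : List Bool) {f : ℝ → ℝ → ℝ} (hf : ∀ a, Continuous fun e => f e a)
    (L : List ℝ) : Continuous fun e => wt α (L.map (f e)) := by
  induction α generalizing L with
  | nil => simpa [wt] using continuous_const
  | cons a α ih =>
    cases L with
    | nil => simpa [wt] using continuous_const
    | cons v L =>
      simp only [List.map_cons, wt]
      refine Continuous.mul ?_ (ih L)
      cases a
      · have := hf v
        simp only [Bool.false_eq_true, if_false]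
        fun_prop
      · simpa using continuous_const

lemma continuous_psi (n : ℕ) (α : List Bool) {f : ℝ → ℝ → ℝ}
    (hf : ∀ a, Continuous fun e => f e a) (L : List ℝ) :
    Continuous fun e => psi x n α (L.map (f e)) := by
  have h : Continuous fun e => toV (L.map (f e)) := by
    refine continuous_pi fun i => ?_
    simp only [toV, List.getD_eq_getElem?_getD, List.getElem?_map]
    cases L[i]? with
    | none => simpa using continuous_const
    | some a => simpa using hf a
  exact (MvPolynomial.continuous_eval (P x n α)).comp h

lemma ratio_map (g : Polynomial ℝ) (L : List ℝ) (f : ℝ → ℝ) : ratio g (L.map f) =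
    detRem g L.length (rootPoly fun i => f (L.get i)) := by
  have e : ((L.map f).map fun a => Polynomial.X - Polynomial.C a).prod =
      rootPoly fun i => f (L.get i) := by
    rw [rootPoly, ← List.prod_ofFn, List.map_map]
    congr 1
    conv_lhs => rw [← List.ofFn_get L, List.map_ofFn]
    rfl
  rw [ratio, e, List.length_map]

lemma continuous_ratio (g : Polynomial ℝ) {f : ℝ → ℝ → ℝ}
    (hf : ∀ a, Continuous fun e => f e a) (L : List ℝ) :
    Continuous fun e => ratio g (L.map (f e)) := by
  obtain ⟨P, hP⟩ := exists_detRem g L.length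
  simp only [ratio_map, hP]
  exact (MvPolynomial.continuous_eval P).comp (continuous_pi fun i => hf _)

lemma continuous_PP (k : ℕ) {f : ℝ → ℝ → ℝ}
    (hf : ∀ a, Continuous fun e => f e a) (L : List ℝ) :
    Continuous fun e => PP k (L.map (f e)) := by
  induction L with
  | nil => simpa [PP] using continuous_const
  | cons s L ih =>
    simp only [List.map_cons, PP_cons]
    have := hf s
    fun_prop

/-- The determinant of the coefficients of the columns `col g j`. -/
def detCoeff (g : Polynomial ℝ) (m : ℕ) : ℝ :=
  Matrix.det (Matrix.of fun i j : Fin m => (col g j).coeff i)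

lemma ratio_replicate (g : Polynomial ℝ) (m : ℕ) : ratio g (List.replicate m 0) = detCoeff g m := by
  have e : List.replicate m (0 : ℝ) = (List.replicate m (0 : ℝ)).map fun _ => 0 := by simp
  rw [e, ratio_map, List.length_replicate]
  exact detRem_zero g m

lemma F_zero_eq (hx : 0 < x) (n1 n2 : ℕ) :
    F x n1 n2 (List.replicate (2 * n1) 0) (List.replicate (2 * n2) 0) =
      cc n1 n2 * detCoeff Polynomial.X (2 * n1) * detCoeff Polynomial.X (2 * n2) *
        detCoeff (gG x) (2 * (n1 + n2)) := by
  obtain ⟨δ, hδ⟩ := exists_radius x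
  set L : List ℝ := (List.range (2 * n1 + 2 * n2)).map fun k : ℕ => (k + 1 : ℝ) with hL
  have hLl : L.length = 2 * n1 + 2 * n2 := by simp [hL]
  have hnd : L.Nodup := by
    refine List.Nodup.map ?_ List.nodup_range
    intro a b h
    simpa using h
  have hmem : ∀ a ∈ L, 0 < a ∧ a ≤ 2 * n1 + 2 * n2 := by
    intro a ha
    obtain ⟨k, hk, rfl⟩ := List.mem_map.1 ha
    have hk := List.mem_range.1 hk
    refine ⟨by positivity, ?_⟩
    exact_mod_cast hk
  set A := L.take (2 * n1) with hA
  set B := L.drop (2 * n1) with hB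
  have hAB : A ++ B = L := List.take_append_drop _ _
  have hAl : A.length = 2 * n1 := by simp [hA, hLl]
  have hBl : B.length = 2 * n2 := by simp [hB, hLl]
  have hf : ∀ a : ℝ, Continuous fun e : ℝ => e * a := fun a => by fun_prop
  have hf' : ∀ a : ℝ, Continuous fun e : ℝ => -(e * a) := fun a => by fun_prop
  have hal : ∀ a : ℝ, Continuous fun e : ℝ => al (e * a) := by
    intro a
    simp only [al]
    refine Continuous.sub (Continuous.div (by fun_prop) (by fun_prop) fun e => ?_) (by fun_prop)
    positivity
  have hFc : Continuous fun e : ℝ => F x n1 n2 (A.map (e * ·)) (B.map (e * ·)) := by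
    unfold F
    refine continuous_sumW _ fun α => continuous_sumW _ fun β => ?_
    simp only [List.map_map, ← List.map_append]
    exact ((((continuous_wt α hf A).mul (continuous_wt β hf B)).mul
      (continuous_psi _ _ hf _)).mul (continuous_psi _ _ hf' A)).mul (continuous_psi _ _ hf' B)
  have hRc : Continuous fun e : ℝ => R x n1 n2 (A.map (e * ·)) (B.map (e * ·)) := by
    unfold R
    simp only [List.map_map, ← List.map_append]
    refine ((((continuous_const.mul ((continuous_PP _ hf A).div (continuous_PP _ hf A)
      fun e => (PP_pos _ _).ne')).mul ((continuous_PP _ hf B).div (continuous_PP _ hf B)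
      fun e => (PP_pos _ _).ne')).mul (continuous_ratio _ hal A)).mul
      (continuous_ratio _ hal B)).mul (continuous_ratio _ hal _)
  have hpos : 0 < δ / (2 * n1 + 2 * n2 + 1) := div_pos hδ.pos (by positivity)
  have heq : ∀ e ∈ Set.Ioo 0 (δ / (2 * n1 + 2 * n2 + 1)),
      F x n1 n2 (A.map (e * ·)) (B.map (e * ·)) = R x n1 n2 (A.map (e * ·)) (B.map (e * ·)) := by
    intro e he
    refine F_eq_R hx hδ _ n1 n2 rfl _ _ (by simp [hAl]) (by simp [hBl]) ?_
    rw [← List.map_append, hAB]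
    refine ⟨hnd.map fun a b h => mul_left_cancel₀ he.1.ne' h, ?_⟩
    intro b hb
    obtain ⟨a, ha, rfl⟩ := List.mem_map.1 hb
    have ha := hmem a ha
    refine ⟨mul_pos he.1 ha.1, ?_⟩
    have h1 := (lt_div_iff₀ (by positivity)).1 he.2
    nlinarith [he.1]
  have h0 : F x n1 n2 (A.map ((0 : ℝ) * ·)) (B.map ((0 : ℝ) * ·)) =
      R x n1 n2 (A.map ((0 : ℝ) * ·)) (B.map ((0 : ℝ) * ·)) := by
    have hcl := closure_minimal (s := Set.Ioo 0 (δ / (2 * n1 + 2 * n2 + 1)))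
      (t := {e | F x n1 n2 (A.map (e * ·)) (B.map (e * ·)) =
        R x n1 n2 (A.map (e * ·)) (B.map (e * ·))}) heq (isClosed_eq hFc hRc)
    rw [closure_Ioo hpos.ne] at hcl
    exact hcl ⟨le_rfl, hpos.le⟩
  have hz : ∀ M : List ℝ, M.map ((0 : ℝ) * ·) = List.replicate M.length 0 := by
    intro M
    simp
  have hPP : ∀ k m, PP k (List.replicate m 0) = 1 := by
    intro k m
    simp [PP]
  have hal0 : al 0 = 0 := by norm_num [al]
  rw [hz, hz, hAl, hBl] at h0
  rw [h0, R, hPP, hPP, hPP, hPP, List.replicate_append_replicate, List.map_replicate,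
    List.map_replicate, List.map_replicate, hal0, ratio_replicate, ratio_replicate,
    ratio_replicate, mul_add]
  ring

end XXZOverlap

namespace XXZOverlap

open Polynomial

lemma det_eq_of_unitriangular {V : Type*} [AddCommGroup V] [Module ℝ V] {m : ℕ}
    (l : Fin m → V →ₗ[ℝ] ℝ) {p q : ℕ → V}
    (h : ∀ j < m, q j - p j ∈ Submodule.span ℝ (p '' Set.Iio j)) :
    Matrix.det (Matrix.of fun i j : Fin m => l i (q j)) =
      Matrix.det (Matrix.of fun i j : Fin m => l i (p j)) := by
  have hc : ∀ j : ℕ, ∃ c : ℕ → ℝ, j < m → q j = p j + ∑ k ∈ Finset.range j, c k • p k := by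
    intro j
    by_cases hj : j < m
    · have := h j hj
      rw [← Finset.coe_range, Submodule.mem_span_image_finset_iff_exists_fun'] at this
      obtain ⟨c, hc⟩ := this
      exact ⟨c, fun _ => by rw [hc]; abel⟩
    · exact ⟨0, fun h => absurd h hj⟩
  choose c hc using hc
  set u : ℕ → ℕ → ℝ := fun k j => if k < j then c j k else if k = j then 1 else 0 with hu
  have hU : (Matrix.of fun k j : Fin m => u k j).det = 1 := by
    rw [Matrix.det_of_isUpperTriangular]
    · simp [hu]
    · intro a b hab
      have hab : (b : ℕ) < a := hab
      rw [Matrix.of_apply, hu]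
      dsimp only
      rw [if_neg hab.not_gt, if_neg hab.ne']
  have hm : (Matrix.of fun i j : Fin m => l i (q j)) =
      (Matrix.of fun i j : Fin m => l i (p j)) * Matrix.of fun k j : Fin m => u k j := by
    ext i j
    simp only [Matrix.mul_apply, Matrix.of_apply]
    rw [Fin.sum_univ_eq_sum_range (fun k => l i (p k) * u k j) m,
      ← Finset.sum_subset (Finset.range_subset_range.2 j.2), Finset.sum_range_succ, hc j j.2]
    · simp only [map_add, map_sum, map_smul, smul_eq_mul, hu, lt_irrefl, if_false, if_true,
        mul_one]
      rw [add_comm]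
      congr 1
      refine Finset.sum_congr rfl fun k hk => ?_
      rw [if_pos (Finset.mem_range.1 hk), mul_comm]
    · intro k _ hk
      have hk : (j : ℕ) < k := by simpa using hk
      simp [hu, hk.ne', hk.not_gt]
  rw [hm, Matrix.det_mul, hU, mul_one]

lemma prod_Iio_fin {m : ℕ} (j : Fin m) (f : ℕ → ℝ) :
    ∏ i ∈ Finset.Iio j, f i = ∏ i ∈ Finset.range j, f i := by
  rw [← Nat.Iio_eq_range, ← Fin.map_valEmbedding_Iio, Finset.prod_map]
  rfl

lemma det_vandermonde_range (m : ℕ) (f : ℕ → ℝ) :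
    (Matrix.vandermonde fun i : Fin m => f i).det =
      ∏ j ∈ Finset.range m, ∏ i ∈ Finset.range j, (f j - f i) := by
  rw [Matrix.det_vandermonde, Finset.prod_comm' (t' := Finset.univ)
    (s' := fun j : Fin m => Finset.Iio j) (by simp),
    ← Fin.prod_univ_eq_prod_range (fun j => ∏ i ∈ Finset.range j, (f j - f i)) m]
  exact Finset.prod_congr rfl fun j _ => prod_Iio_fin j fun i => f j - f i

lemma prod_range_two_mul (k : ℕ) (f : ℕ → ℝ) :
    ∏ i ∈ Finset.range (2 * k), f i = ∏ j ∈ Finset.range k, (f (2 * j) * f (2 * j + 1)) := by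
  induction k with
  | zero => simp
  | succ k ih => rw [mul_add, mul_one, Finset.prod_range_succ, Finset.prod_range_succ, ih,
      Finset.prod_range_succ, mul_assoc]

/-- The sequence `1, 2, 4, 5, 7, 8, …`. -/
def nod (j : ℕ) : ℕ := 3 * (j / 2) + j % 2 + 1

/-- Chebyshev polynomials of the second kind in the variable `X + 2`. -/
def cheb : ℕ → ℝ[X]
  | 0 => 0
  | 1 => 1
  | e + 2 => (X + 2) * cheb (e + 1) - cheb e

lemma cheb_six (e : ℕ) : cheb (e + 6) = (cubic + 2) * cheb (e + 3) - cheb e := by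
  simp only [cheb, cubic]
  rw [show (C 3 : ℝ[X]) = 3 from rfl]
  ring

/-- The product `e (e² - 1²) ⋯ (e² - i²)`. -/
def oddProd (i : ℕ) (e : ℝ) : ℝ := e * ∏ l ∈ Finset.range i, (e ^ 2 - (l + 1 : ℝ) ^ 2)

lemma oddProd_succ (i : ℕ) (e : ℝ) :
    oddProd (i + 1) e = oddProd i e * (e ^ 2 - (i + 1 : ℝ) ^ 2) := by
  rw [oddProd, oddProd, Finset.prod_range_succ, mul_assoc]

lemma oddProd_shift (i : ℕ) (e : ℝ) :
    oddProd (i + 1) (e + 1) = oddProd i e * (e + i + 1) * (e + i + 2) := by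
  induction i with
  | zero => simp [oddProd]; ring
  | succ i ih =>
    rw [oddProd_succ, ih, oddProd_succ]
    push_cast
    ring

lemma oddProd_shift' (i : ℕ) (e : ℝ) :
    oddProd (i + 1) (e - 1) = oddProd i e * (e - i - 1) * (e - i - 2) := by
  induction i with
  | zero => simp [oddProd]; ring
  | succ i ih =>
    rw [oddProd_succ, ih, oddProd_succ]
    push_cast
    ring

lemma cheb_coeff (e i : ℕ) :
    (cheb e).coeff i * ((2 * i + 1).factorial : ℝ) = oddProd i e := by
  induction e using Nat.twoStepInduction generalizing i with
  | zero => simp [cheb, oddProd]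
  | one =>
    cases i with
    | zero => simp [cheb, oddProd]
    | succ i =>
      have : oddProd (i + 1) 1 = 0 := by
        rw [oddProd, Finset.prod_range_succ']
        simp
      simp [this, cheb, coeff_one]
  | more e h0 h1 =>
    rw [cheb, add_mul, coeff_sub, coeff_add, show (2 : ℝ[X]) = C 2 from rfl, coeff_C_mul,
      sub_mul, add_mul, h0, mul_assoc, h1]
    cases i with
    | zero =>
      simp [oddProd]
      ring
    | succ i =>
      have hs : (cheb (e + 1)).coeff i * ((2 * (i + 1) + 1).factorial : ℝ) =
          oddProd i (e + 1 : ℕ) * ((2 * i + 2) * (2 * i + 3)) := by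
        rw [← h1, show 2 * (i + 1) + 1 = (2 * i + 1) + 1 + 1 by ring, Nat.factorial_succ,
          Nat.factorial_succ]
        push_cast
        ring
      have ha := oddProd_shift i (e + 1 : ℕ)
      have hb := oddProd_shift' i (e + 1 : ℕ)
      rw [show ((e + 1 : ℕ) : ℝ) - 1 = (e : ℕ) by push_cast; ring] at hb
      rw [show ((e + 1 : ℕ) : ℝ) + 1 = (e + 2 : ℕ) by push_cast; ring] at ha
      rw [coeff_X_mul, hs, ha, hb, oddProd_succ]
      push_cast
      ring

lemma col_add_two (g : ℝ[X]) (j : ℕ) : col g (j + 2) = cubic * col g j := by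
  rw [col, col, Nat.add_div_right _ two_pos, Nat.add_mod_right, pow_succ]
  ring

lemma cubic_mul_mem {g p : ℝ[X]} {j : ℕ} (h : p ∈ Submodule.span ℝ (col g '' Set.Iio j)) :
    cubic * p ∈ Submodule.span ℝ (col g '' Set.Iio (j + 2)) := by
  induction h using Submodule.span_induction with
  | mem p hp =>
    obtain ⟨i, hi, rfl⟩ := hp
    rw [← col_add_two]
    exact Submodule.subset_span ⟨i + 2, by simpa using hi, rfl⟩
  | zero => simp
  | add p q _ _ hp hq => rw [mul_add]; exact add_mem hp hq
  | smul c p _ hp => rw [mul_smul_comm]; exact Submodule.smul_mem _ _ hp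

lemma cheb_sub_col_mem (j : ℕ) :
    cheb (nod j) - col X j ∈ Submodule.span ℝ (col X '' Set.Iio j) := by
  have hcol : ∀ {i j : ℕ}, i < j → col X i ∈ Submodule.span ℝ (col X '' Set.Iio j) :=
    fun h => Submodule.subset_span ⟨_, h, rfl⟩
  have hC : ∀ (k : ℕ) [k.AtLeastTwo], (C (OfNat.ofNat k) : ℝ[X]) = OfNat.ofNat k := fun _ => rfl
  induction j using Nat.strong_induction_on with
  | _ j ih =>
    match j with
    | 0 => simp [nod, col, cheb]
    | 1 =>
      have e : cheb (nod 1) - col X 1 = (2 : ℝ) • col X 0 := by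
        simp [nod, col, cheb, smul_eq_C_mul, hC]
      rw [e]
      exact Submodule.smul_mem _ _ (hcol (by norm_num))
    | 2 =>
      have e : cheb (nod 2) - col X 2 = col X 1 + (4 : ℝ) • col X 0 := by
        simp [nod, col, cheb, cubic, smul_eq_C_mul, hC]
        ring
      rw [e]
      exact add_mem (hcol (by norm_num)) (Submodule.smul_mem _ _ (hcol (by norm_num)))
    | 3 =>
      have e : cheb (nod 3) - col X 3 =
          (2 : ℝ) • col X 2 + (2 : ℝ) • col X 1 + (5 : ℝ) • col X 0 := by
        simp [nod, col, cheb, cubic, smul_eq_C_mul, hC]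
        ring
      rw [e]
      exact add_mem (add_mem (Submodule.smul_mem _ _ (hcol (by norm_num)))
        (Submodule.smul_mem _ _ (hcol (by norm_num)))) (Submodule.smul_mem _ _ (hcol (by norm_num)))
    | j + 4 =>
      have hch : ∀ i < j + 4, cheb (nod i) ∈ Submodule.span ℝ (col X '' Set.Iio (j + 4)) := by
        intro i hi
        rw [← sub_add_cancel (cheb (nod i)) (col X i)]
        exact add_mem (Submodule.span_mono (Set.image_mono (Set.Iio_subset_Iio hi.le)) (ih i hi))
          (hcol hi)
      have e : cheb (nod (j + 4)) - col X (j + 4) =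
          cubic * (cheb (nod (j + 2)) - col X (j + 2)) + (2 : ℝ) • cheb (nod (j + 2)) -
            cheb (nod j) := by
        rw [show nod (j + 4) = nod j + 6 by simp only [nod]; omega, cheb_six,
          show nod (j + 2) = nod j + 3 by simp only [nod]; omega, col_add_two, smul_eq_C_mul,
          show (C 2 : ℝ[X]) = 2 from rfl]
        ring
      rw [e]
      exact sub_mem (add_mem (cubic_mul_mem (ih (j + 2) (by omega)))
        (Submodule.smul_mem _ _ (hch _ (by omega)))) (hch _ (by omega))

lemma detCoeff_X_eq (m : ℕ) :
    Matrix.det (Matrix.of fun i j : Fin m => (col X j).coeff i) =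
      ∏ j ∈ Finset.range m, ((nod j : ℝ) / ((2 * j + 1).factorial : ℝ) *
        ∏ i ∈ Finset.range j, ((nod j : ℝ) ^ 2 - (nod i : ℝ) ^ 2)) := by
  have h1 := det_eq_of_unitriangular (fun i : Fin m => lcoeff ℝ (i : ℕ)) (p := col X)
    (q := fun j => cheb (nod j)) fun j _ => cheb_sub_col_mem j
  simp only [lcoeff_apply] at h1
  set p : Fin m → ℝ[X] := fun i => ∏ l ∈ Finset.range i, (X - C ((l + 1 : ℝ) ^ 2)) with hp
  have h2 := Matrix.det_eval_matrixOfPolynomials_eq_det_vandermonde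
    (fun j : Fin m => (nod j : ℝ) ^ 2) p
    (fun i => by
      rw [hp, natDegree_prod_of_monic _ _ fun l _ => monic_X_sub_C _]
      simp only [natDegree_X_sub_C]
      simp)
    (fun i => monic_prod_of_monic _ _ fun l _ => monic_X_sub_C _)
  rw [det_vandermonde_range m fun j => (nod j : ℝ) ^ 2] at h2
  rw [← h1, Finset.prod_mul_distrib, h2, ← Matrix.det_transpose,
    ← Fin.prod_univ_eq_prod_range (fun j => (nod j : ℝ) / ((2 * j + 1).factorial : ℝ)) m,
    Finset.prod_div_distrib, div_mul_eq_mul_div, eq_div_iff, mul_comm,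
    ← Matrix.det_mul_row, ← Matrix.det_mul_column]
  · congr 1
    ext j i
    have := cheb_coeff (nod j) i
    simp only [Matrix.of_apply, Matrix.transpose_apply, mul_comm] at this ⊢
    rw [this, oddProd, hp, eval_prod]
    simp
  · exact Finset.prod_ne_zero_iff.2 fun i _ => by positivity

end XXZOverlap

namespace XXZOverlap

lemma prod_range_symm (k : ℕ) (f : ℕ → ℝ) :
    ∏ j ∈ Finset.range k, (f (k - 1 - j) * f (k + j)) = ∏ j ∈ Finset.range (2 * k), f j := by
  rw [Finset.prod_mul_distrib, Finset.prod_range_reflect, two_mul, Finset.prod_range_add]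

lemma prod_nod_even (k : ℕ) :
    ∏ i ∈ Finset.range (2 * k), ((nod (2 * k) : ℝ) ^ 2 - (nod i : ℝ) ^ 2) =
      ∏ j ∈ Finset.range (2 * k), ((3 * j + 2 : ℝ) * (3 * j + 3)) := by
  rw [prod_range_two_mul k fun i => _ - (nod i : ℝ) ^ 2, ← prod_range_symm]
  refine Finset.prod_congr rfl fun j hj => ?_
  have hj := Finset.mem_range.1 hj
  rw [show nod (2 * k) = 3 * k + 1 by simp only [nod]; omega,
    show nod (2 * j) = 3 * j + 1 by simp only [nod]; omega,
    show nod (2 * j + 1) = 3 * j + 2 by simp only [nod]; omega, Nat.sub_sub,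
    Nat.cast_sub (by omega)]
  push_cast
  ring

lemma prod_nod_odd (k : ℕ) :
    ∏ i ∈ Finset.range (2 * k + 1), ((nod (2 * k + 1) : ℝ) ^ 2 - (nod i : ℝ) ^ 2) =
      ∏ j ∈ Finset.range (2 * k + 1), ((3 * j + 1 : ℝ) * (3 * j + 3)) := by
  have h : ∏ i ∈ Finset.range (2 * k), ((nod (2 * k + 1) : ℝ) ^ 2 - (nod i : ℝ) ^ 2) =
      ∏ j ∈ Finset.range (2 * k), ((3 * j + 4 : ℝ) * (3 * j + 3)) := by
    rw [prod_range_two_mul k fun i => _ - (nod i : ℝ) ^ 2, ← prod_range_symm]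
    refine Finset.prod_congr rfl fun j hj => ?_
    have hj := Finset.mem_range.1 hj
    rw [show nod (2 * k + 1) = 3 * k + 2 by simp only [nod]; omega,
      show nod (2 * j) = 3 * j + 1 by simp only [nod]; omega,
      show nod (2 * j + 1) = 3 * j + 2 by simp only [nod]; omega, Nat.sub_sub,
      Nat.cast_sub (by omega)]
    push_cast
    ring
  rw [Finset.prod_range_succ, h, Finset.prod_mul_distrib, Finset.prod_mul_distrib,
    Finset.prod_range_succ', Finset.prod_range_succ,
    show nod (2 * k + 1) = 3 * k + 2 by simp only [nod]; omega,
    show nod (2 * k) = 3 * k + 1 by simp only [nod]; omega]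
  have e : ∀ j : ℕ, (3 * ((j + 1 : ℕ) : ℝ) + 1) = 3 * j + 4 := fun j => by push_cast; ring
  simp only [e]
  push_cast
  ring

lemma prod_three_factorial (m : ℕ) :
    ∏ j ∈ Finset.range m, ((3 * j + 1 : ℝ) * (3 * j + 2) * (3 * j + 3)) =
      ((3 * m).factorial : ℝ) := by
  induction m with
  | zero => simp
  | succ m ih =>
    rw [Finset.prod_range_succ, ih, show 3 * (m + 1) = 3 * m + 1 + 1 + 1 by ring,
      Nat.factorial_succ, Nat.factorial_succ, Nat.factorial_succ]
    push_cast
    ring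

lemma prod_three (m : ℕ) :
    ∏ j ∈ Finset.range m, (3 * j + 3 : ℝ) = 3 ^ m * (m.factorial : ℝ) := by
  induction m with
  | zero => simp
  | succ m ih =>
    rw [Finset.prod_range_succ, ih, Nat.factorial_succ]
    push_cast
    ring

lemma prod_nod_pair (k : ℕ) :
    (∏ i ∈ Finset.range (2 * k), ((nod (2 * k) : ℝ) ^ 2 - (nod i : ℝ) ^ 2)) *
      ∏ i ∈ Finset.range (2 * k + 1), ((nod (2 * k + 1) : ℝ) ^ 2 - (nod i : ℝ) ^ 2) =
    ((6 * k + 1).factorial : ℝ) * (3 ^ (2 * k + 1) * ((2 * k + 1).factorial : ℝ)) := by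
  have h := prod_three_factorial (2 * k)
  have h' := prod_three (2 * k + 1)
  rw [← mul_assoc] at h
  rw [prod_nod_even, prod_nod_odd, Finset.prod_mul_distrib (s := Finset.range (2 * k + 1)), h',
    Finset.prod_range_succ,
    Nat.factorial_succ (6 * k), show 6 * k = 3 * 2 * k by ring, Nat.cast_mul (3 * 2 * k + 1), ← h,
    Finset.prod_mul_distrib,
    Finset.prod_mul_distrib, Finset.prod_mul_distrib]
  push_cast
  ring

lemma gammaN_succ (k : ℕ) : gammaN (2 * (k + 1)) = gammaN (2 * k) *
    (2⁻¹ * (((6 * k + 4).factorial : ℝ) * ((2 * k + 1).factorial : ℝ) /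
      (((4 * k + 2).factorial : ℝ) * ((4 * k + 3).factorial : ℝ)))) := by
  have h : ∀ j, gammaN (2 * j) = ((2:ℝ)⁻¹) ^ j * ∏ i ∈ Finset.Icc 1 j,
      ((Nat.factorial (6*i-2) : ℝ) * (Nat.factorial (2*i-1) : ℝ)) /
        ((Nat.factorial (4*i-2) : ℝ) * (Nat.factorial (4*i-1) : ℝ)) := by
    intro j
    rw [gammaN, if_pos (by omega), Nat.mul_div_cancel_left _ two_pos]
  rw [h, h, Finset.prod_Icc_succ_top (by omega), pow_succ,
    show 6 * (k + 1) - 2 = 6 * k + 4 by omega, show 2 * (k + 1) - 1 = 2 * k + 1 by omega,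
    show 4 * (k + 1) - 2 = 4 * k + 2 by omega, show 4 * (k + 1) - 1 = 4 * k + 3 by omega]
  ring

lemma detCoeff_X_eq_gammaN (k : ℕ) :
    Matrix.det (Matrix.of fun i j : Fin (2 * k) => (col Polynomial.X j).coeff i) =
      9 ^ k.choose 2 * gammaN (2 * k) := by
  rw [detCoeff_X_eq]
  induction k with
  | zero => simp [gammaN]
  | succ k ih =>
    have hp := prod_nod_pair k
    rw [gammaN_succ, show 2 * (k + 1) = 2 * k + 1 + 1 by ring, Finset.prod_range_succ,
      Finset.prod_range_succ, ih, Nat.choose_succ_succ' k 1, Nat.choose_one_right, pow_add]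
    have e1 : (nod (2 * k) : ℝ) = 3 * k + 1 := by
      rw [show nod (2 * k) = 3 * k + 1 by simp only [nod]; omega]
      push_cast
      ring
    have e2 : (nod (2 * k + 1) : ℝ) = 3 * k + 2 := by
      rw [show nod (2 * k + 1) = 3 * k + 2 by simp only [nod]; omega]
      push_cast
      ring
    have f1 : ((6 * k + 4).factorial : ℝ) =
        (6 * k + 4) * (6 * k + 3) * (6 * k + 2) * ((6 * k + 1).factorial : ℝ) := by
      rw [Nat.factorial_succ, Nat.factorial_succ, Nat.factorial_succ]
      push_cast
      ring
    have f2 : ((4 * k + 2).factorial : ℝ) = (4 * k + 2) * ((4 * k + 1).factorial : ℝ) := by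
      rw [Nat.factorial_succ]
      push_cast
      ring
    rw [show 2 * (2 * k) + 1 = 4 * k + 1 by ring, show 2 * (2 * k + 1) + 1 = 4 * k + 3 by ring,
      f1, f2]
    have p1 : ((4 * k + 1).factorial : ℝ) ≠ 0 := by positivity
    have p3 : ((4 * k + 3).factorial : ℝ) ≠ 0 := by positivity
    have h9 : (3 : ℝ) ^ (2 * k + 1) = 3 * 9 ^ k := by
      rw [pow_succ, pow_mul]
      norm_num
      ring
    rw [h9] at hp
    generalize (∏ i ∈ Finset.range (2 * k), ((nod (2 * k) : ℝ) ^ 2 - (nod i : ℝ) ^ 2)) = U at *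
    generalize (∏ i ∈ Finset.range (2 * k + 1), ((nod (2 * k + 1) : ℝ) ^ 2 - (nod i : ℝ) ^ 2)) = V
      at *
    rw [e1, e2]
    generalize ((4 * k + 1).factorial : ℝ) = a at *
    generalize ((4 * k + 3).factorial : ℝ) = b at *
    generalize ((6 * k + 1).factorial : ℝ) = c at *
    generalize ((2 * k + 1).factorial : ℝ) = d at *
    have hk : (4 * k + 2 : ℝ) ≠ 0 := by positivity
    field_simp
    linear_combination 2 * gammaN (2 * k) * (3 * k + 1 : ℝ) * (3 * k + 2) * (4 * k + 2) * hp

end XXZOverlap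

namespace XXZOverlap

lemma det_lower_mul (m : ℕ) (w b : ℕ → ℕ → ℝ) :
    Matrix.det (Matrix.of fun i j : Fin m => ∑ k ∈ Finset.range (i + 1), w i k * b k j) =
      (∏ i ∈ Finset.range m, w i i) * Matrix.det (Matrix.of fun i j : Fin m => b i j) := by
  set W : Matrix (Fin m) (Fin m) ℝ := Matrix.of fun i k => if (k : ℕ) ≤ i then w i k else 0 with hW
  have hd : W.det = ∏ i ∈ Finset.range m, w i i := by
    rw [Matrix.det_of_isLowerTriangular, ← Fin.prod_univ_eq_prod_range (fun i => w i i) m]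
    · exact Finset.prod_congr rfl fun i _ => by simp [hW]
    · intro i j hij
      exact if_neg (not_le.2 hij)
  rw [← hd, ← Matrix.det_mul]
  congr 1
  ext i j
  simp only [Matrix.mul_apply, Matrix.of_apply, hW]
  rw [Fin.sum_univ_eq_sum_range (fun k => (if k ≤ (i : ℕ) then w i k else 0) * b k j) m,
    ← Finset.sum_subset (Finset.range_subset_range.2 i.2)]
  · refine Finset.sum_congr rfl fun k hk => ?_
    rw [if_pos (Nat.lt_succ_iff.1 (Finset.mem_range.1 hk))]
  · intro k _ hk
    rw [if_neg (by simpa using hk), zero_mul]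

/-- The order `0, 2, …, 2n - 2, 2n - 1, …, 3, 1` of `0, …, 2n - 1`. -/
def fold (n a : ℕ) : ℕ := if a < n then 2 * a else 2 * (2 * n - 1 - a) + 1

lemma fold_lt {n a : ℕ} (h : a < 2 * n) : fold n a < 2 * n := by
  rw [fold]
  split_ifs <;> omega

/-- The Kronecker delta. -/
def kron (a b : ℕ) : ℝ := if a = b then 1 else 0

lemma kron_self (a : ℕ) : kron a a = 1 := if_pos rfl

lemma kron_ne {a b : ℕ} (h : a ≠ b) : kron a b = 0 := if_neg h

lemma det_fold (n : ℕ) :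
    Matrix.det (Matrix.of fun i j : Fin (2 * n) => kron (fold n i) j) = 1 := by
  induction n with
  | zero => exact Matrix.det_fin_zero
  | succ n ih =>
    change Matrix.det (Matrix.of fun i j : Fin (2 * n + 1 + 1) =>
      kron (fold (n + 1) i) j) = 1
    rw [Matrix.det_succ_column_zero, Finset.sum_eq_single 0, Matrix.det_succ_column_zero,
      Finset.sum_eq_single (Fin.last _)]
    · simp only [Matrix.of_apply, Matrix.submatrix_apply, Fin.val_zero, Fin.val_last,
        Fin.succAbove_zero, Fin.val_succ, Fin.succAbove_last, Matrix.submatrix_submatrix]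
      have e1 : fold (n + 1) 0 = 0 := by simp [fold]
      have e2 : fold (n + 1) (2 * n + 1) = 0 + 1 := by
        simp only [fold]
        split_ifs <;> omega
      rw [e1, e2, kron_self, kron_self, pow_mul, neg_one_sq, one_pow,
        pow_zero, one_mul, one_mul, one_mul, ← ih]
      congr 1
      ext i j
      simp only [Matrix.submatrix_apply, Matrix.of_apply, Function.comp_apply, Fin.val_succ,
        Fin.val_castSucc, kron]
      congr 1
      have := i.2
      simp only [fold, eq_iff_iff]
      split_ifs <;> omega
    · intro i _ hi
      have h1 : (i : ℕ) ≠ 2 * n := fun h => hi (Fin.ext h)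
      have := i.2
      simp only [Matrix.of_apply, Matrix.submatrix_apply, Fin.val_zero, Fin.succAbove_zero,
        Fin.val_succ]
      rw [kron_ne, mul_zero, zero_mul]
      simp only [fold]
      split_ifs <;> omega
    · simp
    · intro i _ hi
      have h1 : (i : ℕ) ≠ 0 := fun h => hi (Fin.ext h)
      simp only [Matrix.of_apply, Fin.val_zero]
      rw [kron_ne, mul_zero, zero_mul]
      simp only [fold]
      split_ifs <;> omega
    · simp

lemma det_comp_fold (n : ℕ) (b : ℕ → ℕ → ℝ) :
    Matrix.det (Matrix.of fun i j : Fin (2 * n) => b i (fold n j)) =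
      Matrix.det (Matrix.of fun i j : Fin (2 * n) => b i j) := by
  rw [← mul_one (Matrix.det (Matrix.of fun i j : Fin (2 * n) => b i j)), ← det_fold n,
    ← Matrix.det_transpose (Matrix.of fun i j : Fin (2 * n) => kron _ _),
    ← Matrix.det_mul]
  congr 1
  ext i j
  simp only [Matrix.mul_apply, Matrix.of_apply, Matrix.transpose_apply]
  rw [Finset.sum_eq_single ⟨fold n j, fold_lt j.2⟩]
  · simp [kron_self]
  · intro k _ hk
    rw [kron_ne fun h => hk (Fin.ext h.symm), mul_zero]
  · simp

lemma det_block_lower (n : ℕ) (b : ℕ → ℕ → ℝ) (h : ∀ i < n, ∀ j < n, b i (n + j) = 0) :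
    Matrix.det (Matrix.of fun i j : Fin (2 * n) => b i j) =
      Matrix.det (Matrix.of fun i j : Fin n => b i j) *
        Matrix.det (Matrix.of fun i j : Fin n => b (n + i) (n + j)) := by
  rw [two_mul, ← Matrix.det_submatrix_equiv_self finSumFinEquiv]
  rw [← Matrix.det_fromBlocks_zero₁₂ _ (Matrix.of fun i j : Fin n => b (n + i) j)]
  congr 1
  ext (i | i) (j | j)
  · simp
  · simpa [add_comm] using h i i.2 j j.2
  · simp [add_comm]
  · simp [add_comm]

lemma det_coeff_mul (n : ℕ) (u : PowerSeries ℝ) (hu : PowerSeries.constantCoeff u = 1)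
    (d : ℕ → PowerSeries ℝ) :
    Matrix.det (Matrix.of fun i j : Fin n => PowerSeries.coeff i (u * d j)) =
      Matrix.det (Matrix.of fun i j : Fin n => PowerSeries.coeff i (d j)) := by
  have h := det_lower_mul n (fun i k => PowerSeries.coeff (i - k) u)
    (fun k j => PowerSeries.coeff k (d j))
  simp only [Nat.sub_self, PowerSeries.coeff_zero_eq_constantCoeff, hu, Finset.prod_const_one,
    one_mul] at h
  rw [← h]
  congr 1
  ext i j
  simp only [Matrix.of_apply]
  rw [mul_comm, PowerSeries.coeff_mul, Finset.Nat.sum_antidiagonal_eq_sum_range_succ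
    (fun a b => PowerSeries.coeff a (d j) * PowerSeries.coeff b u)]
  exact Finset.sum_congr rfl fun k _ => mul_comm _ _

lemma det_coeff_aeval (m : ℕ) (u : PowerSeries ℝ) (p : ℕ → Polynomial ℝ) :
    Matrix.det (Matrix.of fun i j : Fin m =>
      PowerSeries.coeff i (Polynomial.aeval (PowerSeries.X * u) (p j))) =
      PowerSeries.constantCoeff u ^ m.choose 2 *
        Matrix.det (Matrix.of fun i j : Fin m => (p j).coeff i) := by
  have h := det_lower_mul m (fun i k => PowerSeries.coeff i ((PowerSeries.X * u) ^ k))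
    (fun k j => (p j).coeff k)
  have hd : ∀ i, PowerSeries.coeff i ((PowerSeries.X * u) ^ i) =
      PowerSeries.constantCoeff u ^ i := by
    intro i
    rw [mul_pow, PowerSeries.coeff_X_pow_mul', if_pos le_rfl, Nat.sub_self,
      PowerSeries.coeff_zero_eq_constantCoeff, map_pow]
  simp only [hd] at h
  rw [Nat.choose_two_right, ← Finset.sum_range_id, ← Finset.prod_pow_eq_pow_sum, ← h]
  congr 1
  ext i j
  simp only [Matrix.of_apply]
  rw [Polynomial.aeval_eq_sum_range' (n := (p j).natDegree + 1 + (i + 1)) (by omega), map_sum,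
    ← Finset.sum_subset (Finset.range_subset_range.2 (Nat.le_add_left (i + 1 : ℕ) _))]
  · refine Finset.sum_congr rfl fun k _ => ?_
    rw [map_smul, smul_eq_mul, mul_comm]
  · intro k _ hk
    rw [map_smul, mul_pow, PowerSeries.coeff_X_pow_mul', if_neg (by simpa using hk), smul_zero]

end XXZOverlap

namespace XXZOverlap

open PowerSeries

variable {x : ℝ}

/-- The power series `1 / (1 + X)`. -/
def vs : ℝ⟦X⟧ := (1 + X)⁻¹

lemma vs_mul : vs * (1 + X) = 1 := PowerSeries.inv_mul_cancel _ (by simp)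

/-- The power series `X / (1 + X)³`. -/
def ys : ℝ⟦X⟧ := X * vs ^ 3

/-- The generating series of the columns of the overlap determinant. -/
def ds (x : ℝ) : ℕ → ℝ⟦X⟧
  | 0 => C (x ^ 2 + 1) + C x * X
  | 1 => C ((x - 1) ^ 2) * (2 * X + X ^ 2) + C x * (1 + 6 * X + 5 * X ^ 2 + X ^ 3)
  | j + 2 => X * (X + 3) * ds x (j + 1) + X * ds x j

/-- The series `ds` multiplied by `1 + X`. -/
def fs (x : ℝ) (j : ℕ) : ℝ⟦X⟧ := (1 + X) * ds x j

lemma ys_mul_fs_one : ys * fs x 1 = fs x 0 - ys * fs x 0 - C (x ^ 2 + 1) := by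
  have h : (X : ℝ⟦X⟧) * ds x 1 = (1 + X) ^ 3 * ds x 0 - X * ds x 0 -
      C (x ^ 2 + 1) * (1 + X) ^ 2 := by
    simp only [ds, map_add, map_pow, map_sub, map_one]
    ring
  have hv : vs ^ 2 * (1 + X) ^ 2 = 1 := by rw [← mul_pow, vs_mul, one_pow]
  have hv3 : vs ^ 3 * (1 + X) = vs ^ 2 := by rw [pow_succ, mul_assoc, vs_mul, mul_one]
  simp only [ys, fs]
  linear_combination vs ^ 2 * h + (X * ds x 1 + X * ds x 0) * hv3 +
    ((1 + X) * ds x 0 - C (x ^ 2 + 1)) * hv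

lemma ys_mul_fs_two :
    ys * fs x 2 = fs x 1 - 3 * (ys * fs x 1) - 2 * (ys * fs x 0) - C x := by
  have h : (X : ℝ⟦X⟧) * ds x 2 = (1 + X) ^ 3 * ds x 1 - 3 * (X * ds x 1) - 2 * (X * ds x 0) -
      C x * (1 + X) ^ 2 := by
    simp only [ds, map_add, map_pow, map_sub, map_one]
    ring
  have hv : vs ^ 2 * (1 + X) ^ 2 = 1 := by rw [← mul_pow, vs_mul, one_pow]
  have hv3 : vs ^ 3 * (1 + X) = vs ^ 2 := by rw [pow_succ, mul_assoc, vs_mul, mul_one]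
  simp only [ys, fs]
  linear_combination vs ^ 2 * h + (X * ds x 2 + 3 * X * ds x 1 + 2 * X * ds x 0) * hv3 +
    ((1 + X) * ds x 1 - C x) * hv

lemma ys_mul_fs_add_three (j : ℕ) :
    ys * fs x (j + 3) = fs x (j + 2) - 3 * (ys * fs x (j + 2)) - 3 * (ys * fs x (j + 1)) -
      ys * fs x j := by
  have h : X * (ds x (j + 3) + 3 * ds x (j + 2) + 3 * ds x (j + 1) + ds x j) =
      (1 + X) ^ 3 * ds x (j + 2) := by
    simp only [ds]
    ring
  have hv : vs ^ 3 * (1 + X) ^ 3 = 1 := by rw [← mul_pow, vs_mul, one_pow]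
  simp only [ys, fs]
  linear_combination vs ^ 3 * (1 + X) * h + (1 + X) * ds x (j + 2) * hv

/-- The span of `1, y, …, yⁿ⁻¹` and `yⁿ f, yⁿ⁻¹ f, …, yⁿ⁻ʲ⁺¹ f`. -/
def spanY (x : ℝ) (n j : ℕ) : Submodule ℝ ℝ⟦X⟧ :=
  Submodule.span ℝ ({p | ∃ k < n, p = ys ^ k} ∪ {p | ∃ i < j, p = ys ^ (n - i) * fs x 0})

lemma ys_pow_mem {n k : ℕ} (j : ℕ) (h : k < n) : ys ^ k ∈ spanY x n j :=
  Submodule.subset_span (Or.inl ⟨k, h, rfl⟩)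

lemma ys_pow_mul_mem {j i : ℕ} (n : ℕ) (h : i < j) : ys ^ (n - i) * fs x 0 ∈ spanY x n j :=
  Submodule.subset_span (Or.inr ⟨i, h, rfl⟩)

lemma spanY_mono {n i j : ℕ} (h : i ≤ j) : spanY x n i ≤ spanY x n j := by
  refine Submodule.span_mono ?_
  rintro p (⟨k, hk, rfl⟩ | ⟨k, hk, rfl⟩)
  · exact Or.inl ⟨k, hk, rfl⟩
  · exact Or.inr ⟨k, by omega, rfl⟩

lemma spanY_succ (n j : ℕ) : spanY x n j ≤ spanY x (n + 1) (j + 1) := by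
  refine Submodule.span_mono ?_
  rintro p (⟨k, hk, rfl⟩ | ⟨k, hk, rfl⟩)
  · exact Or.inl ⟨k, by omega, rfl⟩
  · exact Or.inr ⟨k + 1, by omega, by rw [Nat.add_sub_add_right]⟩

lemma fs_sub_mem (j : ℕ) : ∀ n, j ≤ n →
    ys ^ n * fs x j - ys ^ (n - j) * fs x 0 ∈ spanY x n j := by
  induction j using Nat.strong_induction_on with
  | _ j ih =>
    intro n hn
    have hmem : ∀ i < j, ys ^ n * fs x i ∈ spanY x n j := by
      intro i hi
      rw [← sub_add_cancel (ys ^ n * fs x i) (ys ^ (n - i) * fs x 0)]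
      exact add_mem (spanY_mono hi.le (ih i hi n (by omega))) (ys_pow_mul_mem n hi)
    match j, n with
    | 0, n => simp
    | 1, n + 1 =>
      have e : ys ^ (n + 1) * fs x 1 - ys ^ (n + 1 - 1) * fs x 0 =
          -(ys ^ (n + 1) * fs x 0) - (x ^ 2 + 1) • ys ^ n := by
        rw [smul_eq_C_mul, Nat.add_sub_cancel]
        linear_combination ys ^ n * ys_mul_fs_one (x := x)
      rw [e]
      exact sub_mem (neg_mem (hmem 0 (by omega))) (Submodule.smul_mem _ _ (ys_pow_mem _ (by omega)))
    | 2, n + 1 =>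
      have e : ys ^ (n + 1) * fs x 2 - ys ^ (n + 1 - 2) * fs x 0 =
          (ys ^ n * fs x 1 - ys ^ (n - 1) * fs x 0) - (3 : ℝ) • (ys ^ (n + 1) * fs x 1) -
            (2 : ℝ) • (ys ^ (n + 1) * fs x 0) - x • ys ^ n := by
        rw [smul_eq_C_mul, smul_eq_C_mul, smul_eq_C_mul, map_ofNat, map_ofNat,
          show n + 1 - 2 = n - 1 by omega]
        linear_combination ys ^ n * ys_mul_fs_two (x := x)
      rw [e]
      exact sub_mem (sub_mem (sub_mem (spanY_succ _ _ (ih 1 (by omega) n (by omega)))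
        (Submodule.smul_mem _ _ (hmem 1 (by omega)))) (Submodule.smul_mem _ _ (hmem 0 (by omega))))
        (Submodule.smul_mem _ _ (ys_pow_mem _ (by omega)))
    | j + 3, n + 1 =>
      have e : ys ^ (n + 1) * fs x (j + 3) - ys ^ (n + 1 - (j + 3)) * fs x 0 =
          (ys ^ n * fs x (j + 2) - ys ^ (n - (j + 2)) * fs x 0) -
            (3 : ℝ) • (ys ^ (n + 1) * fs x (j + 2)) - (3 : ℝ) • (ys ^ (n + 1) * fs x (j + 1)) -
              ys ^ (n + 1) * fs x j := by
        rw [smul_eq_C_mul, smul_eq_C_mul, map_ofNat,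
          show n + 1 - (j + 3) = n - (j + 2) by omega]
        linear_combination ys ^ n * ys_mul_fs_add_three (x := x) j
      rw [e]
      exact sub_mem (sub_mem (sub_mem (spanY_succ _ _ (ih (j + 2) (by omega) n (by omega)))
        (Submodule.smul_mem _ _ (hmem _ (by omega)))) (Submodule.smul_mem _ _ (hmem _ (by omega))))
        (hmem _ (by omega))

lemma det_coeff_ys (n : ℕ) :
    Matrix.det (Matrix.of fun i j : Fin (2 * n) =>
      coeff i (ys ^ ((j : ℕ) / 2 + (j : ℕ) % 2) * fs x 0 ^ ((j : ℕ) % 2))) =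
      Matrix.det (Matrix.of fun i j : Fin n => coeff i (ds x j)) := by
  set p : ℕ → ℝ⟦X⟧ := fun k => if k < n then ys ^ k else ys ^ (2 * n - k) * fs x 0 with hp
  set q : ℕ → ℝ⟦X⟧ := fun k => if k < n then ys ^ k else ys ^ n * fs x (k - n) with hq
  have h1 := det_comp_fold n
    (fun i j => coeff i (ys ^ (j / 2 + j % 2) * fs x 0 ^ (j % 2)))
  have h2 : (Matrix.of fun i j : Fin (2 * n) => coeff i (ys ^ (fold n j / 2 + fold n j % 2) *
      fs x 0 ^ (fold n j % 2))) = Matrix.of fun i j : Fin (2 * n) => coeff i (p j) := by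
    ext i j
    simp only [Matrix.of_apply, hp, fold]
    have := j.2
    split_ifs with hj
    · rw [Nat.mul_div_cancel_left _ two_pos, Nat.mul_mod_right, pow_zero, mul_one, add_zero]
    · rw [show (2 * (2 * n - 1 - (j : ℕ)) + 1) / 2 + (2 * (2 * n - 1 - (j : ℕ)) + 1) % 2 =
        2 * n - j by omega, show (2 * (2 * n - 1 - (j : ℕ)) + 1) % 2 = 1 by omega, pow_one]
  have h3 := det_eq_of_unitriangular (fun i : Fin (2 * n) => coeff (R := ℝ) (i : ℕ)) (p := p)
    (q := q) (by
      intro j hj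
      simp only [hp, hq]
      split_ifs with hjn
      · simp
      · have h := fs_sub_mem (x := x) (j - n) n (by omega)
        rw [show n - (j - n) = 2 * n - j by omega] at h
        refine Submodule.span_mono ?_ h
        rintro r (⟨k, hk, rfl⟩ | ⟨k, hk, rfl⟩)
        · exact ⟨k, Set.mem_Iio.2 (by omega), if_pos hk⟩
        · refine ⟨n + k, Set.mem_Iio.2 (by omega), ?_⟩
          dsimp only
          rw [if_neg (by omega), show 2 * n - (n + k) = n - k by omega])
  rw [← h1, h2, ← h3, det_block_lower n fun i j => coeff i (q j)]
  · have hA : Matrix.det (Matrix.of fun i j : Fin n => coeff i (q j)) = 1 := by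
      have hc : ∀ i j : ℕ, coeff i (ys ^ j) = if j ≤ i then coeff (i - j) ((vs ^ 3) ^ j) else 0 :=
        fun i j => by rw [ys, mul_pow, coeff_X_pow_mul']
      have hv : constantCoeff vs = 1 := by simp [vs]
      rw [Matrix.det_of_isLowerTriangular]
      · refine Finset.prod_eq_one fun i _ => ?_
        simp [hq, hc, hv]
      · intro i j hij
        have hij : (i : ℕ) < j := hij
        simp only [Matrix.of_apply, hq, if_pos j.2, hc]
        exact if_neg hij.not_ge
    rw [hA, one_mul, ← det_coeff_mul n ((vs ^ 3) ^ n * (1 + X)) (by simp [vs])]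
    congr 1
    ext i j
    simp only [Matrix.of_apply, hq]
    rw [if_neg (by omega), ys, mul_pow, Nat.add_sub_cancel_left, fs, mul_assoc, add_comm n,
      coeff_X_pow_mul, mul_assoc]
  · intro i hi j hj
    simp only [hq]
    rw [if_neg (by omega), ys, mul_pow, mul_assoc, coeff_X_pow_mul', if_neg (by omega)]

end XXZOverlap

namespace XXZOverlap

open PowerSeries

variable {x : ℝ}

lemma aeval_cubic : Polynomial.aeval (X * (C (-3) * vs)) cubic = C (-27) * ys := by
  have h : X * vs = 1 - vs := by linear_combination vs_mul
  simp only [cubic, map_mul, map_pow, map_add, Polynomial.aeval_X, map_neg, map_ofNat, ys]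
  linear_combination (27 * (X * vs)) * (1 - X * vs + vs) * h

lemma aeval_gG : Polynomial.aeval (X * (C (-3) * vs)) (gG x) = C (-9) * (ys * fs x 0) := by
  have h : X * vs = 1 - vs := by linear_combination vs_mul
  have hv3 : vs ^ 3 * (1 + X) = vs ^ 2 := by rw [pow_succ, mul_assoc, vs_mul, mul_one]
  simp only [gG, map_mul, map_pow, map_add, map_sub, Polynomial.aeval_X, Polynomial.aeval_C,
    PowerSeries.algebraMap_apply, Algebra.algebraMap_self, RingHom.id_apply, map_neg, map_ofNat, ys,
    fs, ds, map_one]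
  linear_combination (9 * X * ((C x ^ 2 + 1) + C x * X)) * hv3 + 9 * (C x ^ 2 + 1) * X * vs * h

lemma prod_scal (n : ℕ) :
    ∏ j ∈ Finset.range (2 * n), ((-27 : ℝ) ^ (j / 2) * (-9) ^ (j % 2)) =
      (-9) ^ n * 729 ^ n.choose 2 := by
  induction n with
  | zero => simp
  | succ n ih =>
    have h : (729 : ℝ) ^ n = (-27) ^ n * (-27) ^ n := by rw [← mul_pow]; norm_num
    rw [Nat.mul_succ, Finset.prod_range_succ, Finset.prod_range_succ, ih,
      show (2 * n + 1) / 2 = n by omega, show (2 * n + 1) % 2 = 1 by omega,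
      Nat.mul_div_cancel_left _ two_pos, Nat.mul_mod_right, Nat.choose_succ_succ' n 1,
      Nat.choose_one_right, pow_add 729, h]
    ring

lemma choose_two_mul (n : ℕ) : (2 * n).choose 2 = n + 4 * n.choose 2 := by
  induction n with
  | zero => rfl
  | succ n ih =>
    rw [Nat.mul_succ, Nat.choose_succ_succ' (2 * n + 1) 1, Nat.choose_succ_succ' (2 * n) 1, ih,
      Nat.choose_succ_succ' n 1]
    simp only [Nat.choose_one_right]
    ring

lemma detCoeff_gG (x : ℝ) (n : ℕ) : detCoeff (gG x) (2 * n) = 3 ^ n * 9 ^ n.choose 2 *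
    Matrix.det (Matrix.of fun i j : Fin n => coeff i (ds x j)) := by
  have h := det_coeff_aeval (2 * n) (C (-3) * vs) (col (gG x))
  have hv : constantCoeff vs = 1 := by simp [vs]
  have e : (Matrix.of fun i j : Fin (2 * n) => coeff (R := ℝ) i
      (Polynomial.aeval (X * (C (-3) * vs)) (col (gG x) j))) = Matrix.of fun i j =>
      (fun j : Fin (2 * n) => ((-27 : ℝ) ^ ((j : ℕ) / 2) * (-9) ^ ((j : ℕ) % 2))) j *
      (Matrix.of fun i j : Fin (2 * n) =>
        coeff i (ys ^ ((j : ℕ) / 2 + (j : ℕ) % 2) * fs x 0 ^ ((j : ℕ) % 2))) i j := by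
    ext i j
    simp only [Matrix.of_apply]
    rw [col, map_mul, map_pow, map_pow, aeval_cubic, aeval_gG, ← coeff_C_mul]
    congr 1
    rw [map_mul, map_pow, map_pow]
    ring
  rw [e, Matrix.det_mul_row, Fin.prod_univ_eq_prod_range
    (fun j => (-27 : ℝ) ^ (j / 2) * (-9) ^ (j % 2)), prod_scal, det_coeff_ys, map_mul, hv,
    constantCoeff_C, mul_one, choose_two_mul, pow_add, pow_mul] at h
  have h3 : ((-3 : ℝ) ^ n * ((-3) ^ 4) ^ n.choose 2) ≠ 0 := by positivity
  refine mul_left_cancel₀ h3 ?_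
  rw [detCoeff, ← h, show (729 : ℝ) = (-3) ^ 4 * 9 by norm_num,
    show (-9 : ℝ) = (-3) * 3 by norm_num, mul_pow, mul_pow]
  ring

end XXZOverlap

namespace XXZOverlap

open PowerSeries

variable {x : ℝ}

lemma zchoose_natCast (a b : ℕ) : zchoose a b = a.choose b := by
  unfold zchoose
  split_ifs with h
  · simp
  · rw [Nat.choose_eq_zero_of_lt (by omega)]
    rfl

lemma zchoose_neg (a b : ℤ) (h : b < 0) : zchoose a b = 0 := if_neg (by omega)

lemma zchoose_succ (a : ℕ) (b : ℤ) : zchoose (a + 1) b = zchoose a (b - 1) + zchoose a b := by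
  obtain h | rfl | h := lt_trichotomy b 0
  · rw [zchoose_neg _ _ h, zchoose_neg _ _ h, zchoose_neg _ _ (by omega), add_zero]
  · rw [zchoose_neg _ (0 - 1) (by omega)]
    simp [zchoose]
    positivity
  · obtain ⟨k, rfl⟩ : ∃ k : ℕ, b = k + 1 := ⟨(b - 1).toNat, by omega⟩
    rw [add_sub_cancel_right]
    exact_mod_cast by simp only [zchoose_natCast, Nat.choose_succ_succ']; push_cast; rfl

lemma zchoose_add_three (a : ℕ) (b : ℤ) : zchoose (a + 3) b =
    zchoose a b + 3 * zchoose (a + 1) (b - 1) + zchoose a (b - 3) := by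
  have h1 := zchoose_succ (a + 2) b
  have h2 := zchoose_succ (a + 1) b
  have h3 := zchoose_succ (a + 1) (b - 1)
  have h4 := zchoose_succ a b
  have h5 := zchoose_succ a (b - 1)
  have h6 := zchoose_succ a (b - 2)
  push_cast at *
  simp only [add_assoc, sub_sub] at *
  norm_num at *
  linarith

/-- The entries of the overlap determinant. -/
def entry (x : ℝ) (i j : ℤ) : ℝ :=
  (x - 1) ^ 2 * (zchoose (i + j) (2 * j - i) : ℝ) +
    x * (zchoose (i + j + 2) (2 * j - i + 1) : ℝ)

lemma zchoose_eq_zero {a b : ℤ} (h : a < b) : zchoose a b = 0 := if_neg (by omega)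

lemma entry_succ_succ (x : ℝ) (i j : ℕ) :
    entry x (i + 1) (j + 2) =
      3 * entry x i (j + 1) + entry x (i - 1) (j + 1) + entry x i j := by
  have h1 := zchoose_add_three (i + j) (2 * j + 3 - i)
  have h2 := zchoose_add_three (i + j + 2) (2 * j + 4 - i)
  have e1 : entry x (i + 1) (j + 2) = (x - 1) ^ 2 * zchoose (i + j + 3) (2 * j + 3 - i) +
      x * zchoose (i + j + 2 + 3) (2 * j + 4 - i) := by
    unfold entry; congr! 4 <;> ring_nf
  have e2 : entry x i (j + 1) = (x - 1) ^ 2 * zchoose (i + j + 1) (2 * j + 3 - i - 1) +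
      x * zchoose (i + j + 2 + 1) (2 * j + 4 - i - 1) := by
    unfold entry; congr! 4 <;> ring_nf
  have e3 : entry x (i - 1) (j + 1) = (x - 1) ^ 2 * zchoose (i + j) (2 * j + 3 - i) +
      x * zchoose (i + j + 2) (2 * j + 4 - i) := by
    unfold entry; congr! 4 <;> ring_nf
  have e4 : entry x i j = (x - 1) ^ 2 * zchoose (i + j) (2 * j + 3 - i - 3) +
      x * zchoose (i + j + 2) (2 * j + 4 - i - 3) := by
    unfold entry; congr! 4 <;> ring_nf
  push_cast at h1 h2
  rw [e1, e2, e3, e4, h1, h2]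
  push_cast
  ring

lemma entry_neg_one (x : ℝ) (j : ℕ) : entry x (-1) (j + 1) = 0 := by
  rw [entry, zchoose_eq_zero (by omega), zchoose_eq_zero (by omega)]
  simp

lemma entry_zero_add_two (x : ℝ) (j : ℕ) : entry x 0 (j + 2) = 0 := by
  simp [entry, zchoose_eq_zero (show ((j + 2) : ℤ) < 2 * (j + 2) by omega),
    zchoose_eq_zero (show ((j + 2) + 2 : ℤ) < 2 * (j + 2) + 1 by omega)]

lemma coeff_cubic_series (a b c d : ℝ) (i : ℕ) :
    coeff i (C a * X ^ 0 + C b * X ^ 1 + C c * X ^ 2 + C d * X ^ 3) =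
      (if i = 0 then a else 0) + (if i = 1 then b else 0) + (if i = 2 then c else 0) +
        if i = 3 then d else 0 := by
  simp only [map_add, coeff_C_mul_X_pow]

lemma coeff_ds (x : ℝ) (j : ℕ) : ∀ i : ℕ, coeff i (ds x j) = entry x i j := by
  induction j using Nat.twoStepInduction with
  | zero =>
    intro i
    have e : ds x 0 = C (x ^ 2 + 1) * X ^ 0 + C x * X ^ 1 + C 0 * X ^ 2 + C 0 * X ^ 3 := by
      simp [ds]
    rw [e, coeff_cubic_series]
    match i with
    | 0 => norm_num [entry, zchoose]; ring
    | 1 => norm_num [entry, zchoose]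
    | i + 2 =>
      rw [entry, zchoose_neg _ _ (by push_cast; omega), zchoose_neg _ _ (by push_cast; omega)]
      simp
  | one =>
    intro i
    have e : ds x 1 = C x * X ^ 0 + C (2 * (x - 1) ^ 2 + 6 * x) * X ^ 1 +
        C ((x - 1) ^ 2 + 5 * x) * X ^ 2 + C x * X ^ 3 := by
      simp only [ds, map_add, map_mul, map_ofNat]
      ring
    rw [e, coeff_cubic_series]
    match i with
    | 0 => norm_num [entry, zchoose]
    | 1 =>
      rw [entry, show zchoose _ _ = 2 from rfl, show zchoose _ _ = 6 from rfl]
      norm_num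
      ring
    | 2 => norm_num [entry, zchoose, Nat.choose]; ring
    | 3 => norm_num [entry, zchoose]
    | i + 4 =>
      rw [entry, zchoose_neg _ _ (by push_cast; omega), zchoose_neg _ _ (by push_cast; omega)]
      simp
  | more j ih0 ih1 =>
    intro i
    have e : ds x (j + 2) = X * (X * ds x (j + 1) + 3 * ds x (j + 1) + ds x j) := by
      rw [ds]; ring
    match i with
    | 0 =>
      rw [e, coeff_zero_X_mul]
      exact (entry_zero_add_two x j).symm
    | i + 1 =>
      rw [e, coeff_succ_X_mul, map_add, map_add, ih0, ← map_ofNat (C (R := ℝ)), coeff_C_mul, ih1]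
      have h := entry_succ_succ x i j
      push_cast at h ⊢
      rw [h]
      have h' : coeff i (X * ds x (j + 1)) = entry x (i - 1) (j + 1) := by
        match i with
        | 0 => simpa using (entry_neg_one x j).symm
        | i + 1 => rw [coeff_succ_X_mul, ih1]; push_cast; congr 1; ring
      rw [h']
      ring

end XXZOverlap

namespace XXZOverlap

variable {x : ℝ}

lemma IsGroundState.eq_Zv_of_eq (hx : 0 < x) {n N : ℕ} (hN : N = n + n) {ψ : Conf N → ℂ}
    (h : IsGroundState N x ψ) : ψ = Zv x n := by
  subst hN
  exact IsGroundState.eq_Zv hx n h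

lemma word_append {M N : ℕ} (α : Conf M) (β : Conf N) :
    word (Fin.append α β) = word α ++ word β := by
  rw [word, word, word, ← List.ofFn_fin_append]
  congr 1
  ext i
  refine Fin.addCases (fun j => ?_) (fun j => ?_) i <;> simp

lemma sum_word (N : ℕ) (g : List Bool → ℝ) : ∑ α : Conf N, g (word α) = sumW N g := by
  induction N generalizing g with
  | zero => simp [word, sumW]
  | succ N ih =>
    rw [sumW, ← ih, ← ih, ← (Fin.consEquiv fun _ : Fin (N + 1) => Fin 2).sum_comp,
      Fintype.sum_prod_type, Fin.sum_univ_two, add_comm]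
    simp [word, List.ofFn_succ, Fin.consEquiv]

lemma psi_replicate_zero (x : ℝ) (n m : ℕ) (α : List Bool) :
    psi x n α (List.replicate m 0) = Z x n α := by
  rw [psi, Z]
  congr 2
  ext i
  simp only [toV, List.getD_eq_getElem?_getD, List.getElem?_replicate]
  split_ifs <;> rfl

lemma wt_replicate_zero (α : List Bool) (m : ℕ) : wt α (List.replicate m 0) = 1 := by
  induction α generalizing m with
  | nil => simp [wt]
  | cons a α ih =>
    cases m with
    | zero => simp [wt]
    | succ m => simp [List.replicate_succ, wt, ih]

lemma overlap_Zv (x : ℝ) (n1 n2 : ℕ) :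
    overlap (2 * n1) (2 * n2) (Zv x (n1 + n2)) (Zv x n1) (Zv x n2) =
      (F x n1 n2 (List.replicate (2 * n1) 0) (List.replicate (2 * n2) 0) : ℂ) := by
  have h : F x n1 n2 (List.replicate (2 * n1) 0) (List.replicate (2 * n2) 0) =
      ∑ α : Conf (2 * n1), ∑ β : Conf (2 * n2),
        Z x (n1 + n2) (word (Fin.append α β)) * Z x n1 (word α) * Z x n2 (word β) := by
    simp only [F, word_append, List.map_replicate, neg_zero, List.replicate_append_replicate,
      psi_replicate_zero, wt_replicate_zero, one_mul]
    rw [← sum_word]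
    exact Finset.sum_congr rfl fun α _ => (sum_word _ _).symm
  rw [h, overlap]
  push_cast
  rfl

lemma F_zero_eq_det (hx : 0 < x) (n1 n2 : ℕ) :
    F x n1 n2 (List.replicate (2 * n1) 0) (List.replicate (2 * n2) 0) =
      gammaN (2 * n1) * gammaN (2 * n2) *
        Matrix.det (Matrix.of fun i j : Fin (n1 + n2) => entry x i j) := by
  rw [F_zero_eq hx, detCoeff_gG, detCoeff, detCoeff, detCoeff_X_eq_gammaN, detCoeff_X_eq_gammaN,
    cc, pow_add 9, pow_add 9]
  simp only [coeff_ds]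
  field_simp

end XXZOverlap

/-- **Theorem 1.1 (even-even case).** For `x > 0` and even `N1, N2 ≥ 0`, with
`n = (N1+N2)/2`, the ground-state overlap is
`O_{N1,N2} = γ_{N1} γ_{N2} det_{i,j=1}^n ((x−1)² C(i+j−2,2j−i−1) + x C(i+j,2j−i))`. -/
theorem overlap_even_even (x : ℝ) (hx : 0 < x) (N1 N2 : ℕ)
    (hN1 : Even N1) (hN2 : Even N2)
    (ψ1 : Conf N1 → ℂ) (ψ2 : Conf N2 → ℂ) (ψ : Conf (N1+N2) → ℂ)
    (hψ1 : IsGroundState N1 x ψ1) (hψ2 : IsGroundState N2 x ψ2)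
    (hψ : IsGroundState (N1+N2) x ψ) :
    overlap N1 N2 ψ ψ1 ψ2 =
      ((gammaN N1 * gammaN N2 *
        Matrix.det (Matrix.of fun i j : Fin ((N1+N2)/2) =>
          (x-1)^2 * (zchoose ((i.1 : ℤ) + j.1) (2*(j.1 : ℤ) - i.1) : ℝ)
          + x * (zchoose ((i.1 : ℤ) + j.1 + 2) (2*(j.1 : ℤ) - i.1 + 1) : ℝ)) : ℝ) : ℂ) := by
  obtain ⟨n1, rfl⟩ := even_iff_exists_two_mul.1 hN1
  obtain ⟨n2, rfl⟩ := even_iff_exists_two_mul.1 hN2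
  rw [XXZOverlap.IsGroundState.eq_Zv_of_eq hx (two_mul n1) hψ1,
    XXZOverlap.IsGroundState.eq_Zv_of_eq hx (two_mul n2) hψ2,
    XXZOverlap.IsGroundState.eq_Zv_of_eq hx (by ring : _ = (n1 + n2) + (n1 + n2)) hψ,
    XXZOverlap.overlap_Zv, XXZOverlap.F_zero_eq_det hx, ← Nat.mul_add,
    Nat.mul_div_cancel_left _ two_pos]
  rfl

end
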